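/- In the normalized setting, fix z ∈ (0, 1/3] and let v(x,y) := ∫_{−z}^{z} u(x+s, y) ds. Then there exists a constant C̃ ≥ 1, depending only on N, z and β (in particular, not on γ or u), such that sup_{[0,1]×B_1(0)} v ≤ C̃ · inf_{[0,1]×B_1(0)} u. -/

import Mathlib

open MeasureTheory Set Metric ProbabilityTheory

noncomputable section

/-- `ℝ^{N-1}`, the space of the variable `y`. -/
abbrev Euc (N : ℕ) : Type := EuclideanSpace ℝ (Fin (N - 1))

/-- The partial derivative `∂φ/∂x` of a function on `ℝ × ℝ^{N-1}`. -/
def dX {N : ℕ} (φ : ℝ × Euc N → ℝ) (p : ℝ × Euc N) : ℝ :=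
  fderiv ℝ φ p (1, 0)

/-- The Laplacian `Δ_y` in the `y`-variables. -/
def lapY {N : ℕ} (φ : ℝ × Euc N → ℝ) (p : ℝ × Euc N) : ℝ :=
  ∑ i : Fin (N - 1),
    fderiv ℝ (fun q => fderiv ℝ φ q ((0 : ℝ), EuclideanSpace.single i (1 : ℝ))) p
      ((0 : ℝ), EuclideanSpace.single i (1 : ℝ))

/-- `u` is a distributional solution of `Δ_y u + β(y) u_x + γ(x,y) u = 0` on `S`:
for every test function `φ ∈ C_c^∞(S)`, `∫_S u · (Δ_y φ − β φ_x + γ φ) = 0`. -/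
def IsDistribSolution {N : ℕ} (S : Set (ℝ × Euc N)) (β : Euc N → ℝ)
    (γ u : ℝ × Euc N → ℝ) : Prop :=
  ∀ φ : ℝ × Euc N → ℝ, ContDiff ℝ (⊤ : ℕ∞) φ → HasCompactSupport φ → tsupport φ ⊆ S →
    ∫ p in S, u p * (lapY φ p - β p.2 * dX φ p + γ p * φ p) = 0

/-- The cylinder `(−5,6) × B_3(0)` of the normalized setting. -/
def cylD (N : ℕ) : Set (ℝ × Euc N) := Ioo (-5 : ℝ) 6 ×ˢ ball (0 : Euc N) 3

/-- `‖β‖_∞ := sup_{B_3(0)} |β|`. -/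
def supNormβ {N : ℕ} (β : Euc N → ℝ) : ℝ := sSup ((fun y => |β y|) '' ball (0 : Euc N) 3)

/-- `A_d^+ := {y ∈ B_1(0) | β(y) > d}`. -/
def Aplus {N : ℕ} (β : Euc N → ℝ) (d : ℝ) : Set (Euc N) :=
  {y ∈ ball (0 : Euc N) 1 | d < β y}

/-- `A_d^− := {y ∈ B_1(0) | −β(y) > d}`. -/
def Aminus {N : ℕ} (β : Euc N → ℝ) (d : ℝ) : Set (Euc N) :=
  {y ∈ ball (0 : Euc N) 1 | d < -β y}

open Filter Topology

section Calculus

/-- Powers of the positive part are differentiable. -/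
theorem hasDerivAt_posPart_pow (n : ℕ) (s : ℝ) :
    HasDerivAt (fun s : ℝ => max s 0 ^ (n + 2)) ((n + 2 : ℕ) * max s 0 ^ (n + 1)) s := by
  rcases lt_trichotomy s 0 with hs | rfl | hs
  · have h : (fun s : ℝ => max s 0 ^ (n + 2)) =ᶠ[𝓝 s] fun _ => (0 : ℝ) := by
      filter_upwards [Iio_mem_nhds hs] with t ht
      simp [max_eq_right (le_of_lt (mem_Iio.1 ht))]
    rw [max_eq_right hs.le]
    simpa using (hasDerivAt_const s (0 : ℝ)).congr_of_eventuallyEq h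
  · have h : (fun s : ℝ => max s 0 ^ (n + 2)) =o[𝓝 0] fun s : ℝ => s := by
      have h1 : (fun s : ℝ => max s 0 ^ (n + 2)) =O[𝓝 0] fun s : ℝ => s ^ (n + 2) := by
        refine Asymptotics.IsBigO.of_bound 1 (Eventually.of_forall fun t => ?_)
        rw [norm_pow, norm_pow, one_mul]
        gcongr
        rw [Real.norm_eq_abs, Real.norm_eq_abs, abs_of_nonneg (le_max_right _ _)]
        exact max_le (le_abs_self _) (abs_nonneg _)
      refine h1.trans_isLittleO ?_
      simpa using Asymptotics.isLittleO_pow_pow (𝕜 := ℝ) (show 1 < n + 2 by omega)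
    rw [hasDerivAt_iff_isLittleO]
    simpa using h
  · have h : (fun s : ℝ => max s 0 ^ (n + 2)) =ᶠ[𝓝 s] fun s => s ^ (n + 2) := by
      filter_upwards [Ioi_mem_nhds hs] with t ht
      rw [max_eq_left (le_of_lt (mem_Ioi.1 ht))]
    rw [max_eq_left hs.le]
    exact (hasDerivAt_pow (n + 2) s).congr_of_eventuallyEq h

/-- A function of one variable has nonnegative second derivative at a local minimum. -/
theorem IsLocalMin.second_deriv_nonneg {f f1 : ℝ → ℝ} {f2 a : ℝ} (hmin : IsLocalMin f a)
    (hf : ∀ t, HasDerivAt f (f1 t) t) (hf1 : HasDerivAt f1 f2 a) : 0 ≤ f2 := by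
  by_contra! hneg
  have hd : deriv f = f1 := funext fun t => (hf t).deriv
  have hmax : IsLocalMax f a := by
    refine isLocalMax_of_deriv_deriv_neg ?_ hmin.deriv_eq_zero (hf a).continuousAt
    rw [hd, hf1.deriv]
    exact hneg
  have hconst : f =ᶠ[𝓝 a] fun _ => f a := by
    filter_upwards [hmin, hmax] with t h1 h2 using le_antisymm h2 h1
  have hz : f1 =ᶠ[𝓝 a] fun _ => (0 : ℝ) := by
    filter_upwards [hconst.eventuallyEq_nhds] with t ht
    rw [← (hf t).deriv, ht.deriv_eq]
    simp
  have := hf1.deriv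
  rw [hz.deriv_eq] at this
  simp at this
  linarith

end Calculus

section Integration

/-- Differentiation under the integral sign for a family with compact support. -/
theorem hasDerivAt_integral_of_compact_support {V : Type*} [NormedAddCommGroup V]
    [MeasurableSpace V] [BorelSpace V] {μ : Measure V} [IsFiniteMeasureOnCompacts μ]
    {F F' : ℝ → V → ℝ} {K : Set V} {a b r : ℝ}
    (hK : IsCompact K) (hr : r ∈ Ioo a b)
    (hF : ∀ s ∈ Ioo a b, Continuous (F s))
    (hF' : ContinuousOn (fun q : ℝ × V => F' q.1 q.2) (Ioo a b ×ˢ univ))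
    (hd : ∀ s ∈ Ioo a b, ∀ p, HasDerivAt (fun s => F s p) (F' s p) s)
    (h0 : ∀ s ∈ Ioo a b, ∀ p ∉ K, F s p = 0) :
    HasDerivAt (fun s => ∫ p, F s p ∂μ) (∫ p, F' r p ∂μ) r := by
  obtain ⟨a', ha', ha'r⟩ := exists_between hr.1
  obtain ⟨b', hb'r, hb'⟩ := exists_between hr.2
  have hsub : Icc a' b' ⊆ Ioo a b := fun s hs => ⟨ha'.trans_le hs.1, hs.2.trans_lt hb'⟩
  obtain ⟨C, hC⟩ := (isCompact_Icc.prod hK).exists_bound_of_continuousOn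
    (hF'.mono (prod_mono hsub (subset_univ K)))
  have h0' : ∀ s ∈ Ioo a b, ∀ p ∉ K, F' s p = 0 := by
    intro s hs p hp
    refine (hd s hs p).unique ?_
    refine (hasDerivAt_const s (0 : ℝ)).congr_of_eventuallyEq ?_
    filter_upwards [Ioo_mem_nhds hs.1 hs.2] with t ht using h0 t ht p hp
  have hF'r : Continuous (F' r) := by
    have : Continuous fun p : V => ((r, p) : ℝ × V) := by fun_prop
    exact hF'.comp_continuous this fun p => ⟨hr, mem_univ _⟩
  refine (hasDerivAt_integral_of_dominated_loc_of_deriv_le (bound := K.indicator fun _ => C)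
    (s := Icc a' b') (Icc_mem_nhds ha'r hb'r) ?_ ?_ hF'r.aestronglyMeasurable ?_ ?_ ?_).2
  · filter_upwards [Ioo_mem_nhds hr.1 hr.2] with s hs using (hF s hs).aestronglyMeasurable
  · exact (hF r hr).integrable_of_hasCompactSupport (HasCompactSupport.intro hK (h0 r hr))
  · refine Eventually.of_forall fun p s hs => ?_
    by_cases hp : p ∈ K
    · rw [indicator_of_mem hp]
      exact hC (s, p) ⟨hs, hp⟩
    · rw [indicator_of_notMem hp, h0' s (hsub hs) p hp, norm_zero]
  · exact (integrable_indicator_iff hK.measurableSet).2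
      (integrableOn_const hK.measure_lt_top.ne)
  · exact Eventually.of_forall fun p s hs => hd s (hsub hs) p

variable {V : Type*} [NormedAddCommGroup V] [NormedSpace ℝ V] [MeasurableSpace V] [BorelSpace V]
  [FiniteDimensional ℝ V] {μ : Measure V} [μ.IsAddHaarMeasure]

/-- Integration by parts along a direction against a compactly supported function. -/
theorem integral_mul_lineDeriv_eq_neg {f f1 g g1 : V → ℝ} {v : V} {K : Set V} (hK : IsCompact K)
    (hf : ∀ p, HasLineDerivAt ℝ f (f1 p) p v) (hg : ∀ p, HasLineDerivAt ℝ g (g1 p) p v)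
    (hfc : Continuous f) (hf1c : Continuous f1) (hgc : Continuous g) (hg1c : Continuous g1)
    (hg0 : ∀ p ∉ K, g p = 0) (hg10 : ∀ p ∉ K, g1 p = 0) :
    ∫ p, f p * g1 p ∂μ = - ∫ p, f1 p * g p ∂μ := by
  have hcg : HasCompactSupport g := HasCompactSupport.intro hK hg0
  have hcg1 : HasCompactSupport g1 := HasCompactSupport.intro hK hg10
  exact integral_bilinear_hasLineDerivAt_right_eq_neg_left_of_integrable
    (B := ContinuousLinearMap.mul ℝ ℝ)
    ((hf1c.mul hgc).integrable_of_hasCompactSupport hcg.mul_left)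
    ((hfc.mul hg1c).integrable_of_hasCompactSupport hcg1.mul_left)
    ((hfc.mul hgc).integrable_of_hasCompactSupport hcg.mul_left)
    (fun p _ => hf p) (fun p _ => hg p)

/-- Double integration by parts along a direction against a compactly supported function. -/
theorem integral_mul_second_lineDeriv_eq {f f1 f2 g g1 g2 : V → ℝ} {v : V} {K : Set V}
    (hK : IsCompact K)
    (hf : ∀ p, HasLineDerivAt ℝ f (f1 p) p v) (hf1 : ∀ p, HasLineDerivAt ℝ f1 (f2 p) p v)
    (hg : ∀ p, HasLineDerivAt ℝ g (g1 p) p v) (hg1 : ∀ p, HasLineDerivAt ℝ g1 (g2 p) p v)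
    (hfc : Continuous f) (hf1c : Continuous f1) (hf2c : Continuous f2)
    (hgc : Continuous g) (hg1c : Continuous g1) (hg2c : Continuous g2)
    (hg0 : ∀ p ∉ K, g p = 0) (hg10 : ∀ p ∉ K, g1 p = 0) (hg20 : ∀ p ∉ K, g2 p = 0) :
    ∫ p, f p * g2 p ∂μ = ∫ p, f2 p * g p ∂μ := by
  rw [integral_mul_lineDeriv_eq_neg hK hf hg1 hfc hf1c hg1c hg2c hg10 hg20,
    integral_mul_lineDeriv_eq_neg hK hf1 hg hf1c hf2c hgc hg1c hg0 hg10, neg_neg]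

/-- Rescaled kernels concentrating at a point. -/
theorem tendsto_integral_rescaled {H k : ℝ → V → ℝ} {k0 g : V → ℝ} {c : V} {M : ℝ}
    (hHc : ContinuousAt (fun q : ℝ × V => H q.1 q.2) (0, c))
    (hHm : ∀ s, Continuous (H s)) (hM : ∀ s, 0 < s → ∀ y, |H s y| ≤ M)
    (hkm : ∀ s, 0 < s → Continuous (k s)) (hg : Integrable g μ)
    (hkg : ∀ s, 0 < s → ∀ ξ, |k s ξ| ≤ g ξ)
    (hk : ∀ ξ, Tendsto (fun s => k s ξ) (𝓝[>] 0) (𝓝 (k0 ξ))) :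
    Tendsto (fun s : ℝ => ∫ y, H s y * ((s ^ Module.finrank ℝ V)⁻¹ * k s (s⁻¹ • (y - c))) ∂μ)
      (𝓝[>] 0) (𝓝 (H 0 c * ∫ ξ, k0 ξ ∂μ)) := by
  have hchange : ∀ s : ℝ, 0 < s →
      ∫ y, H s y * ((s ^ Module.finrank ℝ V)⁻¹ * k s (s⁻¹ • (y - c))) ∂μ
        = ∫ ξ, H s (c + s • ξ) * k s ξ ∂μ := by
    intro s hs
    have h1 := Measure.integral_comp_inv_smul_of_nonneg μ
      (fun ξ => H s (c + s • ξ) * k s ξ) hs.le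
    have h2 := integral_sub_right_eq_self (μ := μ)
      (fun y => H s (c + s • s⁻¹ • y) * k s (s⁻¹ • y)) c
    rw [h1] at h2
    have hpow : (s ^ Module.finrank ℝ V) ≠ 0 := (pow_pos hs _).ne'
    calc ∫ y, H s y * ((s ^ Module.finrank ℝ V)⁻¹ * k s (s⁻¹ • (y - c))) ∂μ
        = (s ^ Module.finrank ℝ V)⁻¹ *
          ∫ y, H s (c + s • s⁻¹ • (y - c)) * k s (s⁻¹ • (y - c)) ∂μ := by
          rw [← integral_const_mul]
          congr 1
          ext y
          rw [smul_inv_smul₀ hs.ne', add_sub_cancel]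
          ring
      _ = _ := by rw [h2, smul_eq_mul, inv_mul_cancel_left₀ hpow]
  rw [← integral_const_mul]
  have hM0 : 0 ≤ M := (abs_nonneg _).trans (hM 1 one_pos 0)
  have : Tendsto (fun s : ℝ => ∫ ξ, H s (c + s • ξ) * k s ξ ∂μ) (𝓝[>] 0)
      (𝓝 (∫ ξ, H 0 c * k0 ξ ∂μ)) := by
    refine tendsto_integral_filter_of_dominated_convergence (fun ξ => M * g ξ) ?_ ?_
      (hg.const_mul M) ?_
    · filter_upwards [self_mem_nhdsWithin] with s hs
      have h1 : Continuous fun ξ : V => c + s • ξ := by fun_prop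
      exact (((hHm s).comp h1).mul (hkm s hs)).aestronglyMeasurable
    · filter_upwards [self_mem_nhdsWithin] with s hs
      refine Eventually.of_forall fun ξ => ?_
      rw [Real.norm_eq_abs, abs_mul]
      exact mul_le_mul (hM s hs _) (hkg s hs ξ) (abs_nonneg _) hM0
    · refine Eventually.of_forall fun ξ => Tendsto.mul ?_ (hk ξ)
      have h1 : Tendsto (fun s : ℝ => ((s, c + s • ξ) : ℝ × V)) (𝓝[>] 0) (𝓝 (0, c)) := by
        have : Continuous fun s : ℝ => ((s, c + s • ξ) : ℝ × V) := by fun_prop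
        have := this.tendsto 0
        simp only [zero_smul, add_zero] at this
        exact this.mono_left nhdsWithin_le_nhds
      exact hHc.tendsto.comp h1
  refine this.congr' ?_
  filter_upwards [self_mem_nhdsWithin] with s hs using (hchange s hs).symm

end Integration

section Green

variable {N : ℕ}

instance isAddHaarMeasure_volume_prod : (volume : Measure (ℝ × Euc N)).IsAddHaarMeasure :=
  inferInstanceAs ((volume : Measure ℝ).prod (volume : Measure (Euc N))).IsAddHaarMeasure

theorem hasDerivAt_norm_sq_line (y c : Euc N) (i : Fin (N - 1)) :
    HasDerivAt (fun t : ℝ => ‖y + t • EuclideanSpace.single i (1 : ℝ) - c‖ ^ 2)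
      (2 * (y i - c i)) 0 := by
  have h1 : HasDerivAt (fun t : ℝ => y + t • EuclideanSpace.single i (1 : ℝ) - c)
      (EuclideanSpace.single i (1 : ℝ)) 0 := by
    simpa using (((hasDerivAt_id (0 : ℝ)).smul_const
      (EuclideanSpace.single i (1 : ℝ))).const_add y).sub_const c
  have h2 := h1.norm_sq
  simpa [EuclideanSpace.inner_single_right] using h2

theorem hasDerivAt_coord_line (y c : Euc N) (i : Fin (N - 1)) :
    HasDerivAt (fun t : ℝ => 2 * ((y + t • EuclideanSpace.single i (1 : ℝ)) i - c i)) 2 0 := by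
  have : (fun t : ℝ => 2 * ((y + t • EuclideanSpace.single i (1 : ℝ) : Euc N) i - c i))
      = fun t : ℝ => 2 * (y i + t - c i) := by
    ext t
    simp
  rw [this]
  simpa using ((((hasDerivAt_id (0 : ℝ)).const_add (y i)).sub_const (c i)).const_mul 2)

/-- First derivative of a radial function along a coordinate line. -/
theorem hasDerivAt_radial_line {F : ℝ → ℝ} {F1 : ℝ} (y c : Euc N) (i : Fin (N - 1))
    (h : HasDerivAt F F1 (‖y - c‖ ^ 2)) :
    HasDerivAt (fun t : ℝ => F (‖y + t • EuclideanSpace.single i (1 : ℝ) - c‖ ^ 2))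
      (F1 * (2 * (y i - c i))) 0 := by
  refine HasDerivAt.comp (0 : ℝ) (h₂ := F) ?_ (hasDerivAt_norm_sq_line y c i)
  simpa using h

/-- Second derivative of a radial function along a coordinate line. -/
theorem hasDerivAt_radial_line_second {F1 : ℝ → ℝ} {F2 : ℝ} (y c : Euc N) (i : Fin (N - 1))
    (h : HasDerivAt F1 F2 (‖y - c‖ ^ 2)) :
    HasDerivAt (fun t : ℝ => F1 (‖y + t • EuclideanSpace.single i (1 : ℝ) - c‖ ^ 2) *
      (2 * ((y + t • EuclideanSpace.single i (1 : ℝ)) i - c i)))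
      (F2 * (2 * (y i - c i)) ^ 2 + 2 * F1 (‖y - c‖ ^ 2)) 0 := by
  have := (hasDerivAt_radial_line y c i h).mul (hasDerivAt_coord_line y c i)
  convert! this using 1
  simp
  ring

theorem sum_radial_second (F1 F2 : ℝ) (y c : Euc N) :
    ∑ i : Fin (N - 1), (F2 * (2 * (y i - c i)) ^ 2 + 2 * F1)
      = 4 * ‖y - c‖ ^ 2 * F2 + 2 * ((N - 1 : ℕ) : ℝ) * F1 := by
  have : ‖y - c‖ ^ 2 = ∑ i, (y i - c i) ^ 2 := by
    rw [EuclideanSpace.norm_sq_eq]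
    simp
  rw [Finset.sum_add_distrib, this, Finset.mul_sum, Finset.sum_mul]
  congr 1
  · exact Finset.sum_congr rfl fun i _ => by ring
  · simp
    ring

theorem contDiff_fderiv_apply {V : Type*} [NormedAddCommGroup V] [NormedSpace ℝ V] {U : V → ℝ}
    (hU : ContDiff ℝ 2 U) (v : V) : ContDiff ℝ 1 fun p => fderiv ℝ U p v :=
  (hU.fderiv_right (m := 1) (by norm_num)).clm_apply contDiff_const

theorem continuous_second {V : Type*} [NormedAddCommGroup V] [NormedSpace ℝ V] {U : V → ℝ}
    (hU : ContDiff ℝ 2 U) (v : V) :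
    Continuous fun p => fderiv ℝ (fun q => fderiv ℝ U q v) p v :=
  ((contDiff_fderiv_apply hU v).continuous_fderiv (by norm_num)).clm_apply continuous_const

theorem continuous_dX {U : ℝ × Euc N → ℝ} (hU : ContDiff ℝ 2 U) : Continuous (dX U) :=
  (contDiff_fderiv_apply hU _).continuous

theorem continuous_lapY {U : ℝ × Euc N → ℝ} (hU : ContDiff ℝ 2 U) : Continuous (lapY U) :=
  continuous_finsetSum _ fun _ _ => continuous_second hU _

theorem hasLineDerivAt_of_contDiff {V : Type*} [NormedAddCommGroup V] [NormedSpace ℝ V] {U : V → ℝ}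
    (hU : ContDiff ℝ 1 U) (p v : V) : HasLineDerivAt ℝ U (fderiv ℝ U p v) p v :=
  ((hU.differentiable (by norm_num)) p).hasFDerivAt.hasLineDerivAt v

/-- Green's identity for `Δ_y + β ∂_x` against a test function that is radial in `y`. -/
theorem integral_green {U : ℝ × Euc N → ℝ} (hU : ContDiff ℝ 2 U) {β : Euc N → ℝ}
    (hβ : Continuous β) {F F1 F2 Fx : ℝ → ℝ → ℝ} (c : Euc N) {K : Set (ℝ × Euc N)}
    (hK : IsCompact K)
    (hF1 : ∀ x q, HasDerivAt (F x) (F1 x q) q) (hF2 : ∀ x q, HasDerivAt (F1 x) (F2 x q) q)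
    (hFx : ∀ x q, HasDerivAt (fun x => F x q) (Fx x q) x)
    (hFc : Continuous fun p : ℝ × ℝ => F p.1 p.2) (hF1c : Continuous fun p : ℝ × ℝ => F1 p.1 p.2)
    (hF2c : Continuous fun p : ℝ × ℝ => F2 p.1 p.2)
    (hFxc : Continuous fun p : ℝ × ℝ => Fx p.1 p.2)
    (h0 : ∀ p ∉ K, F p.1 (‖p.2 - c‖ ^ 2) = 0) (h1 : ∀ p ∉ K, F1 p.1 (‖p.2 - c‖ ^ 2) = 0)
    (h2 : ∀ p ∉ K, F2 p.1 (‖p.2 - c‖ ^ 2) = 0) (hx : ∀ p ∉ K, Fx p.1 (‖p.2 - c‖ ^ 2) = 0) :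
    ∫ p : ℝ × Euc N, U p * (4 * ‖p.2 - c‖ ^ 2 * F2 p.1 (‖p.2 - c‖ ^ 2)
        + 2 * ((N - 1 : ℕ) : ℝ) * F1 p.1 (‖p.2 - c‖ ^ 2) - β p.2 * Fx p.1 (‖p.2 - c‖ ^ 2))
      = ∫ p : ℝ × Euc N, (lapY U p + β p.2 * dX U p) * F p.1 (‖p.2 - c‖ ^ 2) := by
  have hq : Continuous fun p : ℝ × Euc N => ((p.1, ‖p.2 - c‖ ^ 2) : ℝ × ℝ) := by fun_prop
  have gF := hFc.comp hq
  have gF1 := hF1c.comp hq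
  have gF2 := hF2c.comp hq
  have gFx := hFxc.comp hq
  simp only [Function.comp_def] at gF gF1 gF2 gFx
  have hU1 : ContDiff ℝ 1 U := hU.of_le (by norm_num)
  have hUc := hU.continuous
  have hint : ∀ f : ℝ × Euc N → ℝ, Continuous f → (∀ p ∉ K, f p = 0) → Integrable f :=
    fun f hf hf0 => hf.integrable_of_hasCompactSupport (HasCompactSupport.intro hK hf0)
  have hlineX : ∀ p : ℝ × Euc N, HasLineDerivAt ℝ (fun p : ℝ × Euc N => β p.2 *
      F p.1 (‖p.2 - c‖ ^ 2)) (β p.2 * Fx p.1 (‖p.2 - c‖ ^ 2)) p ((1 : ℝ), (0 : Euc N)) := by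
    intro p
    have h3 : HasDerivAt (fun t : ℝ => p.1 + t) 1 0 := by
      simpa using (hasDerivAt_id (0 : ℝ)).const_add p.1
    have h4 : HasDerivAt (fun t : ℝ => F (p.1 + t) (‖p.2 - c‖ ^ 2))
        (Fx p.1 (‖p.2 - c‖ ^ 2)) 0 := by
      have := HasDerivAt.comp (0 : ℝ) (h₂ := fun x => F x (‖p.2 - c‖ ^ 2))
        (h := fun t : ℝ => p.1 + t) (by simpa using hFx p.1 (‖p.2 - c‖ ^ 2)) h3
      simpa [Function.comp_def] using this
    simpa [HasLineDerivAt] using h4.const_mul (β p.2)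
  have hX := integral_mul_lineDeriv_eq_neg (μ := (volume : Measure (ℝ × Euc N))) hK
    (fun p => hasLineDerivAt_of_contDiff hU1 p ((1 : ℝ), (0 : Euc N))) hlineX hUc
    (continuous_dX hU) (by fun_prop) (by fun_prop) (fun p hp => by simp [h0 p hp])
    (fun p hp => by simp [hx p hp])
  have hcoord : ∀ i : Fin (N - 1), Continuous fun p : ℝ × Euc N => 2 * (p.2 i - c i) := by
    intro i
    fun_prop
  have hY : ∀ i : Fin (N - 1), ∫ p : ℝ × Euc N, U p * (F2 p.1 (‖p.2 - c‖ ^ 2) *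
      (2 * (p.2 i - c i)) ^ 2 + 2 * F1 p.1 (‖p.2 - c‖ ^ 2))
      = ∫ p : ℝ × Euc N, fderiv ℝ (fun q => fderiv ℝ U q ((0 : ℝ), EuclideanSpace.single i (1 : ℝ)))
          p ((0 : ℝ), EuclideanSpace.single i (1 : ℝ)) * F p.1 (‖p.2 - c‖ ^ 2) := by
    intro i
    refine integral_mul_second_lineDeriv_eq (K := K) (v := ((0 : ℝ), EuclideanSpace.single i (1 : ℝ)))
      (g1 := fun p : ℝ × Euc N => F1 p.1 (‖p.2 - c‖ ^ 2) * (2 * (p.2 i - c i))) hK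
      (fun p => hasLineDerivAt_of_contDiff hU1 p _)
      (fun p => hasLineDerivAt_of_contDiff (contDiff_fderiv_apply hU _) p _) ?_ ?_ hUc
      (contDiff_fderiv_apply hU _).continuous (continuous_second hU _) gF (gF1.mul (hcoord i))
      ((gF2.mul ((hcoord i).pow 2)).add (continuous_const.mul gF1)) h0
      (fun p hp => by simp [h1 p hp]) (fun p hp => by simp [h1 p hp, h2 p hp])
    · intro p
      simpa [HasLineDerivAt] using hasDerivAt_radial_line p.2 c i (hF1 p.1 (‖p.2 - c‖ ^ 2))
    · intro p
      simpa [HasLineDerivAt] using hasDerivAt_radial_line_second p.2 c i (hF2 p.1 (‖p.2 - c‖ ^ 2))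
  have e1 : ∀ p : ℝ × Euc N, U p * (4 * ‖p.2 - c‖ ^ 2 * F2 p.1 (‖p.2 - c‖ ^ 2)
        + 2 * ((N - 1 : ℕ) : ℝ) * F1 p.1 (‖p.2 - c‖ ^ 2) - β p.2 * Fx p.1 (‖p.2 - c‖ ^ 2))
      = (∑ i : Fin (N - 1), U p * (F2 p.1 (‖p.2 - c‖ ^ 2) *
      (2 * (p.2 i - c i)) ^ 2 + 2 * F1 p.1 (‖p.2 - c‖ ^ 2)))
        - U p * (β p.2 * Fx p.1 (‖p.2 - c‖ ^ 2)) := by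
    intro p
    rw [← Finset.mul_sum, sum_radial_second]
    ring
  have e2 : ∀ p : ℝ × Euc N, (lapY U p + β p.2 * dX U p) * F p.1 (‖p.2 - c‖ ^ 2)
      = (∑ i : Fin (N - 1), fderiv ℝ (fun q => fderiv ℝ U q ((0 : ℝ), EuclideanSpace.single i
          (1 : ℝ))) p ((0 : ℝ), EuclideanSpace.single i (1 : ℝ)) * F p.1 (‖p.2 - c‖ ^ 2))
        + dX U p * (β p.2 * F p.1 (‖p.2 - c‖ ^ 2)) := by
    intro p
    rw [← Finset.sum_mul]
    simp only [lapY]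
    ring
  have i1 : ∀ i : Fin (N - 1), Integrable fun p : ℝ × Euc N => U p * (F2 p.1 (‖p.2 - c‖ ^ 2) *
      (2 * (p.2 i - c i)) ^ 2 + 2 * F1 p.1 (‖p.2 - c‖ ^ 2)) := fun i =>
    hint _ (hUc.mul ((gF2.mul ((hcoord i).pow 2)).add (continuous_const.mul gF1)))
      (fun p hp => by simp [h1 p hp, h2 p hp])
  have i2 : ∀ i : Fin (N - 1), Integrable fun p : ℝ × Euc N =>
      fderiv ℝ (fun q => fderiv ℝ U q ((0 : ℝ), EuclideanSpace.single i
          (1 : ℝ))) p ((0 : ℝ), EuclideanSpace.single i (1 : ℝ)) * F p.1 (‖p.2 - c‖ ^ 2) := fun i =>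
    hint _ ((continuous_second hU _).mul gF) (fun p hp => by simp [h0 p hp])
  have i3 : Integrable fun p : ℝ × Euc N => U p * (β p.2 * Fx p.1 (‖p.2 - c‖ ^ 2)) :=
    hint _ (by fun_prop) (fun p hp => by simp [hx p hp])
  have i4 : Integrable fun p : ℝ × Euc N => dX U p * (β p.2 * F p.1 (‖p.2 - c‖ ^ 2)) :=
    hint _ ((continuous_dX hU).mul (by fun_prop)) (fun p hp => by simp [h0 p hp])
  simp_rw [e1, e2]
  rw [integral_sub (integrable_finsetSum _ fun i _ => i1 i) i3,
    integral_add (integrable_finsetSum _ fun i _ => i2 i) i4,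
    integral_finsetSum _ fun i _ => i1 i, integral_finsetSum _ fun i _ => i2 i, hX,
    Finset.sum_congr rfl fun i _ => hY i, sub_neg_eq_add]
  rfl

/-- Green's identity for `Δ_y` on a slice `x = const` against a radial test function. -/
theorem integral_green_slice {U : ℝ × Euc N → ℝ} (hU : ContDiff ℝ 2 U) (x : ℝ)
    {F F1 F2 : ℝ → ℝ} (c : Euc N) {K : Set (Euc N)} (hK : IsCompact K)
    (hF1 : ∀ q, HasDerivAt F (F1 q) q) (hF2 : ∀ q, HasDerivAt F1 (F2 q) q)
    (hF2c : Continuous F2)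
    (h0 : ∀ y ∉ K, F (‖y - c‖ ^ 2) = 0) (h1 : ∀ y ∉ K, F1 (‖y - c‖ ^ 2) = 0)
    (h2 : ∀ y ∉ K, F2 (‖y - c‖ ^ 2) = 0) :
    ∫ y : Euc N, U (x, y) * (4 * ‖y - c‖ ^ 2 * F2 (‖y - c‖ ^ 2)
        + 2 * ((N - 1 : ℕ) : ℝ) * F1 (‖y - c‖ ^ 2))
      = ∫ y : Euc N, lapY U (x, y) * F (‖y - c‖ ^ 2) := by
  have hq : Continuous fun y : Euc N => ‖y - c‖ ^ 2 := by fun_prop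
  have hemb : Continuous fun y : Euc N => ((x, y) : ℝ × Euc N) := by fun_prop
  have gF := (continuous_iff_continuousAt.2 fun q => (hF1 q).continuousAt).comp hq
  have gF1 := (continuous_iff_continuousAt.2 fun q => (hF2 q).continuousAt).comp hq
  have gF2 := hF2c.comp hq
  simp only [Function.comp_def] at gF gF1 gF2
  have hU1 : ContDiff ℝ 1 U := hU.of_le (by norm_num)
  have hslice : ∀ (f : ℝ × Euc N → ℝ), ContDiff ℝ 1 f → ∀ (y v : Euc N),
      HasLineDerivAt ℝ (fun y => f (x, y)) (fderiv ℝ f (x, y) ((0 : ℝ), v)) y v := by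
    intro f hf y v
    simpa [HasLineDerivAt] using hasLineDerivAt_of_contDiff hf (x, y) ((0 : ℝ), v)
  have hcoord : ∀ i : Fin (N - 1), Continuous fun y : Euc N => 2 * (y i - c i) := by
    intro i
    fun_prop
  have hY : ∀ i : Fin (N - 1), ∫ y : Euc N, U (x, y) * (F2 (‖y - c‖ ^ 2) *
      (2 * (y i - c i)) ^ 2 + 2 * F1 (‖y - c‖ ^ 2))
      = ∫ y : Euc N, fderiv ℝ (fun q => fderiv ℝ U q ((0 : ℝ), EuclideanSpace.single i (1 : ℝ)))
          (x, y) ((0 : ℝ), EuclideanSpace.single i (1 : ℝ)) * F (‖y - c‖ ^ 2) := by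
    intro i
    refine integral_mul_second_lineDeriv_eq (K := K) (v := EuclideanSpace.single i (1 : ℝ))
      (f := fun y : Euc N => U (x, y))
      (g1 := fun y : Euc N => F1 (‖y - c‖ ^ 2) * (2 * (y i - c i))) hK
      (fun p => hslice U hU1 p _)
      (fun p => hslice _ (contDiff_fderiv_apply hU _) p _) ?_ ?_ (hU.continuous.comp hemb)
      ((contDiff_fderiv_apply hU _).continuous.comp hemb) ((continuous_second hU _).comp hemb)
      gF (gF1.mul (hcoord i))
      ((gF2.mul ((hcoord i).pow 2)).add (continuous_const.mul gF1)) h0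
      (fun p hp => by simp [h1 p hp]) (fun p hp => by simp [h1 p hp, h2 p hp])
    · intro p
      simpa [HasLineDerivAt] using hasDerivAt_radial_line p c i (hF1 (‖p - c‖ ^ 2))
    · intro p
      simpa [HasLineDerivAt] using hasDerivAt_radial_line_second p c i (hF2 (‖p - c‖ ^ 2))
  have hint : ∀ f : Euc N → ℝ, Continuous f → (∀ p ∉ K, f p = 0) → Integrable f :=
    fun f hf hf0 => hf.integrable_of_hasCompactSupport (HasCompactSupport.intro hK hf0)
  simp_rw [← sum_radial_second, lapY, Finset.mul_sum, Finset.sum_mul]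
  rw [integral_finsetSum _ fun i _ => ?_, integral_finsetSum _ fun i _ => ?_]
  · exact Finset.sum_congr rfl fun i _ => hY i
  · exact hint _ (((continuous_second hU _).comp hemb).mul gF) (fun p hp => by simp [h0 p hp])
  · exact hint _ ((hU.continuous.comp hemb).mul ((gF2.mul ((hcoord i).pow 2)).add
      (continuous_const.mul gF1))) (fun p hp => by simp [h1 p hp, h2 p hp])

end Green

section Barrier

variable {N : ℕ}

theorem HasLineDerivAt.hasDerivAt_line {V : Type*} [NormedAddCommGroup V] [NormedSpace ℝ V]
    {f f1 : V → ℝ} {v : V} (h : ∀ p, HasLineDerivAt ℝ f (f1 p) p v) (p : V) (t : ℝ) :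
    HasDerivAt (fun t : ℝ => f (p + t • v)) (f1 (p + t • v)) t := by
  have h1 : HasDerivAt (fun s : ℝ => f (p + t • v + s • v)) (f1 (p + t • v)) (t - t) := by
    rw [sub_self]
    exact h (p + t • v)
  have h2 := h1.comp_sub_const t t
  refine h2.congr_of_eventuallyEq (Eventually.of_forall fun s => ?_)
  show f (p + s • v) = f (p + t • v + (s - t) • v)
  rw [add_assoc, ← add_smul, add_sub_cancel]

/-- A `C¹` function vanishing on `[a', b']` and at least `1` outside `(a, b)`. -/
theorem exists_interval_cutoff {a a' b' b : ℝ} (ha : a < a') (hb : b' < b) :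
    ∃ k k1 : ℝ → ℝ, (∀ x, HasDerivAt k (k1 x) x) ∧ Continuous k1 ∧ (∀ x, 0 ≤ k x) ∧
      (∀ x ∈ Icc a' b', k x = 0) ∧ (∀ x ∉ Ioo a b, 1 ≤ k x) := by
  have ha0 : 0 < a' - a := sub_pos.2 ha
  have hb0 : 0 < b - b' := sub_pos.2 hb
  refine ⟨fun x => max ((x - b') / (b - b')) 0 ^ 2 + max ((a' - x) / (a' - a)) 0 ^ 2,
    fun x => 2 * max ((x - b') / (b - b')) 0 * (1 / (b - b')) +
      2 * max ((a' - x) / (a' - a)) 0 * (-1 / (a' - a)), ?_, ?_, ?_, ?_, ?_⟩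
  · intro x
    have h1 : HasDerivAt (fun x : ℝ => (x - b') / (b - b')) (1 / (b - b')) x :=
      ((hasDerivAt_id x).sub_const b').div_const _
    have h2 : HasDerivAt (fun x : ℝ => (a' - x) / (a' - a)) (-1 / (a' - a)) x :=
      ((hasDerivAt_id x).const_sub a').div_const _
    have h3 := (hasDerivAt_posPart_pow 0 ((x - b') / (b - b'))).comp x h1
    have h4 := (hasDerivAt_posPart_pow 0 ((a' - x) / (a' - a))).comp x h2
    convert! h3.add h4 using 1
    simp
  · fun_prop
  · intro x
    positivity
  · intro x hx
    have h1 : (x - b') / (b - b') ≤ 0 := div_nonpos_of_nonpos_of_nonneg (by linarith [hx.2]) hb0.le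
    have h2 : (a' - x) / (a' - a) ≤ 0 := div_nonpos_of_nonpos_of_nonneg (by linarith [hx.1]) ha0.le
    simp [max_eq_right h1, max_eq_right h2]
  · intro x hx
    have hcase : x ≤ a ∨ b ≤ x := by
      by_contra! h
      exact hx ⟨h.1, h.2⟩
    rcases hcase with h | h
    · have h1 : 1 ≤ (a' - x) / (a' - a) := by
        rw [le_div_iff₀ ha0]
        linarith
      have h2 : 1 ≤ max ((a' - x) / (a' - a)) 0 ^ 2 := one_le_pow₀ (le_max_of_le_left h1)
      have h3 : 0 ≤ max ((x - b') / (b - b')) 0 ^ 2 := by positivity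
      linarith
    · have h1 : 1 ≤ (x - b') / (b - b') := by
        rw [le_div_iff₀ hb0]
        linarith
      have h2 : 1 ≤ max ((x - b') / (b - b')) 0 ^ 2 := one_le_pow₀ (le_max_of_le_left h1)
      have h3 : 0 ≤ max ((a' - x) / (a' - a)) 0 ^ 2 := by positivity
      linarith

/-- Existence of a compactly supported function `F (x, |y - c|²)` that is a strict subsolution of
`Δ_y ± β ∂_x - 1` outside the tube `|y - c| < ρ`. -/
theorem exists_barrier (d : ℝ) {B ρ a a' b' b : ℝ} (hB : 0 ≤ B) (hρ : 0 < ρ) (ha : a < a')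
    (hb : b' < b) :
    ∃ (n : ℕ) (F F1 F2 Fx : ℝ → ℝ → ℝ),
      (∀ x q, HasDerivAt (F x) (F1 x q) q) ∧ (∀ x q, HasDerivAt (F1 x) (F2 x q) q) ∧
      (∀ x q, HasDerivAt (fun x => F x q) (Fx x q) x) ∧
      (Continuous fun p : ℝ × ℝ => F p.1 p.2) ∧ (Continuous fun p : ℝ × ℝ => F1 p.1 p.2) ∧
      (Continuous fun p : ℝ × ℝ => F2 p.1 p.2) ∧ (Continuous fun p : ℝ × ℝ => Fx p.1 p.2) ∧
      (∀ x q, 0 ≤ q → x ∉ Ioo a b ∨ 4 ≤ q → F x q = 0 ∧ F1 x q = 0 ∧ F2 x q = 0 ∧ Fx x q = 0) ∧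
      (∀ x q, 0 ≤ F x q) ∧ (∀ x q, 0 ≤ q → F x q ≤ 4 ^ (n + 3)) ∧
      (∀ x q s, x ∈ Icc a' b' → 0 ≤ s → s ≤ 4 - q → s ^ (n + 3) ≤ F x q) ∧
      (∀ x q θ, ρ ^ 2 ≤ q → |θ| ≤ B →
        0 ≤ 4 * q * F2 x q + 2 * d * F1 x q + θ * Fx x q - F x q) ∧
      (∀ x q θ s, ρ ^ 2 ≤ q → |θ| ≤ B → x ∈ Icc a' b' → 0 ≤ s → s ≤ 4 - q →
        s ^ (n + 1) ≤ 4 * q * F2 x q + 2 * d * F1 x q + θ * Fx x q - F x q) := by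
  obtain ⟨k, k1, hk, hk1c, hk0, hkin, hkout⟩ := exists_interval_cutoff ha hb
  obtain ⟨K, hK⟩ := isCompact_Icc.exists_bound_of_continuousOn (hk1c.continuousOn (s := Icc a b))
  have hkc : Continuous k := continuous_iff_continuousAt.2 fun x => (hk x).continuousAt
  obtain ⟨n, hn⟩ := exists_nat_ge ((4 * (2 * |d| + 4 * (B * |K|)) + 17) / (4 * ρ ^ 2))
  have hρ2 : 0 < 4 * ρ ^ 2 := by positivity
  rw [div_le_iff₀ hρ2] at hn
  have hder : ∀ x q, HasDerivAt (fun q : ℝ => 4 - q - 4 * k x) (-1) q := fun x q => by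
    simpa using ((hasDerivAt_id q).const_sub 4).sub_const (4 * k x)
  have hderx : ∀ x q, HasDerivAt (fun x : ℝ => 4 - q - 4 * k x) (-(4 * k1 x)) x := fun x q => by
    simpa using ((hk x).const_mul 4).const_sub (4 - q)
  have hsmall : ∀ x q, 0 ≤ q → x ∉ Ioo a b ∨ 4 ≤ q → max (4 - q - 4 * k x) 0 = 0 := by
    rintro x q hq (h | h)
    · exact max_eq_right (by linarith [hkout x h])
    · exact max_eq_right (by linarith [hk0 x])
  have hle : ∀ x q, 0 ≤ q → max (4 - q - 4 * k x) 0 ≤ 4 := fun x q hq =>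
    max_le (by linarith [hk0 x]) (by norm_num)
  have hkey : ∀ x q θ, ρ ^ 2 ≤ q → |θ| ≤ B → max (4 - q - 4 * k x) 0 ^ (n + 1) ≤
      4 * q * ((n + 3 : ℕ) * ((n + 2 : ℕ) * max (4 - q - 4 * k x) 0 ^ (n + 1)))
      + 2 * d * (-((n + 3 : ℕ) * max (4 - q - 4 * k x) 0 ^ (n + 2)))
      + θ * ((n + 3 : ℕ) * max (4 - q - 4 * k x) 0 ^ (n + 2) * (-(4 * k1 x)))
      - max (4 - q - 4 * k x) 0 ^ (n + 3) := by
    intro x q θ hq hθ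
    have hq0 : 0 ≤ q := (sq_nonneg ρ).trans hq
    by_cases hx : x ∈ Ioo a b
    · have hKx : |k1 x| ≤ |K| := (hK x (Ioo_subset_Icc_self hx)).trans (le_abs_self K)
      have hm0 : 0 ≤ max (4 - q - 4 * k x) 0 := le_max_right _ _
      have hm4 := hle x q hq0
      generalize max (4 - q - 4 * k x) 0 = m at hm0 hm4 ⊢
      have hθk : |θ * k1 x| ≤ B * |K| := by
        rw [abs_mul]
        exact mul_le_mul hθ hKx (abs_nonneg _) hB
      have e1 : -(B * |K|) ≤ -(θ * k1 x) := neg_le_neg ((le_abs_self _).trans hθk)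
      have e2 : -|d| ≤ -d := neg_le_neg (le_abs_self d)
      have e3 : 4 * ρ ^ 2 * n ≤ 4 * q * (n + 2) := by nlinarith [Nat.cast_nonneg (α := ℝ) n]
      have e4 : -(4 * (2 * |d| + 4 * (B * |K|))) ≤ m * (-(2 * d) - 4 * (θ * k1 x)) := by
        have : 0 ≤ 2 * |d| + 4 * (B * |K|) := by positivity
        nlinarith
      have e5 : m ^ 2 ≤ 16 := by nlinarith
      have e6 : (0:ℝ) ≤ n := Nat.cast_nonneg n
      have e7 : 17 ≤ 4 * q * (n + 2) + m * (-(2 * d) - 4 * (θ * k1 x)) := by linarith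
      have e8 : 1 ≤ (n + 3) * (4 * q * (n + 2) + m * (-(2 * d) - 4 * (θ * k1 x))) - m ^ 2 := by
        nlinarith
      have e9 := mul_le_mul_of_nonneg_left e8 (pow_nonneg hm0 (n + 1))
      rw [mul_one] at e9
      refine e9.trans (le_of_eq ?_)
      push_cast
      ring
    · simp [hsmall x q hq0 (Or.inl hx)]
  refine ⟨n, fun x q => max (4 - q - 4 * k x) 0 ^ (n + 3),
    fun x q => -((n + 3 : ℕ) * max (4 - q - 4 * k x) 0 ^ (n + 2)),
    fun x q => (n + 3 : ℕ) * ((n + 2 : ℕ) * max (4 - q - 4 * k x) 0 ^ (n + 1)),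
    fun x q => (n + 3 : ℕ) * max (4 - q - 4 * k x) 0 ^ (n + 2) * (-(4 * k1 x)),
    fun x q => ?_, fun x q => ?_, fun x q => ?_, by fun_prop, by fun_prop, by fun_prop,
    by fun_prop, fun x q hq h => ?_, fun x q => by positivity, fun x q hq => ?_,
    fun x q s hx h0 hs => ?_, fun x q θ hq hθ => ?_, fun x q θ s hq hθ hx h0 hs => ?_⟩
  · convert! (hasDerivAt_posPart_pow (n + 1) (4 - q - 4 * k x)).comp q (hder x q) using 1
    ring
  · have := (((hasDerivAt_posPart_pow n (4 - q - 4 * k x)).comp q (hder x q)).const_mul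
      ((n + 3 : ℕ) : ℝ)).neg
    convert! this using 1
    ring
  · exact (hasDerivAt_posPart_pow (n + 1) (4 - q - 4 * k x)).comp x (hderx x q)
  · simp [hsmall x q hq h]
  · exact pow_le_pow_left₀ (le_max_right _ _) (hle x q hq) _
  · refine pow_le_pow_left₀ h0 (le_max_of_le_left ?_) _
    rw [hkin x hx]
    linarith
  · exact (pow_nonneg (le_max_right _ _) _).trans (hkey x q θ hq hθ)
  · refine (pow_le_pow_left₀ h0 (le_max_of_le_left ?_) _).trans (hkey x q θ hq hθ)
    rw [hkin x hx]
    linarith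

end Barrier

section Propagation

variable {N : ℕ}

/-- A nonnegative bounded `C²` function `U` satisfying `|Δ_y U + β U_x| ≤ U` on `S`. -/
structure IsNearSolution (β : Euc N → ℝ) (S : Set (ℝ × Euc N)) (U : ℝ × Euc N → ℝ) : Prop where
  contDiff : ContDiff ℝ 2 U
  nonneg : ∀ p, 0 ≤ U p
  bounded : ∃ M, ∀ p, U p ≤ M
  abs_le : ∀ p ∈ S, |lapY U p + β p.2 * dX U p| ≤ U p

theorem IsNearSolution.mono {β : Euc N → ℝ} {S T : Set (ℝ × Euc N)} {U : ℝ × Euc N → ℝ}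
    (h : IsNearSolution β S U) (hT : T ⊆ S) : IsNearSolution β T U :=
  ⟨h.contDiff, h.nonneg, h.bounded, fun p hp => h.abs_le p (hT hp)⟩

theorem IsNearSolution.continuous {β : Euc N → ℝ} {S : Set (ℝ × Euc N)} {U : ℝ × Euc N → ℝ}
    (h : IsNearSolution β S U) : Continuous U := h.contDiff.continuous

theorem integrableOn_box {U : ℝ × Euc N → ℝ} (hU : Continuous U) {a b : ℝ} {c : Euc N} {r : ℝ}
    {T : Set (ℝ × Euc N)} (hT : T ⊆ Icc a b ×ˢ closedBall c r) : IntegrableOn U T :=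
  (hU.continuousOn.integrableOn_compact (isCompact_Icc.prod (isCompact_closedBall c r))).mono_set hT

/-- The mass of a near solution in a box is controlled by the mass in a thin tube. -/
theorem exists_integral_le_integral_tube {β : Euc N → ℝ} (hβ : Continuous β) {B : ℝ}
    (hB : ∀ y, |β y| ≤ B) (c : Euc N) {ρ a a' b' b r : ℝ} (hρ : 0 < ρ) (ha : a < a') (hb : b' < b)
    (hr0 : 0 ≤ r) (hr : r < 2) (hρ2 : ρ ≤ 2) :
    ∃ C > 0, ∀ U, IsNearSolution β (Icc a b ×ˢ closedBall c 2) U →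
      ∫ p in Icc a' b' ×ˢ closedBall c r, U p ≤ C * ∫ p in Icc a b ×ˢ ball c ρ, U p := by
  have hB0 : 0 ≤ B := (abs_nonneg _).trans (hB c)
  obtain ⟨n, F, F1, F2, Fx, hF1, hF2, hFx, hFc, hF1c, hF2c, hFxc, hvan, hF0, -, -, hsub,
    hstrict⟩ := exists_barrier ((N - 1 : ℕ) : ℝ) hB0 hρ ha hb
  set K : Set (ℝ × Euc N) := Icc a b ×ˢ closedBall c 2 with hKdef
  have hK : IsCompact K := isCompact_Icc.prod (isCompact_closedBall c 2)
  have hout : ∀ p ∉ K, F p.1 (‖p.2 - c‖ ^ 2) = 0 ∧ F1 p.1 (‖p.2 - c‖ ^ 2) = 0 ∧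
      F2 p.1 (‖p.2 - c‖ ^ 2) = 0 ∧ Fx p.1 (‖p.2 - c‖ ^ 2) = 0 := by
    intro p hp
    refine hvan _ _ (sq_nonneg _) ?_
    by_contra! h
    refine hp ⟨Ioo_subset_Icc_self h.1, ?_⟩
    rw [mem_closedBall, dist_eq_norm]
    nlinarith [norm_nonneg (p.2 - c)]
  set G : ℝ × Euc N → ℝ := fun p => 4 * ‖p.2 - c‖ ^ 2 * F2 p.1 (‖p.2 - c‖ ^ 2)
        + 2 * ((N - 1 : ℕ) : ℝ) * F1 p.1 (‖p.2 - c‖ ^ 2) - β p.2 * Fx p.1 (‖p.2 - c‖ ^ 2)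
        - F p.1 (‖p.2 - c‖ ^ 2) with hG
  have hq : Continuous fun p : ℝ × Euc N => (p.1, ‖p.2 - c‖ ^ 2) := by fun_prop
  have hcF : Continuous fun p : ℝ × Euc N => F p.1 (‖p.2 - c‖ ^ 2) := hFc.comp hq
  have hcF1 : Continuous fun p : ℝ × Euc N => F1 p.1 (‖p.2 - c‖ ^ 2) := hF1c.comp hq
  have hcF2 : Continuous fun p : ℝ × Euc N => F2 p.1 (‖p.2 - c‖ ^ 2) := hF2c.comp hq
  have hcFx : Continuous fun p : ℝ × Euc N => Fx p.1 (‖p.2 - c‖ ^ 2) := hFxc.comp hq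
  have hGc : Continuous G := by
    have hβ2 : Continuous fun p : ℝ × Euc N => β p.2 := hβ.comp continuous_snd
    fun_prop
  have hG0 : ∀ p ∉ K, G p = 0 := by
    intro p hp
    obtain ⟨e0, e1, e2, e3⟩ := hout p hp
    simp [hG, e0, e1, e2, e3]
  obtain ⟨M, hM⟩ := hK.exists_bound_of_continuousOn hGc.continuousOn
  set κ : ℝ := (4 - r ^ 2) ^ (n + 1) with hκ
  have hκ0 : 0 < κ := pow_pos (by nlinarith) _
  set T : Set (ℝ × Euc N) := Icc a' b' ×ˢ closedBall c r with hTdef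
  set H : Set (ℝ × Euc N) := Icc a b ×ˢ ball c ρ with hHdef
  have hTK : T ⊆ K := prod_mono (Icc_subset_Icc ha.le hb.le) (closedBall_subset_closedBall hr.le)
  have hHK : H ⊆ K := prod_mono le_rfl (ball_subset_closedBall.trans
    (closedBall_subset_closedBall hρ2))
  have hTm : MeasurableSet T := measurableSet_Icc.prod measurableSet_closedBall
  have hHm : MeasurableSet H := measurableSet_Icc.prod measurableSet_ball
  have hpt : ∀ p, T.indicator (fun _ => κ) p - H.indicator (fun _ => |M| + κ) p ≤ G p := by
    intro p
    by_cases hpH : p ∈ H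
    · have h1 : T.indicator (fun _ => κ) p ≤ κ := indicator_le_self' (fun _ _ => hκ0.le) p
      rw [indicator_of_mem hpH]
      have h2 := (abs_le.1 ((hM p (hHK hpH)).trans (le_abs_self M))).1
      linarith
    rw [indicator_of_notMem hpH, sub_zero]
    by_cases hpK : p ∈ K
    · have hqρ : ρ ^ 2 ≤ ‖p.2 - c‖ ^ 2 := by
        refine pow_le_pow_left₀ hρ.le ?_ 2
        by_contra! h
        exact hpH ⟨hpK.1, by rwa [mem_ball, dist_eq_norm]⟩
      have hθ : |-β p.2| ≤ B := by rw [abs_neg]; exact hB _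
      by_cases hpT : p ∈ T
      · rw [indicator_of_mem hpT]
        have hpr : ‖p.2 - c‖ ≤ r := by simpa [dist_eq_norm] using hpT.2
        have := hstrict p.1 (‖p.2 - c‖ ^ 2) (-β p.2) (4 - r ^ 2) hqρ hθ hpT.1 (by nlinarith)
          (by nlinarith [norm_nonneg (p.2 - c)])
        simp only [hG]
        linarith
      · rw [indicator_of_notMem hpT]
        have := hsub p.1 (‖p.2 - c‖ ^ 2) (-β p.2) hqρ hθ
        simp only [hG]
        linarith
    · rw [indicator_of_notMem fun h => hpK (hTK h), hG0 p hpK]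
  refine ⟨(|M| + κ) / κ, by positivity, fun U hU => ?_⟩
  have hUc := hU.continuous
  have hiT : IntegrableOn U T := integrableOn_box hUc hTK
  have hiH : IntegrableOn U H := integrableOn_box hUc hHK
  have hiG : Integrable fun p => U p * G p :=
    (hUc.mul hGc).integrable_of_hasCompactSupport
      (HasCompactSupport.intro hK fun p hp => by simp [hG0 p hp])
  have hiF : Integrable fun p => U p * F p.1 (‖p.2 - c‖ ^ 2) :=
    (hUc.mul hcF).integrable_of_hasCompactSupport
      (HasCompactSupport.intro hK fun p hp => by simp [(hout p hp).1])
  have hgreen := integral_green hU.contDiff hβ c hK hF1 hF2 hFx hFc hF1c hF2c hFxc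
    (fun p hp => (hout p hp).1) (fun p hp => (hout p hp).2.1) (fun p hp => (hout p hp).2.2.1)
    (fun p hp => (hout p hp).2.2.2)
  have hLc : Continuous fun p => lapY U p + β p.2 * dX U p :=
    (continuous_lapY hU.contDiff).add ((hβ.comp continuous_snd).mul
      (continuous_dX (hU.contDiff.of_le (by norm_num))))
  have hiL : Integrable fun p => (lapY U p + β p.2 * dX U p) * F p.1 (‖p.2 - c‖ ^ 2) :=
    (hLc.mul hcF).integrable_of_hasCompactSupport
      (HasCompactSupport.intro hK fun p hp => by simp [(hout p hp).1])
  have hle : ∫ p, U p * G p ≤ 0 := by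
    have h1 : ∫ p, U p * G p = (∫ p, (lapY U p + β p.2 * dX U p) * F p.1 (‖p.2 - c‖ ^ 2))
        - ∫ p, U p * F p.1 (‖p.2 - c‖ ^ 2) := by
      rw [← hgreen, ← integral_sub]
      · congr 1
        ext p
        simp only [hG]
        ring
      · refine (hiG.add hiF).congr (Eventually.of_forall fun p => ?_)
        simp only [hG, Pi.add_apply]
        ring
      · exact hiF
    rw [h1, sub_nonpos]
    refine integral_mono hiL hiF fun p => ?_
    by_cases hp : p ∈ K
    · exact mul_le_mul_of_nonneg_right ((le_abs_self _).trans (hU.abs_le p hp)) (hF0 _ _)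
    · simp [(hout p hp).1]
  have hge : κ * (∫ p in T, U p) - (|M| + κ) * (∫ p in H, U p) ≤ ∫ p, U p * G p := by
    rw [← integral_indicator hTm, ← integral_indicator hHm, ← integral_const_mul,
      ← integral_const_mul, ← integral_sub ((hiT.integrable_indicator hTm).const_mul _)
        ((hiH.integrable_indicator hHm).const_mul _)]
    refine integral_mono (((hiT.integrable_indicator hTm).const_mul _).sub
        ((hiH.integrable_indicator hHm).const_mul _)) hiG fun p => ?_
    refine le_trans (le_of_eq ?_) (mul_le_mul_of_nonneg_left (hpt p) (hU.nonneg p))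
    by_cases h1 : p ∈ T <;> by_cases h2 : p ∈ H <;> simp [h1, h2] <;> ring
  rw [div_mul_eq_mul_div, le_div_iff₀ hκ0]
  linarith

/-- A pointwise lower bound for a near solution in a thin tube propagates to a box. -/
theorem exists_le_of_le_tube {β : Euc N → ℝ} {B : ℝ}
    (hB : ∀ y, |β y| ≤ B) (c : Euc N) {ρ a a' b' b r : ℝ} (hρ : 0 < ρ) (ha : a < a') (hb : b' < b)
    (hr0 : 0 ≤ r) (hr : r < 2) :
    ∃ κ > 0, ∀ U, IsNearSolution β (Icc a b ×ˢ closedBall c 2) U → ∀ m, 0 ≤ m →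
      (∀ p ∈ Icc a b ×ˢ ball c ρ, m ≤ U p) →
      ∀ p ∈ Icc a' b' ×ˢ closedBall c r, κ * m ≤ U p := by
  have hB0 : 0 ≤ B := (abs_nonneg _).trans (hB c)
  obtain ⟨n, F, F1, F2, Fx, hF1, hF2, hFx, hFc, hF1c, hF2c, hFxc, hvan, hF0, hF4, hFlow, hsub,
    -⟩ := exists_barrier ((N - 1 : ℕ) : ℝ) hB0 hρ ha hb
  have hr4 : 0 < 4 - r ^ 2 := by nlinarith
  refine ⟨(4 - r ^ 2) ^ (n + 3) / 4 ^ (n + 3), by positivity, fun U hU m hm hUm p hp => ?_⟩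
  set K : Set (ℝ × Euc N) := Icc a b ×ˢ closedBall c 2 with hKdef
  have hK : IsCompact K := isCompact_Icc.prod (isCompact_closedBall c 2)
  set ε : ℝ := m / 4 ^ (n + 3) with hε
  have hε0 : 0 ≤ ε := by positivity
  set f : ℝ × Euc N → ℝ := fun p => U p - ε * F p.1 (‖p.2 - c‖ ^ 2) with hf
  have hq : Continuous fun p : ℝ × Euc N => (p.1, ‖p.2 - c‖ ^ 2) := by fun_prop
  have hfc : Continuous f := hU.continuous.sub (continuous_const.mul (hFc.comp hq))
  have hpK : p ∈ K := ⟨Icc_subset_Icc ha.le hb.le hp.1, closedBall_subset_closedBall hr.le hp.2⟩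
  obtain ⟨w, hwK, hw⟩ := hK.exists_isMinOn ⟨p, hpK⟩ hfc.continuousOn
  have hU1 : ContDiff ℝ 1 U := hU.contDiff.of_le (by norm_num)
  have hfw : 0 ≤ f w := by
    by_contra! hneg
    have hin : w.1 ∈ Ioo a b ∧ ‖w.2 - c‖ ^ 2 < 4 := by
      by_contra h
      have h0 := (hvan w.1 (‖w.2 - c‖ ^ 2) (sq_nonneg _) (by
        by_contra! h'
        exact h ⟨h'.1, h'.2⟩)).1
      simp only [hf, h0] at hneg
      linarith [hU.nonneg w]
    have hlocal : IsLocalMin f w := by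
      refine hw.isLocalMin ?_
      refine prod_mem_nhds (Icc_mem_nhds hin.1.1 hin.1.2) ?_
      refine Filter.mem_of_superset (isOpen_ball.mem_nhds ?_) ball_subset_closedBall
      rw [mem_ball, dist_eq_norm]
      nlinarith [norm_nonneg (w.2 - c)]
    have hline : ∀ v : ℝ × Euc N, IsLocalMin (fun t : ℝ => f (w + t • v)) 0 := by
      intro v
      have hcont : ContinuousAt (fun t : ℝ => w + t • v) 0 := by fun_prop
      have h1 : ∀ᶠ q in 𝓝 (w + (0 : ℝ) • v), f w ≤ f q := by
        rw [zero_smul, add_zero]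
        exact hlocal
      filter_upwards [hcont.eventually h1] with t ht
      simpa using ht
    have hqρ : ρ ^ 2 ≤ ‖w.2 - c‖ ^ 2 := by
      refine pow_le_pow_left₀ hρ.le ?_ 2
      by_contra! h
      have h1 := hUm w ⟨hwK.1, by rwa [mem_ball, dist_eq_norm]⟩
      have h2 := mul_le_mul_of_nonneg_left (hF4 w.1 (‖w.2 - c‖ ^ 2) (sq_nonneg _)) hε0
      have h3 : ε * 4 ^ (n + 3) = m := by
        rw [hε]
        field_simp
      simp only [hf] at hneg
      linarith
    have hx : dX U w = ε * Fx w.1 (‖w.2 - c‖ ^ 2) := by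
      have h3 : HasDerivAt (fun t : ℝ => w.1 + t) 1 0 := by
        simpa using (hasDerivAt_id (0 : ℝ)).const_add w.1
      have h4 : HasDerivAt (fun t : ℝ => F (w.1 + t) (‖w.2 - c‖ ^ 2))
          (Fx w.1 (‖w.2 - c‖ ^ 2)) 0 := by
        have := HasDerivAt.comp (0 : ℝ) (h₂ := fun x => F x (‖w.2 - c‖ ^ 2))
          (h := fun t : ℝ => w.1 + t) (by simpa using hFx w.1 (‖w.2 - c‖ ^ 2)) h3
        simpa [Function.comp_def] using this
      have h5 : HasDerivAt (fun t : ℝ => f (w + t • ((1 : ℝ), (0 : Euc N))))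
          (dX U w - ε * Fx w.1 (‖w.2 - c‖ ^ 2)) 0 := by
        have h6 : HasDerivAt (fun t : ℝ => U (w + t • ((1 : ℝ), (0 : Euc N)))) (dX U w) 0 :=
          hasLineDerivAt_of_contDiff hU1 w ((1 : ℝ), (0 : Euc N))
        simpa [hf] using h6.fun_sub (h4.const_mul ε)
      linarith [(hline ((1 : ℝ), (0 : Euc N))).hasDerivAt_eq_zero h5]
    have hy : ∀ i : Fin (N - 1), 0 ≤
        fderiv ℝ (fun q => fderiv ℝ U q ((0 : ℝ), EuclideanSpace.single i (1 : ℝ))) w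
          ((0 : ℝ), EuclideanSpace.single i (1 : ℝ))
        - ε * (F2 w.1 (‖w.2 - c‖ ^ 2) * (2 * (w.2 i - c i)) ^ 2
          + 2 * F1 w.1 (‖w.2 - c‖ ^ 2)) := by
      intro i
      have h1 : ∀ p : ℝ × Euc N, HasLineDerivAt ℝ f
          (fderiv ℝ U p ((0 : ℝ), EuclideanSpace.single i (1 : ℝ))
            - ε * (F1 p.1 (‖p.2 - c‖ ^ 2) * (2 * (p.2 i - c i)))) p
          ((0 : ℝ), EuclideanSpace.single i (1 : ℝ)) := by
        intro p
        have e1 : HasDerivAt (fun t : ℝ => U (p + t • ((0 : ℝ), EuclideanSpace.single i (1 : ℝ))))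
            (fderiv ℝ U p ((0 : ℝ), EuclideanSpace.single i (1 : ℝ))) 0 :=
          hasLineDerivAt_of_contDiff hU1 p _
        have e2 := (hasDerivAt_radial_line p.2 c i (hF1 p.1 (‖p.2 - c‖ ^ 2))).const_mul ε
        simpa [HasLineDerivAt, hf] using e1.fun_sub e2
      have h2 : HasLineDerivAt ℝ (fun p : ℝ × Euc N =>
          fderiv ℝ U p ((0 : ℝ), EuclideanSpace.single i (1 : ℝ))
            - ε * (F1 p.1 (‖p.2 - c‖ ^ 2) * (2 * (p.2 i - c i))))
          (fderiv ℝ (fun q => fderiv ℝ U q ((0 : ℝ), EuclideanSpace.single i (1 : ℝ))) w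
            ((0 : ℝ), EuclideanSpace.single i (1 : ℝ))
          - ε * (F2 w.1 (‖w.2 - c‖ ^ 2) * (2 * (w.2 i - c i)) ^ 2
            + 2 * F1 w.1 (‖w.2 - c‖ ^ 2))) w
          ((0 : ℝ), EuclideanSpace.single i (1 : ℝ)) := by
        have e1 : HasDerivAt (fun t : ℝ => fderiv ℝ U
            (w + t • ((0 : ℝ), EuclideanSpace.single i (1 : ℝ)))
            ((0 : ℝ), EuclideanSpace.single i (1 : ℝ))) _ 0 :=
          hasLineDerivAt_of_contDiff (contDiff_fderiv_apply hU.contDiff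
            ((0 : ℝ), EuclideanSpace.single i (1 : ℝ))) w
            ((0 : ℝ), EuclideanSpace.single i (1 : ℝ))
        have e2 := (hasDerivAt_radial_line_second w.2 c i (hF2 w.1 (‖w.2 - c‖ ^ 2))).const_mul ε
        simpa [HasLineDerivAt] using e1.fun_sub e2
      exact (hline _).second_deriv_nonneg (HasLineDerivAt.hasDerivAt_line h1 w) h2
    have hlap := Finset.sum_nonneg fun i (_ : i ∈ Finset.univ) => hy i
    rw [Finset.sum_sub_distrib, ← Finset.mul_sum, sum_radial_second] at hlap
    change 0 ≤ lapY U w - _ at hlap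
    have h1 := (le_abs_self _).trans (hU.abs_le w hwK)
    have h2 := mul_le_mul_of_nonneg_left (hsub w.1 (‖w.2 - c‖ ^ 2) (β w.2) hqρ (hB _)) hε0
    rw [hx] at h1
    simp only [hf] at hneg
    linarith
  have h1 : f w ≤ f p := hw hpK
  have hpr : ‖p.2 - c‖ ≤ r := by simpa [dist_eq_norm] using hp.2
  have h2 := mul_le_mul_of_nonneg_left (hFlow p.1 (‖p.2 - c‖ ^ 2) (4 - r ^ 2) hp.1 hr4.le
    (by nlinarith [norm_nonneg (p.2 - c)])) hε0
  have h3 : (4 - r ^ 2) ^ (n + 3) / 4 ^ (n + 3) * m = ε * (4 - r ^ 2) ^ (n + 3) := by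
    rw [hε]
    ring
  simp only [hf] at h1 hfw
  linarith

end Propagation

section Average

variable {N : ℕ}

theorem hasDerivAt_inv_pow (d : ℕ) {r : ℝ} (hr : r ≠ 0) :
    HasDerivAt (fun r : ℝ => (r ^ d)⁻¹) (-(d : ℝ) * (r ^ d)⁻¹ / r) r := by
  have h := (hasDerivAt_pow d r).fun_inv (pow_ne_zero d hr)
  convert! h using 1
  cases d with
  | zero => simp
  | succ d =>
    simp only [Nat.add_sub_cancel]
    field_simp
    ring

/-- The weight in the `x`-variable, growing with the radius `r`. -/
def growingWeight (B r x : ℝ) : ℝ :=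
  Real.exp (r ^ 2 / 2) * max (1 / 5 + B * r ^ 2 / 2 - (x - 1 / 2) ^ 2 / 4) 0 ^ 2

/-- The derivative of `growingWeight` in `x`. -/
def growingWeightX (B r x : ℝ) : ℝ :=
  Real.exp (r ^ 2 / 2) *
    (2 * max (1 / 5 + B * r ^ 2 / 2 - (x - 1 / 2) ^ 2 / 4) 0 * (-(x - 1 / 2) / 2))

/-- The derivative of `growingWeight` in `r`. -/
def growingWeightR (B r x : ℝ) : ℝ :=
  r * growingWeight B r x + r * B * (Real.exp (r ^ 2 / 2) *
    (2 * max (1 / 5 + B * r ^ 2 / 2 - (x - 1 / 2) ^ 2 / 4) 0))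

theorem hasDerivAt_growingWeight_x (B r x : ℝ) :
    HasDerivAt (growingWeight B r) (growingWeightX B r x) x := by
  have h1 : HasDerivAt (fun x : ℝ => 1 / 5 + B * r ^ 2 / 2 - (x - 1 / 2) ^ 2 / 4)
      (-(x - 1 / 2) / 2) x := by
    have := ((((hasDerivAt_id x).sub_const (1 / 2)).fun_pow 2).div_const 4).const_sub
      (1 / 5 + B * r ^ 2 / 2)
    convert! this using 1
    simp
    ring
  have h2 := ((hasDerivAt_posPart_pow 0 _).comp x h1).const_mul (Real.exp (r ^ 2 / 2))
  convert! h2 using 1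
  simp [growingWeightX]

theorem hasDerivAt_growingWeight_r (B r x : ℝ) :
    HasDerivAt (fun r => growingWeight B r x) (growingWeightR B r x) r := by
  have h1 : HasDerivAt (fun r : ℝ => 1 / 5 + B * r ^ 2 / 2 - (x - 1 / 2) ^ 2 / 4) (B * r) r := by
    have := ((((hasDerivAt_pow 2 r).const_mul B).div_const 2).const_add (1 / 5)).sub_const
      ((x - 1 / 2) ^ 2 / 4)
    convert! this using 1
    simp
    ring
  have h0 : HasDerivAt (fun r : ℝ => Real.exp (r ^ 2 / 2)) (Real.exp (r ^ 2 / 2) * r) r := by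
    have := ((hasDerivAt_pow 2 r).div_const 2).exp
    convert! this using 1
    simp
  have h2 := h0.mul ((hasDerivAt_posPart_pow 0 _).comp r h1)
  convert! h2 using 1
  simp [growingWeightR, growingWeight]
  ring

theorem growingWeight_nonneg (B r x : ℝ) : 0 ≤ growingWeight B r x := by
  unfold growingWeight
  positivity

theorem posPart_eq_zero_of_far {B r δ x R : ℝ} (hr : B * r ^ 2 / 2 ≤ δ)
    (hR : 4 * (1 / 5 + δ) ≤ R ^ 2) (hR0 : 0 ≤ R) (hx : x ∉ Icc (1 / 2 - R) (1 / 2 + R)) :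
    max (1 / 5 + B * r ^ 2 / 2 - (x - 1 / 2) ^ 2 / 4) 0 = 0 := by
  refine max_eq_right ?_
  have : R ^ 2 ≤ (x - 1 / 2) ^ 2 := by
    rw [mem_Icc, not_and_or, not_le, not_le] at hx
    rcases hx with h | h <;> nlinarith
  linarith

theorem abs_mul_growingWeightX_le {B r x θ : ℝ} (hB : |θ| ≤ B) (hx : x ∈ Icc (-1 / 2 : ℝ) (3 / 2)) :
    |θ * growingWeightX B r x| ≤ B * (Real.exp (r ^ 2 / 2) *
    (2 * max (1 / 5 + B * r ^ 2 / 2 - (x - 1 / 2) ^ 2 / 4) 0)) := by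
  have h1 : |-(x - 1 / 2) / 2| ≤ 1 := by
    rw [abs_le]
    constructor <;> linarith [hx.1, hx.2]
  have h0 : 0 ≤ Real.exp (r ^ 2 / 2) *
    (2 * max (1 / 5 + B * r ^ 2 / 2 - (x - 1 / 2) ^ 2 / 4) 0) := by positivity
  rw [growingWeightX, ← mul_assoc (Real.exp _), abs_mul, abs_mul, abs_of_nonneg h0]
  refine mul_le_mul hB ?_ (by positivity) ((abs_nonneg _).trans hB)
  exact mul_le_of_le_one_right h0 h1

/-- The radial averaging kernel as a function of the squared distance. -/
def radialKernel (d : ℕ) (r q : ℝ) : ℝ := (r ^ d)⁻¹ * max (1 - q / r ^ 2) 0 ^ 2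

/-- A radial function whose Laplacian is the `r`-derivative of `radialKernel`, up to a factor. -/
def radialPotential (d : ℕ) (r q : ℝ) : ℝ := (r ^ d)⁻¹ * max (1 - q / r ^ 2) 0 ^ 3 / 6

/-- First derivative of `radialPotential`. -/
def radialPotential₁ (d : ℕ) (r q : ℝ) : ℝ :=
  -((r ^ d)⁻¹ * (r ^ 2)⁻¹ * max (1 - q / r ^ 2) 0 ^ 2 / 2)

/-- Second derivative of `radialPotential`. -/
def radialPotential₂ (d : ℕ) (r q : ℝ) : ℝ :=
  (r ^ d)⁻¹ * (r ^ 2)⁻¹ * (r ^ 2)⁻¹ * max (1 - q / r ^ 2) 0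

theorem hasDerivAt_one_sub_div (r q : ℝ) :
    HasDerivAt (fun q : ℝ => 1 - q / r ^ 2) (-(r ^ 2)⁻¹) q := by
  simpa [div_eq_mul_inv] using ((hasDerivAt_id q).div_const (r ^ 2)).const_sub 1

theorem hasDerivAt_radialPotential (d : ℕ) (r q : ℝ) :
    HasDerivAt (radialPotential d r) (radialPotential₁ d r q) q := by
  have h := ((((hasDerivAt_posPart_pow 1 _).comp q (hasDerivAt_one_sub_div r q))).const_mul
    ((r ^ d)⁻¹)).div_const 6
  convert! h using 1
  simp [radialPotential₁]
  ring

theorem hasDerivAt_radialPotential₁ (d : ℕ) (r q : ℝ) :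
    HasDerivAt (radialPotential₁ d r) (radialPotential₂ d r q) q := by
  have h := (((((hasDerivAt_posPart_pow 0 _).comp q (hasDerivAt_one_sub_div r q))).const_mul
    ((r ^ d)⁻¹ * (r ^ 2)⁻¹)).div_const 2).neg
  convert! h using 1
  simp [radialPotential₂]
  ring

theorem hasDerivAt_radialKernel (d : ℕ) {r : ℝ} (hr : r ≠ 0) (q : ℝ) :
    HasDerivAt (fun r => radialKernel d r q)
      (r * (4 * q * radialPotential₂ d r q + 2 * d * radialPotential₁ d r q)) r := by
  have h1 : HasDerivAt (fun r : ℝ => 1 - q / r ^ 2) (2 * q / r ^ 3) r := by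
    have := ((hasDerivAt_inv_pow 2 hr).const_mul q).const_sub 1
    simp only [← div_eq_mul_inv] at this
    convert! this using 1
    field_simp
    push_cast
    ring
  have h := (hasDerivAt_inv_pow d hr).mul ((hasDerivAt_posPart_pow 0 _).comp r h1)
  convert! h using 1
  simp [radialPotential₁, radialPotential₂]
  field_simp
  ring

theorem radialPotential_nonneg (d : ℕ) {r : ℝ} (hr : 0 < r) (q : ℝ) :
    0 ≤ radialPotential d r q := by
  unfold radialPotential
  positivity

theorem posPart_one_sub_div_le_one (r : ℝ) {q : ℝ} (hq : 0 ≤ q) : max (1 - q / r ^ 2) 0 ≤ 1 :=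
  max_le (by linarith [show 0 ≤ q / r ^ 2 by positivity]) zero_le_one

theorem radialPotential_le_radialKernel (d : ℕ) {r q : ℝ} (hr : 0 < r) (hq : 0 ≤ q) :
    radialPotential d r q ≤ radialKernel d r q := by
  unfold radialPotential radialKernel
  rw [mul_div_assoc]
  refine mul_le_mul_of_nonneg_left ?_ (by positivity)
  have h1 := posPart_one_sub_div_le_one r hq
  have h0 : 0 ≤ max (1 - q / r ^ 2) 0 := le_max_right _ _
  nlinarith [mul_nonneg (pow_nonneg h0 2) (sub_nonneg.2 h1), pow_nonneg h0 2]

theorem posPart_one_sub_div_eq_zero {r R q : ℝ} (hr : 0 < r) (hrR : r ≤ R) (hq : R ^ 2 ≤ q) :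
    max (1 - q / r ^ 2) 0 = 0 := by
  refine max_eq_right ?_
  have : r ^ 2 ≤ q := (pow_le_pow_left₀ hr.le hrR 2).trans hq
  rw [sub_nonpos, le_div_iff₀ (by positivity)]
  linarith

theorem continuous_growingWeight (B : ℝ) :
    Continuous fun p : ℝ × ℝ => growingWeight B p.1 p.2 := by
  unfold growingWeight
  fun_prop

theorem continuous_growingWeightX (B : ℝ) :
    Continuous fun p : ℝ × ℝ => growingWeightX B p.1 p.2 := by
  unfold growingWeightX
  fun_prop

theorem continuous_growingWeightR (B : ℝ) :
    Continuous fun p : ℝ × ℝ => growingWeightR B p.1 p.2 := by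
  unfold growingWeightR growingWeight
  fun_prop

/-- The weighted averages of a near solution increase with the radius. -/
theorem monotoneOn_weighted_average {β : Euc N → ℝ} (hβ : Continuous β) {B : ℝ}
    (hB : ∀ y, |β y| ≤ B) {δ : ℝ} (hδ : 0 < δ) (hBδ : B * δ ^ 2 / 2 ≤ 1 / 20) (c : Euc N)
    {U : ℝ × Euc N → ℝ}
    (hU : IsNearSolution β (Icc (-1 / 2 : ℝ) (3 / 2) ×ˢ closedBall c δ) U) :
    MonotoneOn (fun r => ∫ p : ℝ × Euc N, U p *
      (growingWeight B r p.1 * radialKernel (N - 1) r (‖p.2 - c‖ ^ 2))) (Ioc 0 δ) := by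
  have hB0 : 0 ≤ B := (abs_nonneg _).trans (hB c)
  have hUc := hU.continuous
  set K : Set (ℝ × Euc N) := Icc (-1 / 2 : ℝ) (3 / 2) ×ˢ closedBall c δ with hKdef
  have hK : IsCompact K := isCompact_Icc.prod (isCompact_closedBall c δ)
  set K' : Set (ℝ × Euc N) := Icc (1 / 2 - 2 : ℝ) (1 / 2 + 2) ×ˢ closedBall c (2 * δ) with hK'def
  have hK' : IsCompact K' := isCompact_Icc.prod (isCompact_closedBall c _)
  have hqc : Continuous fun p : ℝ × Euc N => ‖p.2 - c‖ ^ 2 := by fun_prop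
  have hdist : ∀ {y : Euc N} {R : ℝ}, 0 ≤ R → y ∉ closedBall c R → R ^ 2 ≤ ‖y - c‖ ^ 2 := by
    intro y R hR hy
    rw [mem_closedBall, dist_eq_norm, not_le] at hy
    exact pow_le_pow_left₀ hR hy.le 2
  have hderiv : ∀ r ∈ Ioo 0 (2 * δ), HasDerivAt (fun r => ∫ p : ℝ × Euc N, U p *
      (growingWeight B r p.1 * radialKernel (N - 1) r (‖p.2 - c‖ ^ 2)))
      (∫ p : ℝ × Euc N, U p * (growingWeightR B r p.1 * radialKernel (N - 1) r (‖p.2 - c‖ ^ 2)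
        + growingWeight B r p.1 * (r * (4 * ‖p.2 - c‖ ^ 2 *
          radialPotential₂ (N - 1) r (‖p.2 - c‖ ^ 2) + 2 * ((N - 1 : ℕ) : ℝ) *
          radialPotential₁ (N - 1) r (‖p.2 - c‖ ^ 2))))) r := by
    intro r hr
    refine hasDerivAt_integral_of_compact_support hK' hr ?_ ?_ ?_ ?_
      (F := fun r (p : ℝ × Euc N) => U p *
        (growingWeight B r p.1 * radialKernel (N - 1) r (‖p.2 - c‖ ^ 2)))
      (F' := fun r (p : ℝ × Euc N) => U p *
        (growingWeightR B r p.1 * radialKernel (N - 1) r (‖p.2 - c‖ ^ 2)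
        + growingWeight B r p.1 * (r * (4 * ‖p.2 - c‖ ^ 2 *
          radialPotential₂ (N - 1) r (‖p.2 - c‖ ^ 2) + 2 * ((N - 1 : ℕ) : ℝ) *
          radialPotential₁ (N - 1) r (‖p.2 - c‖ ^ 2)))))
    · intro s hs
      unfold growingWeight radialKernel
      fun_prop
    · have hne : ∀ q ∈ Ioo (0 : ℝ) (2 * δ) ×ˢ (univ : Set (ℝ × Euc N)), q.1 ≠ 0 :=
        fun q hq => hq.1.1.ne'
      have hpow : ∀ k, ContinuousOn (fun q : ℝ × (ℝ × Euc N) => (q.1 ^ k)⁻¹)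
          (Ioo (0 : ℝ) (2 * δ) ×ˢ univ) := fun k =>
        (by fun_prop : ContinuousOn (fun q : ℝ × (ℝ × Euc N) => q.1 ^ k) _).inv₀
          fun q hq => pow_ne_zero k (hne q hq)
      have h2 := hpow 2
      have hd := hpow (N - 1)
      have hm : ContinuousOn (fun q : ℝ × (ℝ × Euc N) =>
          max (1 - ‖q.2.2 - c‖ ^ 2 / q.1 ^ 2) 0) (Ioo (0 : ℝ) (2 * δ) ×ˢ univ) := by
        simp only [div_eq_mul_inv]
        exact ((continuousOn_const.sub ((by fun_prop : ContinuousOn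
          (fun q : ℝ × (ℝ × Euc N) => ‖q.2.2 - c‖ ^ 2) _).mul h2))).sup continuousOn_const
      have hE : ContinuousOn (fun q : ℝ × (ℝ × Euc N) => growingWeight B q.1 q.2.1)
          (Ioo (0 : ℝ) (2 * δ) ×ˢ univ) :=
        ((continuous_growingWeight B).comp (g := fun p : ℝ × ℝ => growingWeight B p.1 p.2)
          (f := fun q : ℝ × (ℝ × Euc N) => (q.1, q.2.1)) (by fun_prop)).continuousOn
      have hER : ContinuousOn (fun q : ℝ × (ℝ × Euc N) => growingWeightR B q.1 q.2.1)
          (Ioo (0 : ℝ) (2 * δ) ×ˢ univ) :=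
        ((continuous_growingWeightR B).comp (g := fun p : ℝ × ℝ => growingWeightR B p.1 p.2)
          (f := fun q : ℝ × (ℝ × Euc N) => (q.1, q.2.1)) (by fun_prop)).continuousOn
      have hU2 : ContinuousOn (fun q : ℝ × (ℝ × Euc N) => U q.2)
          (Ioo (0 : ℝ) (2 * δ) ×ˢ univ) := (hUc.comp continuous_snd).continuousOn
      unfold radialKernel radialPotential₁ radialPotential₂
      fun_prop
    · intro s hs p
      exact ((hasDerivAt_growingWeight_r B s p.1).mul
        (hasDerivAt_radialKernel (N - 1) hs.1.ne' (‖p.2 - c‖ ^ 2))).const_mul (U p)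
    · intro s hs p hp
      by_cases hx : p.1 ∈ Icc (1 / 2 - 2 : ℝ) (1 / 2 + 2)
      · have hy : p.2 ∉ closedBall c (2 * δ) := fun h => hp ⟨hx, h⟩
        simp [radialKernel, posPart_one_sub_div_eq_zero hs.1 hs.2.le (hdist (by linarith) hy)]
      · have h1 : B * s ^ 2 / 2 ≤ 1 / 5 := by
          have : s ^ 2 ≤ (2 * δ) ^ 2 := pow_le_pow_left₀ hs.1.le hs.2.le 2
          nlinarith
        simp only [growingWeight, posPart_eq_zero_of_far h1 (by norm_num) (by norm_num) hx]
        simp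
  refine monotoneOn_of_hasDerivWithinAt_nonneg (f' := fun r => ∫ p : ℝ × Euc N, U p *
      (growingWeightR B r p.1 * radialKernel (N - 1) r (‖p.2 - c‖ ^ 2)
        + growingWeight B r p.1 * (r * (4 * ‖p.2 - c‖ ^ 2 *
          radialPotential₂ (N - 1) r (‖p.2 - c‖ ^ 2) + 2 * ((N - 1 : ℕ) : ℝ) *
          radialPotential₁ (N - 1) r (‖p.2 - c‖ ^ 2))))) (convex_Ioc 0 δ)
    (fun r hr => (hderiv r ⟨hr.1, by linarith [hr.2]⟩).continuousAt.continuousWithinAt)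
    (fun r hr => ?_) (fun r hr => ?_)
  · rw [interior_Ioc] at hr
    exact (hderiv r ⟨hr.1, by linarith [hr.2]⟩).hasDerivWithinAt
  rw [interior_Ioc] at hr
  have hr0 := hr.1
  have hBr : B * r ^ 2 / 2 ≤ 1 / 20 := by
    have : r ^ 2 ≤ δ ^ 2 := pow_le_pow_left₀ hr.1.le hr.2.le 2
    nlinarith
  have hfar : ∀ x ∉ Icc (-1 / 2 : ℝ) (3 / 2),
      max (1 / 5 + B * r ^ 2 / 2 - (x - 1 / 2) ^ 2 / 4) 0 = 0 := fun x hx =>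
    posPart_eq_zero_of_far (R := 1) hBr (by norm_num) (by norm_num) (by
      convert hx using 2
      norm_num)
  have hout : ∀ p ∉ K, max (1 / 5 + B * r ^ 2 / 2 - (p.1 - 1 / 2) ^ 2 / 4) 0 = 0 ∨
      max (1 - ‖p.2 - c‖ ^ 2 / r ^ 2) 0 = 0 := by
    intro p hp
    by_cases hx : p.1 ∈ Icc (-1 / 2 : ℝ) (3 / 2)
    · right
      exact posPart_one_sub_div_eq_zero hr.1 hr.2.le (hdist hδ.le fun h => hp ⟨hx, h⟩)
    · exact Or.inl (hfar _ hx)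
  have hE0 : ∀ p : ℝ × Euc N, p ∉ K → ∀ f : ℝ → ℝ, f 0 = 0 → growingWeight B r p.1 *
      f (max (1 - ‖p.2 - c‖ ^ 2 / r ^ 2) 0) = 0 ∧ growingWeightX B r p.1 *
      f (max (1 - ‖p.2 - c‖ ^ 2 / r ^ 2) 0) = 0 ∧ growingWeightR B r p.1 *
      f (max (1 - ‖p.2 - c‖ ^ 2 / r ^ 2) 0) = 0 := by
    intro p hp f hf
    rcases hout p hp with h | h <;>
      simp only [growingWeight, growingWeightX, growingWeightR, h, hf] <;> simp
  have hcE : Continuous fun x => growingWeight B r x :=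
    (continuous_growingWeight B).comp (f := fun x : ℝ => (r, x)) (by fun_prop)
  have hcEX : Continuous fun x => growingWeightX B r x :=
    (continuous_growingWeightX B).comp (f := fun x : ℝ => (r, x)) (by fun_prop)
  have hcER : Continuous fun x => growingWeightR B r x :=
    (continuous_growingWeightR B).comp (f := fun x : ℝ => (r, x)) (by fun_prop)
  have hcP : Continuous fun q => radialKernel (N - 1) r q := by
    unfold radialKernel
    fun_prop
  have hcQ : Continuous fun q => radialPotential (N - 1) r q := by
    unfold radialPotential
    fun_prop
  have hcQ1 : Continuous fun q => radialPotential₁ (N - 1) r q := by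
    unfold radialPotential₁
    fun_prop
  have hcQ2 : Continuous fun q => radialPotential₂ (N - 1) r q := by
    unfold radialPotential₂
    fun_prop
  have hQ0 : ∀ p ∉ K, growingWeight B r p.1 * radialPotential (N - 1) r (‖p.2 - c‖ ^ 2) = 0 :=
    fun p hp => (hE0 p hp (fun m => (r ^ (N - 1))⁻¹ * m ^ 3 / 6) (by simp)).1
  have hQ10 : ∀ p ∉ K, growingWeight B r p.1 * radialPotential₁ (N - 1) r (‖p.2 - c‖ ^ 2) = 0 :=
    fun p hp => (hE0 p hp (fun m => -((r ^ (N - 1))⁻¹ * (r ^ 2)⁻¹ * m ^ 2 / 2)) (by simp)).1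
  have hQ20 : ∀ p ∉ K, growingWeight B r p.1 * radialPotential₂ (N - 1) r (‖p.2 - c‖ ^ 2) = 0 :=
    fun p hp => (hE0 p hp (fun m => (r ^ (N - 1))⁻¹ * (r ^ 2)⁻¹ * (r ^ 2)⁻¹ * m) (by simp)).1
  have hQx0 : ∀ p ∉ K, growingWeightX B r p.1 * radialPotential (N - 1) r (‖p.2 - c‖ ^ 2) = 0 :=
    fun p hp => (hE0 p hp (fun m => (r ^ (N - 1))⁻¹ * m ^ 3 / 6) (by simp)).2.1
  have hP0 : ∀ p ∉ K, growingWeightR B r p.1 * radialKernel (N - 1) r (‖p.2 - c‖ ^ 2) = 0 :=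
    fun p hp => (hE0 p hp (fun m => (r ^ (N - 1))⁻¹ * m ^ 2) (by simp)).2.2
  have hgreen := integral_green hU.contDiff hβ c hK
    (F := fun x q => growingWeight B r x * radialPotential (N - 1) r q)
    (F1 := fun x q => growingWeight B r x * radialPotential₁ (N - 1) r q)
    (F2 := fun x q => growingWeight B r x * radialPotential₂ (N - 1) r q)
    (Fx := fun x q => growingWeightX B r x * radialPotential (N - 1) r q)
    (fun x q => (hasDerivAt_radialPotential _ r q).const_mul _)
    (fun x q => (hasDerivAt_radialPotential₁ _ r q).const_mul _)
    (fun x q => (hasDerivAt_growingWeight_x B r x).mul_const _)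
    (by fun_prop) (by fun_prop) (by fun_prop) (by fun_prop) hQ0 hQ10 hQ20 hQx0
  have hint : ∀ f : ℝ × Euc N → ℝ, Continuous f → (∀ p ∉ K, f p = 0) → Integrable f :=
    fun f hf hf0 => hf.integrable_of_hasCompactSupport (HasCompactSupport.intro hK hf0)
  have hβ2 : Continuous fun p : ℝ × Euc N => β p.2 := hβ.comp continuous_snd
  have hLc : Continuous fun p => lapY U p + β p.2 * dX U p :=
    (continuous_lapY hU.contDiff).add (hβ2.mul (continuous_dX hU.contDiff))
  have i1 : Integrable fun p : ℝ × Euc N => (lapY U p + β p.2 * dX U p) *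
      (growingWeight B r p.1 * radialPotential (N - 1) r (‖p.2 - c‖ ^ 2)) :=
    hint _ (by fun_prop) fun p hp => by simp only [hQ0 p hp, mul_zero]
  have i2 : Integrable fun p : ℝ × Euc N => U p *
      (growingWeight B r p.1 * radialPotential (N - 1) r (‖p.2 - c‖ ^ 2)) :=
    hint _ (by fun_prop) fun p hp => by simp only [hQ0 p hp, mul_zero]
  have i3 : Integrable fun p : ℝ × Euc N => U p * (4 * ‖p.2 - c‖ ^ 2 *
      (growingWeight B r p.1 * radialPotential₂ (N - 1) r (‖p.2 - c‖ ^ 2))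
      + 2 * ((N - 1 : ℕ) : ℝ) *
        (growingWeight B r p.1 * radialPotential₁ (N - 1) r (‖p.2 - c‖ ^ 2))
      - β p.2 * (growingWeightX B r p.1 * radialPotential (N - 1) r (‖p.2 - c‖ ^ 2))) :=
    hint _ (by fun_prop) fun p hp => by
      simp only [hQ10 p hp, hQ20 p hp, hQx0 p hp, mul_zero, add_zero, sub_zero]
  have i4 : Integrable fun p : ℝ × Euc N => U p *
      (growingWeightR B r p.1 * radialKernel (N - 1) r (‖p.2 - c‖ ^ 2)
        + growingWeight B r p.1 * (r * (4 * ‖p.2 - c‖ ^ 2 *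
          radialPotential₂ (N - 1) r (‖p.2 - c‖ ^ 2) + 2 * ((N - 1 : ℕ) : ℝ) *
          radialPotential₁ (N - 1) r (‖p.2 - c‖ ^ 2)))) :=
    hint _ (by fun_prop) fun p hp => by
      have e1 := hQ10 p hp
      have e2 := hQ20 p hp
      have e3 := hP0 p hp
      linear_combination U p * e3 + U p * r * (4 * ‖p.2 - c‖ ^ 2) * e2
        + U p * r * (2 * ((N - 1 : ℕ) : ℝ)) * e1
  have hlow : -(∫ p : ℝ × Euc N, U p *
      (growingWeight B r p.1 * radialPotential (N - 1) r (‖p.2 - c‖ ^ 2))) ≤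
      ∫ p : ℝ × Euc N, (lapY U p + β p.2 * dX U p) *
      (growingWeight B r p.1 * radialPotential (N - 1) r (‖p.2 - c‖ ^ 2)) := by
    rw [← integral_neg]
    refine integral_mono i2.neg i1 fun p => ?_
    simp only
    by_cases hp : p ∈ K
    · rw [← neg_mul]
      exact mul_le_mul_of_nonneg_right (abs_le.1 (hU.abs_le p hp)).1
        (mul_nonneg (growingWeight_nonneg _ _ _) (radialPotential_nonneg _ hr.1 _))
    · rw [hQ0 p hp]
      simp
  have hmain : r * (∫ p : ℝ × Euc N, U p * (4 * ‖p.2 - c‖ ^ 2 *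
      (growingWeight B r p.1 * radialPotential₂ (N - 1) r (‖p.2 - c‖ ^ 2))
      + 2 * ((N - 1 : ℕ) : ℝ) *
        (growingWeight B r p.1 * radialPotential₁ (N - 1) r (‖p.2 - c‖ ^ 2))
      - β p.2 * (growingWeightX B r p.1 * radialPotential (N - 1) r (‖p.2 - c‖ ^ 2))))
      + r * (∫ p : ℝ × Euc N, U p *
      (growingWeight B r p.1 * radialPotential (N - 1) r (‖p.2 - c‖ ^ 2))) ≤
      ∫ p : ℝ × Euc N, U p *
      (growingWeightR B r p.1 * radialKernel (N - 1) r (‖p.2 - c‖ ^ 2)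
        + growingWeight B r p.1 * (r * (4 * ‖p.2 - c‖ ^ 2 *
          radialPotential₂ (N - 1) r (‖p.2 - c‖ ^ 2) + 2 * ((N - 1 : ℕ) : ℝ) *
          radialPotential₁ (N - 1) r (‖p.2 - c‖ ^ 2)))) := by
    rw [← integral_const_mul, ← integral_const_mul,
      ← integral_add (i3.const_mul r) (i2.const_mul r)]
    refine integral_mono ((i3.const_mul r).add (i2.const_mul r)) i4 fun p => ?_
    simp only
    have hQ := radialPotential_nonneg (N - 1) hr.1 (‖p.2 - c‖ ^ 2)
    have hQP := radialPotential_le_radialKernel (N - 1) hr.1 (sq_nonneg ‖p.2 - c‖)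
    have hE := growingWeight_nonneg B r p.1
    have hX : -(β p.2) * growingWeightX B r p.1 ≤ B * (Real.exp (r ^ 2 / 2) *
        (2 * max (1 / 5 + B * r ^ 2 / 2 - (p.1 - 1 / 2) ^ 2 / 4) 0)) := by
      by_cases hx : p.1 ∈ Icc (-1 / 2 : ℝ) (3 / 2)
      · exact (le_abs_self _).trans (abs_mul_growingWeightX_le (by rw [abs_neg]; exact hB _) hx)
      · simp only [growingWeightX, hfar _ hx]
        simp
    have hX0 : 0 ≤ B * (Real.exp (r ^ 2 / 2) *
        (2 * max (1 / 5 + B * r ^ 2 / 2 - (p.1 - 1 / 2) ^ 2 / 4) 0)) := by positivity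
    have hR : growingWeightR B r p.1 = r * growingWeight B r p.1 + r * (B *
        (Real.exp (r ^ 2 / 2) *
        (2 * max (1 / 5 + B * r ^ 2 / 2 - (p.1 - 1 / 2) ^ 2 / 4) 0))) := by
      rw [growingWeightR]
      ring
    rw [hR]
    generalize B * (Real.exp (r ^ 2 / 2) *
        (2 * max (1 / 5 + B * r ^ 2 / 2 - (p.1 - 1 / 2) ^ 2 / 4) 0)) = X at hX hX0 ⊢
    generalize growingWeight B r p.1 = E at hE ⊢
    generalize growingWeightX B r p.1 = EX at hX ⊢
    generalize radialPotential (N - 1) r (‖p.2 - c‖ ^ 2) = Q at hQ hQP ⊢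
    generalize radialKernel (N - 1) r (‖p.2 - c‖ ^ 2) = P at hQP ⊢
    have e1 : (E + X) * Q ≤ (E + X) * P := mul_le_mul_of_nonneg_left hQP (by positivity)
    have e2 : (-(β p.2) * EX) * Q ≤ X * Q := mul_le_mul_of_nonneg_right hX hQ
    have e3 : 0 ≤ r * U p * ((E + X) * P - E * Q - (-(β p.2) * EX) * Q) :=
      mul_nonneg (mul_nonneg hr.1.le (hU.nonneg p)) (by linarith)
    linarith
  have h5 := mul_le_mul_of_nonneg_left hlow hr.1.le
  rw [← hgreen] at h5
  linarith

end Average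

section AverageLimit

variable {N : ℕ}

/-- The weighted averages of a bounded continuous function over shrinking tubes converge. -/
theorem tendsto_weighted_average {B : ℝ} (hB0 : 0 ≤ B) {δ : ℝ} (hδ : 0 < δ)
    (hBδ : B * δ ^ 2 / 2 ≤ 1 / 20) (c : Euc N)
    {U : ℝ × Euc N → ℝ} (hUc : Continuous U) {M : ℝ} (hU0 : ∀ p, 0 ≤ U p) (hUM : ∀ p, U p ≤ M) :
    Tendsto (fun r => ∫ p : ℝ × Euc N, U p *
      (growingWeight B r p.1 * radialKernel (N - 1) r (‖p.2 - c‖ ^ 2))) (𝓝[>] 0)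
      (𝓝 ((∫ x in Icc (-1 / 2 : ℝ) (3 / 2), U (x, c) * growingWeight B 0 x) *
        ∫ ξ : Euc N, max (1 - ‖ξ‖ ^ 2) 0 ^ 2)) := by
  set I : Set ℝ := Icc (-1 / 2 : ℝ) (3 / 2) with hI
  have hfar : ∀ r ∈ Icc 0 δ, ∀ x ∉ I, growingWeight B r x = 0 := by
    intro r hr x hx
    have hBr : B * r ^ 2 / 2 ≤ 1 / 20 := by
      have : r ^ 2 ≤ δ ^ 2 := pow_le_pow_left₀ hr.1 hr.2 2
      nlinarith
    have := posPart_eq_zero_of_far (R := 1) (x := x) hBr (by norm_num) (by norm_num) (by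
      convert hx using 2
      rw [hI]
      norm_num)
    simp only [growingWeight, this]
    simp
  set H : ℝ → Euc N → ℝ := fun s y => ∫ x in I, U (x, y) * growingWeight B (max 0 (min s δ)) x
    with hH
  have hclamp : ∀ s, max 0 (min s δ) ∈ Icc 0 δ := fun s =>
    ⟨le_max_left _ _, max_le hδ.le (min_le_right _ _)⟩
  have hHc : Continuous fun q : ℝ × Euc N => H q.1 q.2 := by
    refine continuous_parametric_integral_of_continuous
      (f := fun (q : ℝ × Euc N) x => U (x, q.2) * growingWeight B (max 0 (min q.1 δ)) x) ?_
      isCompact_Icc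
    refine (hUc.comp (f := fun q : (ℝ × Euc N) × ℝ => (q.2, q.1.2)) (by fun_prop)).mul ?_
    exact (continuous_growingWeight B).comp
      (f := fun q : (ℝ × Euc N) × ℝ => (max 0 (min q.1.1 δ), q.2)) (by fun_prop)
  obtain ⟨E, hE⟩ := (isCompact_Icc.prod isCompact_Icc).exists_bound_of_continuousOn
    ((continuous_growingWeight B).continuousOn (s := Icc 0 δ ×ˢ I))
  have hHM : ∀ s y, |H s y| ≤ M * E * volume.real I := by
    intro s y
    rw [← Real.norm_eq_abs]
    refine norm_setIntegral_le_of_norm_le_const (by simp [hI]) fun x hx => ?_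
    rw [norm_mul, Real.norm_eq_abs, abs_of_nonneg (hU0 _)]
    exact mul_le_mul (hUM _) (hE (_, x) ⟨hclamp s, hx⟩) (norm_nonneg _)
      ((hU0 (x, y)).trans (hUM (x, y)))
  have hkc : Continuous fun ξ : Euc N => max (1 - ‖ξ‖ ^ 2) 0 ^ 2 := by fun_prop
  have hki : Integrable fun ξ : Euc N => max (1 - ‖ξ‖ ^ 2) 0 ^ 2 := by
    refine hkc.integrable_of_hasCompactSupport
      (HasCompactSupport.intro (isCompact_closedBall (0 : Euc N) 1) fun ξ hξ => ?_)
    rw [mem_closedBall_zero_iff, not_le] at hξ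
    rw [max_eq_right (by nlinarith)]
    simp
  have h := tendsto_integral_rescaled (μ := (volume : Measure (Euc N))) (H := H)
    (k := fun _ ξ => max (1 - ‖ξ‖ ^ 2) 0 ^ 2) (c := c) hHc.continuousAt
    (fun s => hHc.comp (f := fun y : Euc N => (s, y)) (by fun_prop)) (fun s _ y => hHM s y)
    (fun s _ => hkc) hki (fun s _ ξ => (abs_of_nonneg (by positivity)).le)
    (fun ξ => tendsto_const_nhds)
  have h0 : H 0 c = ∫ x in I, U (x, c) * growingWeight B 0 x := by
    simp [hH, hδ.le]
  rw [h0] at h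
  refine h.congr' ?_
  filter_upwards [Ioc_mem_nhdsGT hδ] with s hs
  have hs' : max 0 (min s δ) = s := by
    rw [min_eq_left hs.2, max_eq_right hs.1.le]
  have hrad : ∀ y : Euc N, (s ^ Module.finrank ℝ (Euc N))⁻¹ *
      max (1 - ‖s⁻¹ • (y - c)‖ ^ 2) 0 ^ 2 = radialKernel (N - 1) s (‖y - c‖ ^ 2) := by
    intro y
    rw [radialKernel, finrank_euclideanSpace_fin, norm_smul, mul_pow, norm_inv, Real.norm_eq_abs,
      abs_of_pos hs.1, inv_pow, div_eq_inv_mul]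
  simp only [hrad, hH, hs']
  rw [Measure.volume_eq_prod, integral_prod_symm]
  · refine integral_congr_ae (Eventually.of_forall fun y => ?_)
    simp only
    rw [← integral_mul_const]
    refine Eq.trans ?_ (setIntegral_eq_integral_of_forall_compl_eq_zero (s := I) ?_)
    · refine integral_congr_ae (Eventually.of_forall fun x => ?_)
      simp only
      ring
    · intro x hx
      simp [hfar s ⟨hs.1.le, hs.2⟩ x hx]
  · rw [← Measure.volume_eq_prod]
    have hcE : Continuous fun x => growingWeight B s x :=
      (continuous_growingWeight B).comp (f := fun x : ℝ => (s, x)) (by fun_prop)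
    have hcP : Continuous fun q => radialKernel (N - 1) s q := by
      unfold radialKernel
      fun_prop
    refine Continuous.integrable_of_hasCompactSupport (by fun_prop) (HasCompactSupport.intro
      (isCompact_Icc.prod (isCompact_closedBall c δ) : IsCompact (I ×ˢ closedBall c δ))
      fun p hp => ?_)
    by_cases hx : p.1 ∈ I
    · have hy : p.2 ∉ closedBall c δ := fun h => hp ⟨hx, h⟩
      rw [mem_closedBall, dist_eq_norm, not_le] at hy
      simp [radialKernel, posPart_one_sub_div_eq_zero hs.1 hs.2 (pow_le_pow_left₀ hδ.le hy.le 2)]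
    · simp [hfar s ⟨hs.1.le, hs.2⟩ _ hx]

/-- Integrals of a near solution over `x`-segments are controlled by its mass in a tube. -/
theorem exists_average_le_integral {β : Euc N → ℝ} (hβ : Continuous β) {B : ℝ}
    (hB : ∀ y, |β y| ≤ B) {δ₀ : ℝ} (hδ₀ : 0 < δ₀) :
    ∃ C > 0, ∀ (c : Euc N) (U : ℝ × Euc N → ℝ),
      IsNearSolution β (Icc (-1 / 2 : ℝ) (3 / 2) ×ˢ closedBall c δ₀) U →
      ∫ x in Icc (-1 / 3 : ℝ) (4 / 3), U (x, c) ≤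
        C * ∫ p in Icc (-1 / 2 : ℝ) (3 / 2) ×ˢ closedBall c δ₀, U p := by
  have hB0 : 0 ≤ B := (abs_nonneg _).trans (hB 0)
  set δ : ℝ := min δ₀ (min 1 (1 / (10 * (B + 1)))) with hδdef
  have hδ : 0 < δ := by positivity
  have hBδ : B * δ ^ 2 / 2 ≤ 1 / 20 := by
    have h1 : δ ≤ 1 := (min_le_right _ _).trans (min_le_left _ _)
    have h2 : δ ≤ 1 / (10 * (B + 1)) := (min_le_right _ _).trans (min_le_right _ _)
    rw [le_div_iff₀ (by positivity)] at h2
    nlinarith [mul_nonneg hB0 hδ.le]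
  set W : ℝ := ∫ ξ : Euc N, max (1 - ‖ξ‖ ^ 2) 0 ^ 2 with hW
  have hW0 : 0 < W := by
    refine Continuous.integral_pos_of_hasCompactSupport_nonneg_nonzero (x := 0) (by fun_prop)
      (HasCompactSupport.intro (isCompact_closedBall (0 : Euc N) 1) fun ξ hξ => ?_)
      (fun ξ => by positivity) (by simp)
    rw [mem_closedBall_zero_iff, not_le] at hξ
    rw [max_eq_right (by nlinarith)]
    simp
  set M : ℝ := Real.exp (δ ^ 2 / 2) * (1 / 4) ^ 2 * (δ ^ (N - 1))⁻¹ with hM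
  have hM0 : 0 < M := by positivity
  set e : ℝ := (1 / 5 - 25 / 144) ^ 2 with he
  have he0 : 0 < e := by norm_num [he]
  refine ⟨M / (e * W), by positivity, fun c U hU => ?_⟩
  have hUc := hU.continuous
  have hsub : Icc (-1 / 2 : ℝ) (3 / 2) ×ˢ closedBall c δ ⊆
      Icc (-1 / 2 : ℝ) (3 / 2) ×ˢ closedBall c δ₀ :=
    prod_mono le_rfl (closedBall_subset_closedBall (min_le_left _ _))
  have hmono := monotoneOn_weighted_average hβ hB hδ hBδ c (hU.mono hsub)
  obtain ⟨m, hm⟩ := hU.bounded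
  have hlim := tendsto_weighted_average hB0 hδ hBδ c hUc hU.nonneg hm
  have hle := le_of_tendsto hlim (by
    filter_upwards [Ioc_mem_nhdsGT hδ] with s hs
    exact hmono hs ⟨hδ, le_rfl⟩ hs.2)
  have hcE : ∀ r, Continuous fun x => growingWeight B r x := fun r =>
    (continuous_growingWeight B).comp (f := fun x : ℝ => (r, x)) (by fun_prop)
  have hcP : Continuous fun q => radialKernel (N - 1) δ q := by
    unfold radialKernel
    fun_prop
  have hUx : Continuous fun x : ℝ => U (x, c) := by fun_prop
  have hlow : e * (∫ x in Icc (-1 / 3 : ℝ) (4 / 3), U (x, c)) ≤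
      ∫ x in Icc (-1 / 2 : ℝ) (3 / 2), U (x, c) * growingWeight B 0 x := by
    have hc0 := hcE 0
    have h1 : ∫ x in Icc (-1 / 3 : ℝ) (4 / 3), U (x, c) * growingWeight B 0 x ≤
        ∫ x in Icc (-1 / 2 : ℝ) (3 / 2), U (x, c) * growingWeight B 0 x := by
      refine setIntegral_mono_set
        ((hUx.mul hc0).continuousOn.integrableOn_compact isCompact_Icc)
        (Eventually.of_forall fun x => mul_nonneg (hU.nonneg _) (growingWeight_nonneg _ _ _)) ?_
      exact (Icc_subset_Icc (by norm_num) (by norm_num)).eventuallyLE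
    refine le_trans ?_ h1
    rw [← integral_const_mul]
    refine setIntegral_mono_on
      ((continuous_const.mul hUx).continuousOn.integrableOn_compact isCompact_Icc)
      ((hUx.mul hc0).continuousOn.integrableOn_compact isCompact_Icc) measurableSet_Icc
      fun x hx => ?_
    rw [mul_comm]
    refine mul_le_mul_of_nonneg_left ?_ (hU.nonneg _)
    have h2 : 1 / 5 - 25 / 144 ≤ 1 / 5 + B * 0 ^ 2 / 2 - (x - 1 / 2) ^ 2 / 4 := by
      nlinarith [hx.1, hx.2]
    have h3 : e ≤ max (1 / 5 + B * 0 ^ 2 / 2 - (x - 1 / 2) ^ 2 / 4) 0 ^ 2 :=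
      pow_le_pow_left₀ (by norm_num) (le_max_of_le_left h2) 2
    rw [growingWeight]
    simpa using h3
  have hup : ∫ p : ℝ × Euc N, U p *
      (growingWeight B δ p.1 * radialKernel (N - 1) δ (‖p.2 - c‖ ^ 2)) ≤
      M * ∫ p in Icc (-1 / 2 : ℝ) (3 / 2) ×ˢ closedBall c δ₀, U p := by
    have hmeas : MeasurableSet (Icc (-1 / 2 : ℝ) (3 / 2) ×ˢ closedBall c δ₀) :=
      measurableSet_Icc.prod measurableSet_closedBall
    have hz : ∀ p ∉ Icc (-1 / 2 : ℝ) (3 / 2) ×ˢ closedBall c δ₀, U p *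
        (growingWeight B δ p.1 * radialKernel (N - 1) δ (‖p.2 - c‖ ^ 2)) = 0 := by
      intro p hp
      by_cases hx : p.1 ∈ Icc (-1 / 2 : ℝ) (3 / 2)
      · have hy : p.2 ∉ closedBall c δ₀ := fun h => hp ⟨hx, h⟩
        rw [mem_closedBall, dist_eq_norm, not_le] at hy
        simp [radialKernel, posPart_one_sub_div_eq_zero hδ le_rfl
          (pow_le_pow_left₀ hδ.le ((min_le_left _ _).trans hy.le) 2)]
      · have := posPart_eq_zero_of_far (R := 1) (x := p.1) hBδ (by norm_num) (by norm_num) (by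
          convert hx using 2
          norm_num)
        simp only [growingWeight, this]
        simp
    rw [← setIntegral_eq_integral_of_forall_compl_eq_zero hz, ← integral_const_mul]
    have hcδ := hcE δ
    refine setIntegral_mono_on (integrableOn_box (by fun_prop) le_rfl)
      (integrableOn_box (by fun_prop) le_rfl) hmeas fun p _ => ?_
    rw [mul_comm M]
    refine mul_le_mul_of_nonneg_left ?_ (hU.nonneg p)
    unfold growingWeight radialKernel
    have h1 := posPart_one_sub_div_le_one δ (sq_nonneg ‖p.2 - c‖)
    have h2 : max (1 / 5 + B * δ ^ 2 / 2 - (p.1 - 1 / 2) ^ 2 / 4) 0 ≤ 1 / 4 :=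
      max_le (by nlinarith [sq_nonneg (p.1 - 1 / 2)]) (by norm_num)
    have h3 : max (1 - ‖p.2 - c‖ ^ 2 / δ ^ 2) 0 ^ 2 ≤ 1 := pow_le_one₀ (le_max_right _ _) h1
    rw [hM]
    gcongr
    exact mul_le_of_le_one_right (by positivity) h3
  rw [div_mul_eq_mul_div, le_div_iff₀ (by positivity)]
  calc _ = e * (∫ x in Icc (-1 / 3 : ℝ) (4 / 3), U (x, c)) * W := by ring
    _ ≤ _ := mul_le_mul_of_nonneg_right hlow hW0.le
    _ ≤ _ := hle
    _ ≤ _ := hup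

end AverageLimit

section HeatKernel

/-- A Gaussian with a correction absorbing the variation of the coefficient. -/
def heatKernel (d : ℕ) (b M τ q : ℝ) : ℝ :=
  (τ ^ d)⁻¹ * Real.exp (-(b / 4) * (q * (τ ^ 2)⁻¹) - q ^ 2 * (τ ^ 3)⁻¹ - M * τ)

/-- The negative logarithmic derivative of `heatKernel` in `q`. -/
def heatSlope (b τ q : ℝ) : ℝ := b / 4 * (τ ^ 2)⁻¹ + 2 * q * (τ ^ 3)⁻¹

/-- The logarithmic derivative of `heatKernel` in `τ`. -/
def heatRate (d : ℕ) (b M τ q : ℝ) : ℝ :=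
  -(d : ℝ) / τ + b * q / (2 * τ ^ 3) + 3 * q ^ 2 / τ ^ 4 - M

theorem hasDerivAt_heatKernel (d : ℕ) (b M τ q : ℝ) :
    HasDerivAt (heatKernel d b M τ) (-(heatSlope b τ q) * heatKernel d b M τ q) q := by
  have h1 : HasDerivAt (fun q : ℝ => -(b / 4) * (q * (τ ^ 2)⁻¹) - q ^ 2 * (τ ^ 3)⁻¹ - M * τ)
      (-(heatSlope b τ q)) q := by
    have := ((((hasDerivAt_id q).mul_const (τ ^ 2)⁻¹).const_mul (-(b / 4))).fun_sub
      ((hasDerivAt_pow 2 q).mul_const (τ ^ 3)⁻¹)).sub_const (M * τ)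
    convert! this using 1
    simp [heatSlope]
    ring
  have h2 := h1.exp.const_mul (τ ^ d)⁻¹
  convert! h2 using 1
  simp [heatKernel]
  ring

theorem hasDerivAt_heatSlope (b τ q : ℝ) : HasDerivAt (heatSlope b τ) (2 * (τ ^ 3)⁻¹) q := by
  have := (((hasDerivAt_id q).const_mul 2).mul_const (τ ^ 3)⁻¹).const_add (b / 4 * (τ ^ 2)⁻¹)
  convert! this using 1
  simp

theorem hasDerivAt_heatKernel_time (d : ℕ) (b M : ℝ) {τ : ℝ} (hτ : τ ≠ 0) (q : ℝ) :
    HasDerivAt (fun τ => heatKernel d b M τ q)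
      (heatRate d b M τ q * heatKernel d b M τ q) τ := by
  have h1 := ((((hasDerivAt_inv_pow 2 hτ).const_mul q).const_mul (-(b / 4))).fun_sub
      ((hasDerivAt_inv_pow 3 hτ).const_mul (q ^ 2))).fun_sub ((hasDerivAt_id τ).const_mul M)
  have h2 := (hasDerivAt_inv_pow d hτ).fun_mul h1.exp
  convert! h2 using 1
  simp only [heatRate, heatKernel, id]
  push_cast
  field_simp
  ring

/-- The truncated heat kernel. -/
def cutHeat (d : ℕ) (ρ b M τ q : ℝ) : ℝ := heatKernel d b M τ q * max (ρ ^ 2 - q) 0 ^ 4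

/-- First `q`-derivative of `cutHeat`. -/
def cutHeat₁ (d : ℕ) (ρ b M τ q : ℝ) : ℝ :=
  heatKernel d b M τ q *
    (-(heatSlope b τ q) * max (ρ ^ 2 - q) 0 ^ 4 - 4 * max (ρ ^ 2 - q) 0 ^ 3)

/-- Second `q`-derivative of `cutHeat`. -/
def cutHeat₂ (d : ℕ) (ρ b M τ q : ℝ) : ℝ :=
  heatKernel d b M τ q * ((heatSlope b τ q ^ 2 - 2 * (τ ^ 3)⁻¹) * max (ρ ^ 2 - q) 0 ^ 4
    + 8 * heatSlope b τ q * max (ρ ^ 2 - q) 0 ^ 3 + 12 * max (ρ ^ 2 - q) 0 ^ 2)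

theorem hasDerivAt_sq_sub (ρ q : ℝ) : HasDerivAt (fun q : ℝ => ρ ^ 2 - q) (-1) q := by
  simpa using (hasDerivAt_id q).const_sub (ρ ^ 2)

theorem hasDerivAt_cutHeat (d : ℕ) (ρ b M τ q : ℝ) :
    HasDerivAt (cutHeat d ρ b M τ) (cutHeat₁ d ρ b M τ q) q := by
  have h := (hasDerivAt_heatKernel d b M τ q).mul
    ((hasDerivAt_posPart_pow 2 _).comp q (hasDerivAt_sq_sub ρ q))
  convert! h using 1
  simp [cutHeat₁]
  ring

theorem hasDerivAt_cutHeat₁ (d : ℕ) (ρ b M τ q : ℝ) :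
    HasDerivAt (cutHeat₁ d ρ b M τ) (cutHeat₂ d ρ b M τ q) q := by
  have h4 := (hasDerivAt_posPart_pow 2 _).comp q (hasDerivAt_sq_sub ρ q)
  have h3 := (hasDerivAt_posPart_pow 1 _).comp q (hasDerivAt_sq_sub ρ q)
  have h := (hasDerivAt_heatKernel d b M τ q).mul
    (((hasDerivAt_heatSlope b τ q).neg.mul h4).sub (h3.const_mul 4))
  convert! h using 1
  simp [cutHeat₂]
  ring

theorem hasDerivAt_cutHeat_time (d : ℕ) (ρ b M : ℝ) {τ : ℝ} (hτ : τ ≠ 0) (q : ℝ) :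
    HasDerivAt (fun τ => cutHeat d ρ b M τ q)
      (heatRate d b M τ q * cutHeat d ρ b M τ q) τ := by
  have h := (hasDerivAt_heatKernel_time d b M hτ q).mul_const (max (ρ ^ 2 - q) 0 ^ 4)
  convert! h using 1
  simp only [cutHeat]
  ring

theorem heatKernel_pos (d : ℕ) (b M : ℝ) {τ : ℝ} (hτ : 0 < τ) (q : ℝ) :
    0 < heatKernel d b M τ q := by
  unfold heatKernel
  positivity

theorem cutHeat_nonneg (d : ℕ) (ρ b M : ℝ) {τ : ℝ} (hτ : 0 < τ) (q : ℝ) :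
    0 ≤ cutHeat d ρ b M τ q :=
  mul_nonneg (heatKernel_pos d b M hτ q).le (by positivity)

/-- A quartic with positive leading coefficient is bounded below on the half line. -/
theorem quartic_lower_bound {A P s : ℝ} (hA : 0 < A) (hP : 0 ≤ P) (hs : 0 ≤ s) {p₁ p₂ p₃ : ℝ}
    (h₁ : 0 ≤ p₁) (h₂ : 0 ≤ p₂) (h₃ : 0 ≤ p₃) (hsum : p₁ + p₂ + p₃ = P) :
    -(P + P * (P / A) ^ 3) ≤ A * s ^ 4 - p₃ * s ^ 3 - p₂ * s ^ 2 - p₁ * s := by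
  have hPA : 0 ≤ P / A := by positivity
  have hPA3 : 0 ≤ P * (P / A) ^ 3 := by positivity
  rcases le_total s 1 with h | h
  · have e2 : s ^ 2 ≤ 1 := pow_le_one₀ hs h
    have e3 : s ^ 3 ≤ 1 := pow_le_one₀ hs h
    have e4 : 0 ≤ A * s ^ 4 := by positivity
    nlinarith
  · have e1 : s ≤ s ^ 3 := le_self_pow₀ h (by norm_num)
    have e2 : s ^ 2 ≤ s ^ 3 := pow_le_pow_right₀ h (by norm_num)
    have e0 : A * s ^ 4 - P * s ^ 3 ≤ A * s ^ 4 - p₃ * s ^ 3 - p₂ * s ^ 2 - p₁ * s := by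
      rw [← hsum]
      nlinarith
    refine le_trans ?_ e0
    rcases le_total s (P / A) with h' | h'
    · have e3 : s ^ 3 ≤ (P / A) ^ 3 := pow_le_pow_left₀ hs h' 3
      have e4 : 0 ≤ A * s ^ 4 := by positivity
      nlinarith
    · rw [div_le_iff₀ hA] at h'
      have e3 : 0 ≤ s ^ 3 * (s * A - P) := mul_nonneg (by positivity) (by linarith)
      nlinarith

/-- The differential inequality satisfied by the untruncated kernel. -/
theorem heat_core_nonneg (d : ℕ) {b₀ B L ρ Λ M T b θ n τ : ℝ} (hb₀ : 0 < b₀) (hb : b₀ ≤ b)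
    (hbB : b ≤ B) (hL : 0 ≤ L) (hLρ : L * ρ ≤ b₀ / 2) (hn : 0 ≤ n) (hnρ : n ≤ ρ)
    (hθ : |θ - b| ≤ L * n) (hτ : 0 < τ) (hτT : τ ≤ T) (hΛ : 0 ≤ Λ)
    (hM : 2 * T * (Λ + 1) + (L * d + (16 + 8 * d) + B * L / 2 + (L * d + (16 + 8 * d) + B * L / 2)
      * ((L * d + (16 + 8 * d) + B * L / 2) / (3 * b₀)) ^ 3) ≤ b₀ / 2 * M) :
    0 ≤ 2 * τ * (4 * n ^ 2 * (heatSlope b τ (n ^ 2) ^ 2 - 2 * (τ ^ 3)⁻¹)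
      - 2 * d * heatSlope b τ (n ^ 2) - Λ) - θ * heatRate d b M τ (n ^ 2) - 2 * τ := by
  obtain ⟨s, rfl⟩ : ∃ s, n = s * τ := ⟨n / τ, by field_simp⟩
  obtain ⟨η, rfl⟩ : ∃ η, θ = b + η * τ := ⟨(θ - b) / τ, by field_simp; ring⟩
  have hs : 0 ≤ s := nonneg_of_mul_nonneg_left hn hτ
  have hη : |η| ≤ L * s := by
    have h1 : |η| * τ ≤ L * s * τ := by
      have : b + η * τ - b = η * τ := by ring
      rw [this, abs_mul, abs_of_pos hτ] at hθ
      linarith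
    exact le_of_mul_le_mul_right h1 hτ
  have hητ : |η * τ| ≤ b₀ / 2 := by
    have : b + η * τ - b = η * τ := by ring
    rw [this] at hθ
    exact hθ.trans ((mul_le_mul_of_nonneg_left hnρ hL).trans hLρ)
  have hητ1 := abs_le.1 hητ
  have hη1 := abs_le.1 hη
  have hd : (0 : ℝ) ≤ d := Nat.cast_nonneg d
  have hB : 0 ≤ B := by linarith
  have hT : 0 < T := hτ.trans_le hτT
  have hM0 : 0 ≤ M := by
    have : 0 ≤ b₀ / 2 * M := le_trans (by positivity) hM
    exact nonneg_of_mul_nonneg_right this (by positivity)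
  have hquart := quartic_lower_bound (A := 3 * b₀) (by positivity)
    (P := L * d + (16 + 8 * d) + B * L / 2) (by positivity) hs (p₁ := L * d) (p₂ := 16 + 8 * d)
    (p₃ := B * L / 2) (by positivity) (by positivity) (by positivity) rfl
  have hid : 2 * τ * (4 * (s * τ) ^ 2 * (heatSlope b τ ((s * τ) ^ 2) ^ 2 - 2 * (τ ^ 3)⁻¹)
      - 2 * d * heatSlope b τ ((s * τ) ^ 2) - Λ) - (b + η * τ) * heatRate d b M τ ((s * τ) ^ 2)
      - 2 * τ = η * d - b * s ^ 2 * η / 2 + (5 * b - 3 * (η * τ)) * s ^ 4 + 32 * s ^ 6 * τ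
        - (16 + 8 * d) * s ^ 2 + (b + η * τ) * M - 2 * τ * (Λ + 1) := by
    simp only [heatSlope, heatRate]
    field_simp
    ring
  rw [hid]
  have e1 : -(L * s * d) ≤ η * d := by nlinarith
  have e2 : b * s ^ 2 * η / 2 ≤ B * L / 2 * s ^ 3 := by
    have h1 : b * s ^ 2 * η ≤ B * s ^ 2 * (L * s) := by
      refine (mul_le_mul_of_nonneg_left hη1.2 (by nlinarith [sq_nonneg s])).trans ?_
      exact mul_le_mul_of_nonneg_right (mul_le_mul_of_nonneg_right hbB (sq_nonneg s))
        (by positivity)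
    nlinarith
  have e3 : 3 * b₀ * s ^ 4 ≤ (5 * b - 3 * (η * τ)) * s ^ 4 :=
    mul_le_mul_of_nonneg_right (by linarith) (by positivity)
  have e4 : 0 ≤ 32 * s ^ 6 * τ := by positivity
  have e5 : b₀ / 2 * M ≤ (b + η * τ) * M := mul_le_mul_of_nonneg_right (by linarith) hM0
  have e6 : 2 * τ * (Λ + 1) ≤ 2 * T * (Λ + 1) :=
    mul_le_mul_of_nonneg_right (by linarith) (by positivity)
  linarith

/-- The truncated heat kernel is a subsolution of the adjoint problem. -/
theorem cutHeat_subsolution (d : ℕ) {b₀ B L ρ M T b θ n τ : ℝ} (hb₀ : 0 < b₀) (hb : b₀ ≤ b)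
    (hbB : b ≤ B) (hL : 0 ≤ L) (hρ : 0 < ρ) (hLρ : L * ρ ≤ b₀ / 2) (hn : 0 ≤ n) (hnρ : n ≤ ρ)
    (hθ : |θ - b| ≤ L * n) (hτ : 0 < τ) (hτT : τ ≤ T)
    (hM : 2 * T * ((6 + d) ^ 2 / (3 * ρ ^ 2) + 1) + (L * d + (16 + 8 * d) + B * L / 2
      + (L * d + (16 + 8 * d) + B * L / 2)
      * ((L * d + (16 + 8 * d) + B * L / 2) / (3 * b₀)) ^ 3) ≤ b₀ / 2 * M) :
    0 ≤ 2 * τ * (4 * n ^ 2 * cutHeat₂ d ρ b M τ (n ^ 2) + 2 * d * cutHeat₁ d ρ b M τ (n ^ 2))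
      - θ * (heatRate d b M τ (n ^ 2) * cutHeat d ρ b M τ (n ^ 2))
      - 2 * τ * cutHeat d ρ b M τ (n ^ 2) := by
  have hcore := heat_core_nonneg d hb₀ hb hbB hL hLρ hn hnρ hθ hτ hτT
    (Λ := (6 + d) ^ 2 / (3 * ρ ^ 2)) (by positivity) hM
  have hψ := heatKernel_pos d b M hτ (n ^ 2)
  have hw : max (ρ ^ 2 - n ^ 2) 0 = ρ ^ 2 - n ^ 2 := max_eq_left (by nlinarith)
  have hw0 : 0 ≤ ρ ^ 2 - n ^ 2 := by nlinarith
  have ha : 0 ≤ heatSlope b τ (n ^ 2) := by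
    have : 0 ≤ b := by linarith
    unfold heatSlope
    positivity
  simp only [cutHeat, cutHeat₁, cutHeat₂, hw]
  generalize heatKernel d b M τ (n ^ 2) = ψ at hψ
  generalize heatSlope b τ (n ^ 2) = a at *
  generalize heatRate d b M τ (n ^ 2) = R at *
  obtain ⟨w, hwdef⟩ : ∃ w, w = ρ ^ 2 - n ^ 2 := ⟨_, rfl⟩
  rw [← hwdef] at hw0 ⊢
  have hΛ : 0 ≤ (6 + d) ^ 2 / (3 * ρ ^ 2) * w ^ 2 + (48 * n ^ 2 - 8 * d * w) := by
    have h1 : (6 + d : ℝ) ^ 2 / (3 * ρ ^ 2) * w ^ 2 + (48 * n ^ 2 - 8 * d * w)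
        = ((6 + d) * w - 12 * ρ ^ 2) ^ 2 / (3 * ρ ^ 2) := by
      have : n ^ 2 = ρ ^ 2 - w := by linarith
      rw [this]
      field_simp
      ring
    rw [h1]
    positivity
  have e1 := mul_nonneg (mul_nonneg hψ.le (pow_nonneg hw0 4)) hcore
  have e2 := mul_nonneg (mul_nonneg (mul_nonneg hψ.le (pow_nonneg hw0 2)) hτ.le) hΛ
  have e3 : 0 ≤ ψ * w ^ 3 * τ * (n ^ 2 * a) := by positivity
  linarith

end HeatKernel

section WeakHarnack

variable {N : ℕ}

theorem cutHeat_eq_zero {d : ℕ} {ρ b M τ : ℝ} {c y : Euc N} (hρ : 0 < ρ)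
    (hy : y ∉ closedBall c ρ) : cutHeat d ρ b M τ (‖y - c‖ ^ 2) = 0 ∧
      cutHeat₁ d ρ b M τ (‖y - c‖ ^ 2) = 0 ∧ cutHeat₂ d ρ b M τ (‖y - c‖ ^ 2) = 0 := by
  rw [mem_closedBall, dist_eq_norm, not_le] at hy
  have : max (ρ ^ 2 - ‖y - c‖ ^ 2) 0 = 0 := max_eq_right (by nlinarith)
  simp [cutHeat, cutHeat₁, cutHeat₂, this]

/-- Averages against the truncated heat kernel decrease along the parabolic direction. -/
theorem antitoneOn_heat_average {β : Euc N → ℝ} (hβ : Continuous β) {σ : ℝ} (hσ : σ * σ = 1)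
    {b₀ B L ρ M T : ℝ} (hb₀ : 0 < b₀) (hL : 0 ≤ L) (hρ : 0 < ρ) (hLρ : L * ρ ≤ b₀ / 2)
    {c : Euc N} (hb : b₀ ≤ σ * β c) (hbB : σ * β c ≤ B)
    (hθ : ∀ y ∈ closedBall c ρ, |σ * β y - σ * β c| ≤ L * ‖y - c‖)
    (hM : 2 * T * ((6 + (N - 1 : ℕ)) ^ 2 / (3 * ρ ^ 2) + 1) + (L * (N - 1 : ℕ) +
      (16 + 8 * (N - 1 : ℕ)) + B * L / 2 + (L * (N - 1 : ℕ) + (16 + 8 * (N - 1 : ℕ)) + B * L / 2)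
      * ((L * (N - 1 : ℕ) + (16 + 8 * (N - 1 : ℕ)) + B * L / 2) / (3 * b₀)) ^ 3) ≤ b₀ / 2 * M)
    {U : ℝ × Euc N → ℝ} (hU : ContDiff ℝ 2 U) (hU0 : ∀ p, 0 ≤ U p) {x₁ t : ℝ} (htT : t ≤ T)
    (hLU : ∀ s ∈ Icc 0 (t ^ 2), ∀ y ∈ closedBall c ρ,
      lapY U (x₁ + σ * s, y) + β y * dX U (x₁ + σ * s, y) ≤ U (x₁ + σ * s, y)) :
    AntitoneOn (fun τ => ∫ y : Euc N, U (x₁ + σ * τ ^ 2, y) *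
      (σ * β y * cutHeat (N - 1) ρ (σ * β c) M τ (‖y - c‖ ^ 2))) (Ioc 0 t) := by
  set Φ : ℝ → ℝ → ℝ := cutHeat (N - 1) ρ (σ * β c) M with hΦ
  set R : ℝ → ℝ → ℝ := heatRate (N - 1) (σ * β c) M with hR
  have hK : IsCompact (closedBall c ρ) := isCompact_closedBall c ρ
  have hUc := hU.continuous
  have hUx := continuous_dX hU
  have hUL := continuous_lapY hU
  have hz : ∀ τ, ∀ y ∉ closedBall c ρ, Φ τ (‖y - c‖ ^ 2) = 0 := fun τ y hy =>
    (cutHeat_eq_zero hρ hy).1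
  have hUd : ∀ τ : ℝ, ∀ y : Euc N, HasDerivAt (fun τ : ℝ => U (x₁ + σ * τ ^ 2, y))
      (2 * σ * τ * dX U (x₁ + σ * τ ^ 2, y)) τ := by
    intro τ y
    have h1 := HasLineDerivAt.hasDerivAt_line (f := U) (f1 := dX U)
      (v := ((1 : ℝ), (0 : Euc N)))
      (fun p => hasLineDerivAt_of_contDiff (hU.of_le (by norm_num)) p _) (x₁, y) (σ * τ ^ 2)
    have h2 : HasDerivAt (fun τ : ℝ => σ * τ ^ 2) (2 * σ * τ) τ := by
      have := (hasDerivAt_pow 2 τ).const_mul σ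
      convert! this using 1
      simp
      ring
    have h3 := h1.comp τ h2
    convert! h3 using 1
    · ext s
      simp
    · simp
      ring
  have hderiv : ∀ τ ∈ Ioo 0 (t + 1), HasDerivAt (fun τ => ∫ y : Euc N, U (x₁ + σ * τ ^ 2, y) *
      (σ * β y * Φ τ (‖y - c‖ ^ 2)))
      (∫ y : Euc N, (2 * σ * τ * dX U (x₁ + σ * τ ^ 2, y) * (σ * β y * Φ τ (‖y - c‖ ^ 2)) +
        U (x₁ + σ * τ ^ 2, y) * (σ * β y * (R τ (‖y - c‖ ^ 2) * Φ τ (‖y - c‖ ^ 2))))) τ := by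
    intro τ hτ
    refine hasDerivAt_integral_of_compact_support hK hτ ?_ ?_ ?_ ?_
      (F := fun τ (y : Euc N) => U (x₁ + σ * τ ^ 2, y) * (σ * β y * Φ τ (‖y - c‖ ^ 2)))
      (F' := fun τ (y : Euc N) => 2 * σ * τ * dX U (x₁ + σ * τ ^ 2, y) *
        (σ * β y * Φ τ (‖y - c‖ ^ 2)) +
        U (x₁ + σ * τ ^ 2, y) * (σ * β y * (R τ (‖y - c‖ ^ 2) * Φ τ (‖y - c‖ ^ 2))))
    · intro s hs
      simp only [hΦ]
      unfold cutHeat heatKernel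
      fun_prop
    · have hne : ∀ q ∈ Ioo (0 : ℝ) (t + 1) ×ˢ (univ : Set (Euc N)), q.1 ≠ 0 :=
        fun q hq => hq.1.1.ne'
      have hpow : ∀ k, ContinuousOn (fun q : ℝ × Euc N => (q.1 ^ k)⁻¹)
          (Ioo (0 : ℝ) (t + 1) ×ˢ univ) := fun k =>
        (by fun_prop : ContinuousOn (fun q : ℝ × Euc N => q.1 ^ k) _).inv₀
          fun q hq => pow_ne_zero k (hne q hq)
      have h1 : ContinuousOn (fun q : ℝ × Euc N => q.1⁻¹) (Ioo (0 : ℝ) (t + 1) ×ˢ univ) := by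
        simpa using hpow 1
      have h2 := hpow 2
      have h3 := hpow 3
      have h4 := hpow 4
      have hd := hpow (N - 1)
      simp only [hΦ, hR]
      unfold cutHeat heatKernel heatRate
      simp only [div_eq_mul_inv, mul_inv]
      fun_prop
    · intro s hs y
      exact (hUd s y).mul ((hasDerivAt_cutHeat_time (N - 1) ρ (σ * β c) M hs.1.ne'
        (‖y - c‖ ^ 2)).const_mul (σ * β y))
    · intro s hs y hy
      simp [hz s y hy]
  refine antitoneOn_of_hasDerivWithinAt_nonpos (convex_Ioc 0 t)
    (fun r hr => (hderiv r ⟨hr.1, by linarith [hr.2]⟩).continuousAt.continuousWithinAt)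
    (fun r hr => by
      rw [interior_Ioc] at hr
      exact (hderiv r ⟨hr.1, by linarith [hr.2]⟩).hasDerivWithinAt) (fun r hr => ?_)
  rw [interior_Ioc] at hr
  have hr0 := hr.1
  set x := x₁ + σ * r ^ 2 with hx
  have hΦc : Continuous (Φ r) := by
    simp only [hΦ]
    unfold cutHeat heatKernel
    fun_prop
  have hΦ1c : Continuous (cutHeat₁ (N - 1) ρ (σ * β c) M r) := by
    unfold cutHeat₁ heatKernel heatSlope
    fun_prop
  have hΦ2c : Continuous (cutHeat₂ (N - 1) ρ (σ * β c) M r) := by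
    unfold cutHeat₂ heatKernel heatSlope
    fun_prop
  have hRc : Continuous (R r) := by
    simp only [hR]
    unfold heatRate
    fun_prop
  have hint : ∀ f : Euc N → ℝ, Continuous f → (∀ y ∉ closedBall c ρ, f y = 0) → Integrable f :=
    fun f hf hf0 => hf.integrable_of_hasCompactSupport (HasCompactSupport.intro hK hf0)
  have hgreen := integral_green_slice hU x c hK
    (hasDerivAt_cutHeat (N - 1) ρ (σ * β c) M r) (hasDerivAt_cutHeat₁ (N - 1) ρ (σ * β c) M r)
    hΦ2c (fun y hy => (cutHeat_eq_zero hρ hy).1) (fun y hy => (cutHeat_eq_zero hρ hy).2.1)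
    (fun y hy => (cutHeat_eq_zero hρ hy).2.2)
  have hi1 : Integrable fun y : Euc N => lapY U (x, y) * Φ r (‖y - c‖ ^ 2) :=
    hint _ (by fun_prop) fun y hy => by simp [hz r y hy]
  have hi2 : Integrable fun y : Euc N => U (x, y) *
      (4 * ‖y - c‖ ^ 2 * cutHeat₂ (N - 1) ρ (σ * β c) M r (‖y - c‖ ^ 2) +
      2 * ((N - 1 : ℕ) : ℝ) * cutHeat₁ (N - 1) ρ (σ * β c) M r (‖y - c‖ ^ 2)) :=
    hint _ (by fun_prop) fun y hy => by
      simp [(cutHeat_eq_zero hρ hy).2.1, (cutHeat_eq_zero hρ hy).2.2]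
  have hi3 : Integrable fun y : Euc N =>
      2 * σ * r * dX U (x, y) * (σ * β y * Φ r (‖y - c‖ ^ 2)) +
        U (x, y) * (σ * β y * (R r (‖y - c‖ ^ 2) * Φ r (‖y - c‖ ^ 2))) :=
    hint _ (by fun_prop) fun y hy => by simp [hz r y hy]
  have hle : ∫ y : Euc N, (2 * σ * r * dX U (x, y) * (σ * β y * Φ r (‖y - c‖ ^ 2)) +
        U (x, y) * (σ * β y * (R r (‖y - c‖ ^ 2) * Φ r (‖y - c‖ ^ 2)))) ≤
      ∫ y : Euc N, 2 * r * (U (x, y) *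
      (4 * ‖y - c‖ ^ 2 * cutHeat₂ (N - 1) ρ (σ * β c) M r (‖y - c‖ ^ 2) +
      2 * ((N - 1 : ℕ) : ℝ) * cutHeat₁ (N - 1) ρ (σ * β c) M r (‖y - c‖ ^ 2)) -
      lapY U (x, y) * Φ r (‖y - c‖ ^ 2)) := by
    refine integral_mono hi3 ((hi2.sub hi1).const_mul (2 * r)) fun y => ?_
    simp only
    by_cases hy : y ∈ closedBall c ρ
    · have hn : ‖y - c‖ ≤ ρ := by rwa [mem_closedBall, dist_eq_norm] at hy
      have hsub := cutHeat_subsolution (N - 1) hb₀ hb hbB hL hρ hLρ (norm_nonneg _) hn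
        (hθ y hy) hr.1 (hr.2.le.trans htT) hM
      have h1 := hLU (r ^ 2) ⟨by positivity, pow_le_pow_left₀ hr.1.le hr.2.le 2⟩ y hy
      have h0 : 0 ≤ Φ r (‖y - c‖ ^ 2) := cutHeat_nonneg _ _ _ _ hr.1 _
      have h2 := mul_nonneg (mul_nonneg (by positivity : 0 ≤ 2 * r) h0) (sub_nonneg.2 h1)
      have h3 := mul_nonneg (hU0 (x, y)) hsub
      have h4 : 2 * σ * r * dX U (x, y) * (σ * β y * Φ r (‖y - c‖ ^ 2)) =
        (σ * σ) * (2 * r * dX U (x, y) * (β y * Φ r (‖y - c‖ ^ 2))) := by ring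
      rw [h4, hσ]
      simp only [← hΦ, ← hR, ← hx] at h2 h3 ⊢
      linarith
    · simp [hz r y hy, (cutHeat_eq_zero hρ hy).2.1, (cutHeat_eq_zero hρ hy).2.2]
  refine hle.trans_eq ?_
  rw [integral_const_mul, integral_sub hi2 hi1, hgreen]
  simp [hΦ]

end WeakHarnack

section WeakHarnackLimit

variable {N : ℕ}

theorem integrable_gaussian {b : ℝ} (hb : 0 < b) :
    Integrable fun ξ : Euc N => Real.exp (-b * ‖ξ‖ ^ 2) := by
  have h := (GaussianFourier.integrable_cexp_neg_mul_sq_norm_add (V := Euc N) (b := (b : ℂ))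
    (by simpa using hb) 0 0).norm
  refine h.congr (Eventually.of_forall fun ξ => ?_)
  simp only [Complex.norm_exp]
  simp [← Complex.ofReal_pow]

/-- Averages against the truncated heat kernel converge as the time tends to zero. -/
theorem tendsto_heat_average {β : Euc N → ℝ} (hβ : Continuous β) {B : ℝ} (hB : ∀ y, |β y| ≤ B)
    {σ : ℝ} (hσ : σ * σ = 1) {ρ M b : ℝ} (hM : 0 ≤ M) (hb : 0 < b)
    (c : Euc N) {U : ℝ × Euc N → ℝ} (hU : Continuous U) (hU0 : ∀ p, 0 ≤ U p) {K : ℝ}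
    (hUK : ∀ p, U p ≤ K) (x₁ : ℝ) :
    Tendsto (fun τ => ∫ y : Euc N, U (x₁ + σ * τ ^ 2, y) *
      (σ * β y * cutHeat (N - 1) ρ b M τ (‖y - c‖ ^ 2))) (𝓝[>] 0)
      (𝓝 (U (x₁, c) * (σ * β c * (ρ ^ 2) ^ 4) * ∫ ξ : Euc N, Real.exp (-(b / 4) * ‖ξ‖ ^ 2))) := by
  have hσ1 : |σ| = 1 := by
    have : |σ| * |σ| = 1 := by rw [← abs_mul, hσ, abs_one]
    nlinarith [abs_nonneg σ]
  have hK0 : 0 ≤ K := (hU0 0).trans (hUK 0)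
  have h := tendsto_integral_rescaled (μ := (volume : Measure (Euc N)))
    (H := fun s y => U (x₁ + σ * s ^ 2, y) * (σ * β y * max (ρ ^ 2 - ‖y - c‖ ^ 2) 0 ^ 4))
    (k := fun s ξ => Real.exp (-(b / 4) * ‖ξ‖ ^ 2 - s * ‖ξ‖ ^ 4 - M * s))
    (k0 := fun ξ => Real.exp (-(b / 4) * ‖ξ‖ ^ 2))
    (g := fun ξ => Real.exp (-(b / 4) * ‖ξ‖ ^ 2)) (c := c) (M := K * (B * (ρ ^ 2) ^ 4))
    (by fun_prop) (fun s => by fun_prop) ?_ (fun s _ => by fun_prop)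
    (integrable_gaussian (by positivity)) ?_ ?_
  · have h0 : U (x₁ + σ * 0 ^ 2, c) * (σ * β c * max (ρ ^ 2 - ‖c - c‖ ^ 2) 0 ^ 4) =
        U (x₁, c) * (σ * β c * (ρ ^ 2) ^ 4) := by
      simp [max_eq_left (sq_nonneg ρ)]
    rw [← h0]
    refine h.congr' ?_
    filter_upwards [self_mem_nhdsWithin] with s hs
    rw [mem_Ioi] at hs
    refine integral_congr_ae (Eventually.of_forall fun y => ?_)
    have e1 : ‖s⁻¹ • (y - c)‖ = ‖y - c‖ / s := by
      rw [norm_smul, norm_inv, Real.norm_eq_abs, abs_of_pos hs, inv_mul_eq_div]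
    have e2 : -(b / 4) * (‖y - c‖ / s) ^ 2 - s * (‖y - c‖ / s) ^ 4 - M * s =
        -(b / 4) * (‖y - c‖ ^ 2 * (s ^ 2)⁻¹) - (‖y - c‖ ^ 2) ^ 2 * (s ^ 3)⁻¹ - M * s := by
      field_simp
    simp only [e1, e2, finrank_euclideanSpace_fin, cutHeat, heatKernel]
    ring
  · intro s hs y
    have h1 : max (ρ ^ 2 - ‖y - c‖ ^ 2) 0 ^ 4 ≤ (ρ ^ 2) ^ 4 :=
      pow_le_pow_left₀ (le_max_right _ _)
        (max_le (by linarith [sq_nonneg ‖y - c‖]) (sq_nonneg ρ)) 4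
    have h2 : 0 ≤ max (ρ ^ 2 - ‖y - c‖ ^ 2) 0 ^ 4 := by positivity
    rw [abs_mul, abs_mul, abs_mul, hσ1, one_mul, abs_of_nonneg (hU0 _), abs_of_nonneg h2]
    have hB0 : 0 ≤ B := (abs_nonneg _).trans (hB y)
    have h3 := hB y
    have h4 := hUK (x₁ + σ * s ^ 2, y)
    have h5 := hU0 (x₁ + σ * s ^ 2, y)
    gcongr
  · intro s hs ξ
    rw [abs_of_nonneg (Real.exp_pos _).le, Real.exp_le_exp]
    have : 0 ≤ s * ‖ξ‖ ^ 4 := by positivity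
    have : 0 ≤ M * s := by positivity
    linarith
  · intro ξ
    have : Continuous fun s : ℝ => Real.exp (-(b / 4) * ‖ξ‖ ^ 2 - s * ‖ξ‖ ^ 4 - M * s) := by
      fun_prop
    have h := this.tendsto 0
    simp only [zero_mul, mul_zero, sub_zero] at h
    exact h.mono_left nhdsWithin_le_nhds

/-- A lower bound for the truncated heat kernel away from the initial time. -/
theorem cutHeat_lower_bound (d : ℕ) {ρ b B M τ q : ℝ} (hb : 0 ≤ b) (hbB : b ≤ B) (hM : 0 ≤ M)
    (hτ : τ ∈ Icc (1 / 2 : ℝ) 3) (hq : 0 ≤ q) (hqρ : q ≤ ρ ^ 2 / 4) :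
    ((3 : ℝ) ^ d)⁻¹ * Real.exp (-(B * ρ ^ 2) - 8 * ρ ^ 4 - 3 * M) * (3 / 4 * ρ ^ 2) ^ 4 ≤
      cutHeat d ρ b M τ q := by
  have hτ0 : 0 < τ := by linarith [hτ.1]
  have h2 : (τ ^ 2)⁻¹ ≤ 4 := by
    rw [inv_le_comm₀ (by positivity) (by norm_num)]
    nlinarith [hτ.1]
  have h3 : (τ ^ 3)⁻¹ ≤ 8 := by
    rw [inv_le_comm₀ (by positivity) (by norm_num)]
    have := pow_le_pow_left₀ (by norm_num) hτ.1 3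
    linarith
  have hd : ((3 : ℝ) ^ d)⁻¹ ≤ (τ ^ d)⁻¹ := by
    have := pow_le_pow_left₀ hτ0.le hτ.2 d
    gcongr
  have e1 : b / 4 * (q * (τ ^ 2)⁻¹) ≤ B * ρ ^ 2 := by
    calc b / 4 * (q * (τ ^ 2)⁻¹) ≤ B / 4 * (ρ ^ 2 / 4 * 4) := by
          gcongr
          linarith
      _ ≤ _ := by nlinarith [mul_nonneg (hb.trans hbB) (sq_nonneg ρ)]
  have e2 : q ^ 2 * (τ ^ 3)⁻¹ ≤ 8 * ρ ^ 4 := by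
    calc q ^ 2 * (τ ^ 3)⁻¹ ≤ (ρ ^ 2 / 4) ^ 2 * 8 := by gcongr
      _ ≤ _ := by nlinarith [sq_nonneg (ρ ^ 2)]
  have e3 : M * τ ≤ 3 * M := by nlinarith [hτ.2]
  have e4 : 3 / 4 * ρ ^ 2 ≤ max (ρ ^ 2 - q) 0 := le_max_of_le_left (by linarith)
  unfold cutHeat heatKernel
  gcongr
  linarith

/-- Values of a near supersolution control earlier or later slice averages, according to the sign
of the coefficient. -/
theorem exists_slice_integral_le {β : Euc N → ℝ} (hβ : Continuous β) {B : ℝ}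
    (hB : ∀ y, |β y| ≤ B) {b₀ L ρ : ℝ} (hb₀ : 0 < b₀) (hL : 0 ≤ L) (hρ : 0 < ρ)
    (hLρ : L * ρ ≤ b₀ / 2) :
    ∃ κ > 0, ∀ σ : ℝ, σ * σ = 1 → ∀ c : Euc N, b₀ ≤ σ * β c →
      (∀ y ∈ closedBall c ρ, |σ * β y - σ * β c| ≤ L * ‖y - c‖) →
      ∀ U : ℝ × Euc N → ℝ, ContDiff ℝ 2 U → (∀ p, 0 ≤ U p) → (∃ K, ∀ p, U p ≤ K) →
      ∀ x₁ : ℝ, ∀ t ∈ Icc (1 / 2 : ℝ) 3,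
      (∀ s ∈ Icc 0 (t ^ 2), ∀ y ∈ closedBall c ρ,
        lapY U (x₁ + σ * s, y) + β y * dX U (x₁ + σ * s, y) ≤ U (x₁ + σ * s, y)) →
      κ * ∫ y in ball c (ρ / 2), U (x₁ + σ * t ^ 2, y) ≤ U (x₁, c) := by
  have hB0 : 0 ≤ B := (abs_nonneg _).trans (hB 0)
  set M : ℝ := (2 * 3 * ((6 + (N - 1 : ℕ)) ^ 2 / (3 * ρ ^ 2) + 1) + (L * (N - 1 : ℕ) +
      (16 + 8 * (N - 1 : ℕ)) + B * L / 2 + (L * (N - 1 : ℕ) + (16 + 8 * (N - 1 : ℕ)) + B * L / 2)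
      * ((L * (N - 1 : ℕ) + (16 + 8 * (N - 1 : ℕ)) + B * L / 2) / (3 * b₀)) ^ 3)) / (b₀ / 2)
    with hMdef
  have hM : 0 ≤ M := by positivity
  set W : ℝ := ∫ ξ : Euc N, Real.exp (-(b₀ / 4) * ‖ξ‖ ^ 2) with hW
  have hWi := integrable_gaussian (N := N) (show 0 < b₀ / 4 by positivity)
  have hW0 : 0 ≤ W := integral_nonneg fun ξ => (Real.exp_pos _).le
  set E : ℝ := ((3 : ℝ) ^ (N - 1))⁻¹ * Real.exp (-(B * ρ ^ 2) - 8 * ρ ^ 4 - 3 * M) *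
    (3 / 4 * ρ ^ 2) ^ 4 with hE
  have hE0 : 0 < E := by positivity
  refine ⟨b₀ / 2 * E / (B * (ρ ^ 2) ^ 4 * W + 1), by positivity, ?_⟩
  intro σ hσ c hb hθ U hU hU0 ⟨K, hUK⟩ x₁ t ht hLU
  have ht0 : 0 < t := by linarith [ht.1]
  have hσ1 : |σ| = 1 := by
    have : |σ| * |σ| = 1 := by rw [← abs_mul, hσ, abs_one]
    nlinarith [abs_nonneg σ]
  have hbB : σ * β c ≤ B := by
    refine (le_abs_self _).trans ?_
    rw [abs_mul, hσ1, one_mul]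
    exact hB c
  have hb' : 0 < σ * β c := hb₀.trans_le hb
  have hUc := hU.continuous
  have hanti := antitoneOn_heat_average hβ hσ hb₀ hL hρ hLρ hb hbB hθ
    (M := M) (T := 3) (by rw [hMdef, mul_div_cancel₀ _ (by positivity)]) hU hU0 ht.2 hLU
  have hlim := tendsto_heat_average hβ hB hσ (ρ := ρ) hM hb' c hUc hU0 hUK x₁
  have hle := ge_of_tendsto hlim (by
    filter_upwards [Ioc_mem_nhdsGT ht0] with s hs
    exact hanti hs ⟨ht0, le_rfl⟩ hs.2)
  have hup : U (x₁, c) * (σ * β c * (ρ ^ 2) ^ 4) *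
      ∫ ξ : Euc N, Real.exp (-(σ * β c / 4) * ‖ξ‖ ^ 2) ≤ U (x₁, c) * (B * (ρ ^ 2) ^ 4 * W + 1) := by
    have h1 : ∫ ξ : Euc N, Real.exp (-(σ * β c / 4) * ‖ξ‖ ^ 2) ≤ W := by
      refine integral_mono (integrable_gaussian (by positivity)) hWi fun ξ => ?_
      simp only [Real.exp_le_exp]
      nlinarith [sq_nonneg ‖ξ‖]
    have h2 : 0 ≤ ∫ ξ : Euc N, Real.exp (-(σ * β c / 4) * ‖ξ‖ ^ 2) :=
      integral_nonneg fun ξ => (Real.exp_pos _).le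
    have h0 := hU0 (x₁, c)
    rw [mul_assoc]
    refine mul_le_mul_of_nonneg_left ?_ h0
    calc _ ≤ B * (ρ ^ 2) ^ 4 * W := by gcongr
      _ ≤ _ := by linarith
  have hlow : b₀ / 2 * E * ∫ y in ball c (ρ / 2), U (x₁ + σ * t ^ 2, y) ≤
      ∫ y : Euc N, U (x₁ + σ * t ^ 2, y) *
      (σ * β y * cutHeat (N - 1) ρ (σ * β c) M t (‖y - c‖ ^ 2)) := by
    have hcc : Continuous (cutHeat (N - 1) ρ (σ * β c) M t) := by
      unfold cutHeat heatKernel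
      fun_prop
    have hσβ : ∀ y ∈ closedBall c ρ, b₀ / 2 ≤ σ * β y := by
      intro y hy
      have h1 := abs_le.1 (hθ y hy)
      have hn : ‖y - c‖ ≤ ρ := by rwa [mem_closedBall, dist_eq_norm] at hy
      have := mul_le_mul_of_nonneg_left hn hL
      linarith [h1.1]
    have hnn : ∀ y : Euc N, 0 ≤ U (x₁ + σ * t ^ 2, y) *
        (σ * β y * cutHeat (N - 1) ρ (σ * β c) M t (‖y - c‖ ^ 2)) := by
      intro y
      by_cases hy : y ∈ closedBall c ρ
      · exact mul_nonneg (hU0 _) (mul_nonneg ((by positivity : 0 ≤ b₀ / 2).trans (hσβ y hy))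
          (cutHeat_nonneg _ _ _ _ ht0 _))
      · simp [(cutHeat_eq_zero hρ hy).1]
    have hcont : Continuous fun y : Euc N => U (x₁ + σ * t ^ 2, y) *
        (σ * β y * cutHeat (N - 1) ρ (σ * β c) M t (‖y - c‖ ^ 2)) := by fun_prop
    have hi : Integrable fun y : Euc N => U (x₁ + σ * t ^ 2, y) *
        (σ * β y * cutHeat (N - 1) ρ (σ * β c) M t (‖y - c‖ ^ 2)) :=
      hcont.integrable_of_hasCompactSupport (HasCompactSupport.intro (isCompact_closedBall c ρ)
        fun y hy => by simp [(cutHeat_eq_zero hρ hy).1])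
    refine le_trans ?_ (setIntegral_le_integral (s := ball c (ρ / 2)) hi
      (Eventually.of_forall hnn))
    rw [← integral_const_mul]
    have hUy : Continuous fun y : Euc N => b₀ / 2 * E * U (x₁ + σ * t ^ 2, y) := by fun_prop
    refine setIntegral_mono_on ((hUy.continuousOn.integrableOn_compact
      (isCompact_closedBall c (ρ / 2))).mono_set ball_subset_closedBall)
      hi.integrableOn measurableSet_ball fun y hy => ?_
    rw [mem_ball, dist_eq_norm] at hy
    have hy' : y ∈ closedBall c ρ := by
      rw [mem_closedBall, dist_eq_norm]
      linarith
    have h1 := cutHeat_lower_bound (N - 1) (ρ := ρ) (q := ‖y - c‖ ^ 2) hb'.le hbB hM ht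
      (sq_nonneg _) (by nlinarith [norm_nonneg (y - c)])
    rw [mul_comm (b₀ / 2 * E)]
    refine mul_le_mul_of_nonneg_left ?_ (hU0 _)
    exact mul_le_mul (hσβ y hy') h1 hE0.le ((by positivity : 0 ≤ b₀ / 2).trans (hσβ y hy'))
  rw [div_mul_eq_mul_div, div_le_iff₀ (by positivity)]
  exact hlow.trans (hle.trans hup)

end WeakHarnackLimit

section Harnack

variable {N : ℕ}

/-- Where the coefficient has a sign, the mass in a tube bounds values from below. -/
theorem exists_integral_tube_le_value {β : Euc N → ℝ} (hβ : Continuous β) {B : ℝ}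
    (hB : ∀ y, |β y| ≤ B) {L : ℝ} (hL0 : 0 ≤ L) (hL : ∀ y y', |β y - β y'| ≤ L * ‖y - y'‖)
    {σ : ℝ} (hσ : σ * σ = 1) {c₀ : Euc N} (hc₀ : 0 < σ * β c₀) :
    ∃ ρ ∈ Ioc (0 : ℝ) (1 / 5), ∃ κ > 0, ∀ (U : ℝ × Euc N → ℝ) (a b : ℝ),
      IsNearSolution β (Icc a b ×ˢ closedBall c₀ 1) U → ∀ e f x₁ : ℝ, x₁ ∈ Icc a b →
      e ∈ Icc a b → f ∈ Icc a b → e ≤ f → (∀ x ∈ Icc e f, σ * (x - x₁) ∈ Icc (1 / 4 : ℝ) 9) →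
      ∀ c ∈ ball c₀ ρ, κ * ∫ p in Icc e f ×ˢ ball c₀ ρ, U p ≤ (f - e) * U (x₁, c) := by
  have hσ1 : |σ| = 1 := by
    have : |σ| * |σ| = 1 := by rw [← abs_mul, hσ, abs_one]
    nlinarith [abs_nonneg σ]
  set b₁ : ℝ := σ * β c₀ with hb₁
  set ρ : ℝ := min (1 / 5) (b₁ / (16 * (L + 1))) with hρdef
  have hρ : 0 < ρ := by positivity
  have hρ5 : ρ ≤ 1 / 5 := min_le_left _ _
  have hLρ : L * ρ ≤ b₁ / 16 := by
    have h2 : ρ ≤ b₁ / (16 * (L + 1)) := min_le_right _ _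
    rw [le_div_iff₀ (by positivity)] at h2
    nlinarith
  have hLσ : ∀ y y', |σ * β y - σ * β y'| ≤ L * ‖y - y'‖ := by
    intro y y'
    rw [← mul_sub, abs_mul, hσ1, one_mul]
    exact hL y y'
  obtain ⟨κ, hκ, h⟩ := exists_slice_integral_le hβ hB (b₀ := b₁ / 2) (L := L) (ρ := 4 * ρ)
    (by positivity) hL0 (by positivity) (by linarith)
  refine ⟨ρ, ⟨hρ, hρ5⟩, κ, hκ, fun U a b hU e f x₁ hx₁ he hf hef hx c hc => ?_⟩
  have hUc := hU.continuous
  have hcn : ‖c - c₀‖ < ρ := by rwa [mem_ball, dist_eq_norm] at hc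
  have hb : b₁ / 2 ≤ σ * β c := by
    have h1 := (abs_le.1 (hLσ c c₀)).1
    have h2 := mul_le_mul_of_nonneg_left hcn.le hL0
    linarith
  have hslice : ∀ x ∈ Icc e f, κ * ∫ y in ball c₀ ρ, U (x, y) ≤ U (x₁, c) := by
    intro x hxe
    obtain ⟨hs1, hs2⟩ := hx x hxe
    have hs0 : 0 ≤ σ * (x - x₁) := by linarith
    have hsq : √(σ * (x - x₁)) ^ 2 = σ * (x - x₁) := Real.sq_sqrt hs0
    have hxx : x₁ + σ * (σ * (x - x₁)) = x := by
      rw [← mul_assoc, hσ]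
      ring
    have h1 := h σ hσ c hb (fun y _ => hLσ y c) U hU.contDiff hU.nonneg hU.bounded x₁
      (√(σ * (x - x₁))) ⟨Real.le_sqrt_of_sq_le (by linarith), by
        rw [Real.sqrt_le_left (by norm_num)]
        linarith⟩ (by
        rw [hsq]
        intro s hs y hy
        refine (le_abs_self _).trans (hU.abs_le (x₁ + σ * s, y) ⟨?_, ?_⟩)
        · have hxab : x ∈ Icc a b := ⟨he.1.trans hxe.1, hxe.2.trans hf.2⟩
          rcases mul_self_eq_one_iff.1 hσ with h | h <;> subst h <;>
            constructor <;> simp only <;> linarith [hs.1, hs.2, hxab.1, hxab.2, hx₁.1, hx₁.2]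
        · rw [mem_closedBall] at hy ⊢
          rw [mem_ball] at hc
          have := dist_triangle y c c₀
          simp only
          linarith)
    rw [hsq, hxx] at h1
    refine le_trans (mul_le_mul_of_nonneg_left ?_ hκ.le) h1
    have hUy : Continuous fun y : Euc N => U (x, y) := by fun_prop
    refine setIntegral_mono_set ((hUy.continuousOn.integrableOn_compact
      (isCompact_closedBall c (4 * ρ / 2))).mono_set ball_subset_closedBall)
      (Eventually.of_forall fun y => hU.nonneg _) (LE.le.eventuallyLE ?_)
    refine ball_subset_ball' ?_
    rw [mem_ball, dist_comm] at hc
    linarith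
  have hi : IntegrableOn U (Icc e f ×ˢ ball c₀ ρ) :=
    integrableOn_box hUc (prod_mono le_rfl ball_subset_closedBall)
  rw [Measure.volume_eq_prod] at hi ⊢
  rw [setIntegral_prod _ hi, ← integral_const_mul]
  have hi2 : IntegrableOn (fun x => κ * ∫ y in ball c₀ ρ, U (x, y)) (Icc e f) := by
    have := hi
    rw [IntegrableOn, ← Measure.prod_restrict] at this
    exact this.integral_prod_left.const_mul κ
  refine (setIntegral_mono_on hi2 (g := fun _ => U (x₁, c)) (by simp) measurableSet_Icc
    hslice).trans ?_
  simp [hef]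

/-- The Harnack type inequality for near solutions. -/
theorem IsNearSolution.exists_average_le {β : Euc N → ℝ} (hβ : Continuous β) {B : ℝ}
    (hB : ∀ y, |β y| ≤ B) {L : ℝ} (hL0 : 0 ≤ L) (hL : ∀ y y', |β y - β y'| ≤ L * ‖y - y'‖)
    {yp ym : Euc N} {R : ℝ} (hR : R < 1) (hyp : ‖yp‖ ≤ R) (hym : ‖ym‖ ≤ R) (hp : 0 < β yp)
    (hm : β ym < 0) :
    ∃ C > 0, ∀ U : ℝ × Euc N → ℝ, IsNearSolution β (Icc (-4 : ℝ) 5 ×ˢ closedBall 0 (2 + R)) U →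
      ∀ y₀ ∈ ball (0 : Euc N) 1, ∀ p ∈ Icc (0 : ℝ) 1 ×ˢ ball (0 : Euc N) 1,
      ∫ x in Icc (-1 / 3 : ℝ) (4 / 3), U (x, y₀) ≤ C * U p := by
  have hR0 : 0 ≤ R := (norm_nonneg _).trans hyp
  set δ : ℝ := (1 - R) / 2 with hδdef
  have hδ : 0 < δ := by simp only [hδdef]; linarith
  set r : ℝ := (3 + R) / 2 with hr
  have hr2 : r < 2 := by linarith
  have hr0 : 0 ≤ r := by linarith
  obtain ⟨C₁, hC₁, h1⟩ := exists_average_le_integral hβ hB hδ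
  obtain ⟨ρp, hρp, κ₃, hκ₃, h3⟩ := exists_integral_tube_le_value hβ hB hL0 hL (σ := 1)
    (by norm_num) (c₀ := yp) (by simpa using hp)
  obtain ⟨ρm, hρm, κ₅, hκ₅, h5⟩ := exists_integral_tube_le_value hβ hB hL0 hL (σ := -1)
    (by norm_num) (c₀ := ym) (by simpa using hm)
  obtain ⟨C₂, hC₂, h2⟩ := exists_integral_le_integral_tube hβ hB yp hρp.1
    (a := -1) (a' := -1 / 2) (b' := 3 / 2) (b := 2) (by norm_num) (by norm_num) hr0 hr2
    (by linarith [hρp.2])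
  obtain ⟨C₄, hC₄, h4⟩ := exists_integral_le_integral_tube hβ hB ym hρm.1
    (a := -3) (a' := -5 / 2) (b' := -3 / 2) (b := -1) (by norm_num) (by norm_num) hr0 hr2
    (by linarith [hρm.2])
  obtain ⟨κ₇, hκ₇, h7⟩ := exists_le_of_le_tube hB ym hρm.1
    (a := -1 / 2) (a' := 0) (b' := 1) (b := 3 / 2) (by norm_num) (by norm_num) hr0 hr2
  set ρ' : ℝ := min ρp (1 - R) with hρ'
  have hρ'0 : 0 < ρ' := lt_min hρp.1 (by linarith)
  set w : ℝ := (volume : Measure (ℝ × Euc N)).real (Icc (-5 / 2 : ℝ) (-3 / 2) ×ˢ ball yp ρ') with hw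
  have hw0 : 0 < w := by
    rw [hw, Measure.volume_eq_prod, measureReal_prod_prod]
    refine mul_pos ?_ ?_
    · simp
      norm_num
    · exact ENNReal.toReal_pos (measure_ball_pos volume yp hρ'0).ne' measure_ball_lt_top.ne
  refine ⟨C₁ * C₂ * (3 / (κ₃ * w)) * C₄ * (2 / (κ₅ * κ₇)), by positivity,
    fun U hU y₀ hy₀ p hpp => ?_⟩
  have hUc := hU.continuous
  have hsub : ∀ {c : Euc N} {s : ℝ}, ‖c‖ + s ≤ 2 + R → closedBall c s ⊆ closedBall 0 (2 + R) := by
    intro c s h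
    refine closedBall_subset_closedBall' ?_
    rw [dist_zero_right]
    linarith
  have hn₀ : ‖y₀‖ < 1 := by rwa [mem_ball_zero_iff] at hy₀
  have hUp : ∀ a b : ℝ, -4 ≤ a → b ≤ 5 → ∀ s ≤ 2,
      IsNearSolution β (Icc a b ×ˢ closedBall yp s) U := fun a b ha hb s hs =>
    hU.mono (prod_mono (Icc_subset_Icc ha hb) (hsub (by linarith)))
  have hUm : ∀ a b : ℝ, -4 ≤ a → b ≤ 5 → ∀ s ≤ 2,
      IsNearSolution β (Icc a b ×ˢ closedBall ym s) U := fun a b ha hb s hs =>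
    hU.mono (prod_mono (Icc_subset_Icc ha hb) (hsub (by linarith)))
  set Q₁ : ℝ := ∫ p in Icc (-1 : ℝ) 2 ×ˢ ball yp ρp, U p with hQ₁
  set Q₂ : ℝ := ∫ p in Icc (-3 : ℝ) (-1) ×ˢ ball ym ρm, U p with hQ₂
  have hQ₂0 : 0 ≤ Q₂ := integral_nonneg fun p => hU.nonneg p
  have s1 : ∫ x in Icc (-1 / 3 : ℝ) (4 / 3), U (x, y₀) ≤ C₁ * (C₂ * Q₁) := by
    refine (h1 y₀ U (hU.mono (prod_mono (Icc_subset_Icc (by norm_num) (by norm_num))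
      (hsub (by linarith))))).trans (mul_le_mul_of_nonneg_left ?_ hC₁.le)
    refine le_trans ?_ (h2 U (hUp _ _ (by norm_num) (by norm_num) _ le_rfl))
    refine setIntegral_mono_set (integrableOn_box hUc le_rfl)
      (Eventually.of_forall fun y => hU.nonneg _) (LE.le.eventuallyLE ?_)
    refine prod_mono le_rfl (closedBall_subset_closedBall' ?_)
    have := dist_le_norm_add_norm y₀ yp
    linarith
  have s3 : ∀ q ∈ Icc (-5 / 2 : ℝ) (-3 / 2) ×ˢ ball yp ρ', κ₃ * Q₁ / 3 ≤ U q := by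
    rintro ⟨x, y⟩ ⟨hx, hy⟩
    simp only at hx hy
    have := h3 U (-4) 5 (hUp _ _ le_rfl le_rfl _ (by norm_num)) (-1) 2 x
      ⟨by linarith [hx.1], by linarith [hx.2]⟩ (by norm_num) (by norm_num) (by norm_num)
      (fun x' hx' => ⟨by linarith [hx.2, hx'.1], by linarith [hx.1, hx'.2]⟩) y
      (ball_subset_ball (min_le_left _ _) hy)
    linarith
  have s4 : κ₃ * Q₁ / 3 * w ≤ C₄ * Q₂ := by
    refine le_trans ?_ (h4 U (hUm _ _ (by norm_num) (by norm_num) _ le_rfl))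
    have hfin : volume (Icc (-5 / 2 : ℝ) (-3 / 2) ×ˢ ball yp ρ') ≠ ⊤ := by
      rw [Measure.volume_eq_prod, Measure.prod_prod]
      exact ENNReal.mul_ne_top (by simp) measure_ball_lt_top.ne
    have e1 : κ₃ * Q₁ / 3 * w ≤ ∫ q in Icc (-5 / 2 : ℝ) (-3 / 2) ×ˢ ball yp ρ', U q := by
      have := setIntegral_mono_on (μ := volume) (f := fun _ : ℝ × Euc N => κ₃ * Q₁ / 3)
        (integrableOn_const hfin)
        (integrableOn_box hUc (prod_mono (le_refl (Icc (-5 / 2 : ℝ) (-3 / 2)))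
          (ball_subset_closedBall (x := yp) (ε := ρ')))) (measurableSet_Icc.prod measurableSet_ball)
        s3
      rw [setIntegral_const, smul_eq_mul, mul_comm] at this
      exact this
    refine e1.trans (setIntegral_mono_set (integrableOn_box hUc le_rfl)
      (Eventually.of_forall fun y => hU.nonneg _) (LE.le.eventuallyLE ?_))
    refine prod_mono le_rfl (ball_subset_closedBall.trans (closedBall_subset_closedBall' ?_))
    have := dist_le_norm_add_norm yp ym
    have h6 : ρ' ≤ 1 - R := min_le_right _ _
    linarith
  have s5 : ∀ q ∈ Icc (-1 / 2 : ℝ) (3 / 2) ×ˢ ball ym ρm, κ₅ * Q₂ / 2 ≤ U q := by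
    rintro ⟨x, y⟩ ⟨hx, hy⟩
    simp only at hx hy
    have := h5 U (-4) 5 (hUm _ _ le_rfl le_rfl _ (by norm_num)) (-3) (-1) x
      ⟨by linarith [hx.1], by linarith [hx.2]⟩ (by norm_num) (by norm_num) (by norm_num)
      (fun x' hx' => ⟨by linarith [hx.1, hx'.2], by linarith [hx.2, hx'.1]⟩) y hy
    linarith
  have s7 := h7 U (hUm _ _ (by norm_num) (by norm_num) _ le_rfl) (κ₅ * Q₂ / 2) (by positivity) s5 p
    ⟨hpp.1, ball_subset_closedBall.trans (closedBall_subset_closedBall' (by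
      have := dist_le_norm_add_norm 0 ym
      rw [norm_zero] at this
      linarith)) hpp.2⟩
  have t1 : Q₁ ≤ 3 / (κ₃ * w) * C₄ * Q₂ := by
    rw [mul_assoc, div_mul_eq_mul_div, le_div_iff₀ (by positivity)]
    linarith
  have t2 : Q₂ ≤ 2 / (κ₅ * κ₇) * U p := by
    rw [div_mul_eq_mul_div, le_div_iff₀ (by positivity)]
    linarith
  calc _ ≤ C₁ * (C₂ * Q₁) := s1
    _ ≤ C₁ * (C₂ * (3 / (κ₃ * w) * C₄ * (2 / (κ₅ * κ₇) * U p))) := by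
        gcongr
        refine t1.trans ?_
        gcongr
    _ = _ := by ring

end Harnack

section Mollification

theorem contDiff_mollify {V : Type*} [NormedAddCommGroup V] [NormedSpace ℝ V] [MeasurableSpace V]
    [BorelSpace V] {μ : Measure V} {w φ : V → ℝ} (hw : LocallyIntegrable w μ) {n : ℕ∞}
    (hφ : ContDiff ℝ n φ) (hc : HasCompactSupport φ) :
    ContDiff ℝ n fun p => ∫ q, w q * φ (p - q) ∂μ :=
  hc.contDiff_convolution_right (ContinuousLinearMap.mul ℝ ℝ) hw hφ

theorem fderiv_mollify {V : Type*} [NormedAddCommGroup V] [NormedSpace ℝ V] [MeasurableSpace V]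
    [BorelSpace V] {μ : Measure V} [SFinite μ]
    [μ.IsAddLeftInvariant] {w φ : V → ℝ}
    (hw : LocallyIntegrable w μ) (hφ : ContDiff ℝ 1 φ) (hc : HasCompactSupport φ) (p v : V) :
    fderiv ℝ (fun p => ∫ q, w q * φ (p - q) ∂μ) p v = ∫ q, w q * fderiv ℝ φ (p - q) v ∂μ := by
  have h := hc.hasFDerivAt_convolution_right (ContinuousLinearMap.mul ℝ ℝ) hw hφ p
  have h1 := congrArg (fun l : V →L[ℝ] ℝ => l v) h.fderiv
  rw [convolution_precompR_apply (ContinuousLinearMap.mul ℝ ℝ) hw (hc.fderiv ℝ)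
    (hφ.continuous_fderiv (by norm_num)) p v] at h1
  exact h1

variable {N : ℕ}

theorem dX_mollify {w φ : ℝ × Euc N → ℝ} (hw : LocallyIntegrable w) (hφ : ContDiff ℝ 1 φ)
    (hc : HasCompactSupport φ) (p : ℝ × Euc N) :
    dX (fun p => ∫ q, w q * φ (p - q)) p = ∫ q, w q * dX φ (p - q) :=
  fderiv_mollify hw hφ hc p _

theorem integrable_mul_comp_sub {w f : ℝ × Euc N → ℝ} (hw : LocallyIntegrable w)
    (hf : Continuous f) (hc : HasCompactSupport f) (p : ℝ × Euc N) :
    Integrable fun q => w q * f (p - q) :=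
  hc.convolutionExists_right (ContinuousLinearMap.mul ℝ ℝ) hw hf p

theorem lapY_mollify {w φ : ℝ × Euc N → ℝ} (hw : LocallyIntegrable w) (hφ : ContDiff ℝ 2 φ)
    (hc : HasCompactSupport φ) (p : ℝ × Euc N) :
    lapY (fun p => ∫ q, w q * φ (p - q)) p = ∫ q, w q * lapY φ (p - q) := by
  have hφ1 : ContDiff ℝ 1 φ := hφ.of_le (by norm_num)
  have hd : ∀ v : ℝ × Euc N, ContDiff ℝ 1 fun q => fderiv ℝ φ q v := fun v =>
    (hφ.fderiv_right (m := 1) (by norm_num)).clm_apply contDiff_const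
  have hdc : ∀ v : ℝ × Euc N, HasCompactSupport fun q => fderiv ℝ φ q v := fun v =>
    hc.fderiv_apply ℝ v
  simp only [lapY, Finset.mul_sum]
  rw [integral_finsetSum]
  · refine Finset.sum_congr rfl fun i _ => ?_
    simp only [fderiv_mollify hw hφ1 hc]
    exact fderiv_mollify hw (hd _) (hdc _) p _
  · intro i _
    refine integrable_mul_comp_sub hw (f := fun q => fderiv ℝ (fun q => fderiv ℝ φ q
      ((0 : ℝ), EuclideanSpace.single i (1 : ℝ))) q ((0 : ℝ), EuclideanSpace.single i (1 : ℝ)))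
      ?_ ((hdc _).fderiv_apply ℝ _) p
    exact ((hd _).continuous_fderiv (by norm_num)).clm_apply continuous_const

theorem fderiv_comp_const_sub_apply {V : Type*} [NormedAddCommGroup V] [NormedSpace ℝ V]
    (φ : V → ℝ) (p q v : V) :
    fderiv ℝ (fun q => φ (p - q)) q v = -fderiv ℝ φ (p - q) v := by
  have h1 := (ContinuousLinearEquiv.neg ℝ (M := V)).comp_right_fderiv (f := fun q => φ (p + q))
    (x := q)
  simp only [Function.comp_def, ContinuousLinearEquiv.neg_apply, ← sub_eq_add_neg] at h1
  rw [h1, fderiv_comp_add_left, ← sub_eq_add_neg]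
  simp

theorem dX_comp_const_sub (φ : ℝ × Euc N → ℝ) (p q : ℝ × Euc N) :
    dX (fun q => φ (p - q)) q = -dX φ (p - q) :=
  fderiv_comp_const_sub_apply φ p q _

theorem lapY_comp_const_sub (φ : ℝ × Euc N → ℝ) (p q : ℝ × Euc N) :
    lapY (fun q => φ (p - q)) q = lapY φ (p - q) := by
  simp only [lapY]
  refine Finset.sum_congr rfl fun i _ => ?_
  simp only [fderiv_comp_const_sub_apply]
  rw [fderiv_fun_neg, neg_apply,
    fderiv_comp_const_sub_apply (fun q => fderiv ℝ φ q ((0 : ℝ), EuclideanSpace.single i (1 : ℝ))),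
    neg_neg]

/-- The equation tested against translates of a kernel. -/
theorem IsDistribSolution.integral_kernel_eq_zero {S : Set (ℝ × Euc N)} {β : Euc N → ℝ}
    {γ u : ℝ × Euc N → ℝ} (h : IsDistribSolution S β γ u) {φ : ℝ × Euc N → ℝ}
    (hφ : ContDiff ℝ (⊤ : ℕ∞) φ) (hc : HasCompactSupport φ) {p : ℝ × Euc N}
    (hp : ∀ q, p - q ∈ tsupport φ → q ∈ S) :
    ∫ q in S, u q * (lapY φ (p - q) + β q.2 * dX φ (p - q) + γ q * φ (p - q)) = 0 := by
  have hts : tsupport (fun q => φ (p - q)) ⊆ (fun q => p - q) ⁻¹' tsupport φ := by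
    refine closure_minimal (fun q hq => subset_tsupport φ hq) ?_
    exact (isClosed_tsupport φ).preimage (by fun_prop)
  have := h (fun q => φ (p - q)) (hφ.comp (contDiff_const.sub contDiff_id))
    (hc.comp_homeomorph (Homeomorph.subLeft p)) (fun q hq => hp q (hts hq))
  rw [← this]
  simp only [dX_comp_const_sub, lapY_comp_const_sub]
  refine integral_congr_ae (Eventually.of_forall fun q => ?_)
  simp only
  ring

theorem dX_prod_mul {a : ℝ → ℝ} {b : Euc N → ℝ} (ha : Differentiable ℝ a)
    (hb : Differentiable ℝ b) (p : ℝ × Euc N) :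
    dX (fun p => a p.1 * b p.2) p = deriv a p.1 * b p.2 := by
  have h1 : DifferentiableAt ℝ (fun p : ℝ × Euc N => a p.1 * b p.2) p := by fun_prop
  have h2 := h1.hasFDerivAt.comp_hasDerivAt p.1
    (f := fun t : ℝ => (t, p.2)) ((hasDerivAt_id p.1).prodMk (hasDerivAt_const p.1 p.2))
  exact h2.unique ((ha p.1).hasDerivAt.mul_const (b p.2))

end Mollification

section Approximation

variable {N : ℕ}

/-- Anisotropic mollifiers whose `x`-derivative is controlled independently of the width `δ` in the
`y`-variables. -/
theorem exists_anisotropic_kernel (N : ℕ) {ε : ℝ} (hε : 0 < ε) :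
    ∃ A ≥ (0 : ℝ), ∀ δ > (0 : ℝ), ∃ (φ : ℝ × Euc N → ℝ) (b : Euc N → ℝ),
      ContDiff ℝ (⊤ : ℕ∞) φ ∧ HasCompactSupport φ ∧ (∀ p, 0 ≤ φ p) ∧
      tsupport φ ⊆ closedBall 0 ε ×ˢ closedBall 0 δ ∧ ∫ p, φ p = 1 ∧ Continuous b ∧
      (∀ y, 0 ≤ b y) ∧ Integrable b ∧ ∫ y, b y = 1 ∧ (∀ p, |dX φ p| ≤ A * b p.2) ∧
      ∀ y ∉ closedBall 0 δ, b y = 0 := by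
  let α : ContDiffBump (0 : ℝ) := ⟨ε / 2, ε, by positivity, by linarith⟩
  set a : ℝ → ℝ := α.normed volume with ha
  have has : ContDiff ℝ (⊤ : ℕ∞) a := α.contDiff_normed
  obtain ⟨A, hA⟩ := (has.continuous_deriv (by simp)).bounded_above_of_compact_support
    (α.hasCompactSupport_normed (μ := volume)).deriv
  refine ⟨A, (norm_nonneg _).trans (hA 0), fun δ hδ => ?_⟩
  let ω : ContDiffBump (0 : Euc N) := ⟨δ / 2, δ, by positivity, by linarith⟩
  set b : Euc N → ℝ := ω.normed volume with hb
  have hbs : ContDiff ℝ (⊤ : ℕ∞) b := ω.contDiff_normed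
  have ha0 : ∀ x ∉ closedBall (0 : ℝ) ε, a x = 0 := fun x hx => by
    rw [← Function.notMem_support, α.support_normed_eq]
    exact fun h => hx (ball_subset_closedBall h)
  have hb0 : ∀ y ∉ closedBall (0 : Euc N) δ, b y = 0 := fun y hy => by
    rw [← Function.notMem_support, ω.support_normed_eq]
    exact fun h => hy (ball_subset_closedBall h)
  have hz : ∀ p ∉ closedBall (0 : ℝ) ε ×ˢ closedBall (0 : Euc N) δ, a p.1 * b p.2 = 0 := by
    intro p hp
    by_cases h : p.1 ∈ closedBall (0 : ℝ) ε
    · rw [hb0 p.2 fun h' => hp ⟨h, h'⟩, mul_zero]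
    · rw [ha0 p.1 h, zero_mul]
  have hK : IsCompact (closedBall (0 : ℝ) ε ×ˢ closedBall (0 : Euc N) δ) :=
    (isCompact_closedBall _ _).prod (isCompact_closedBall _ _)
  refine ⟨fun p => a p.1 * b p.2, b, (has.comp contDiff_fst).mul (hbs.comp contDiff_snd),
    HasCompactSupport.intro hK hz, fun p => mul_nonneg (α.nonneg_normed _) (ω.nonneg_normed _),
    closure_minimal (fun p hp => by_contra fun h => hp (hz p h)) hK.isClosed, ?_,
    hbs.continuous, ω.nonneg_normed, ω.integrable_normed, ω.integral_normed, fun p => ?_, hb0⟩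
  · rw [Measure.volume_eq_prod, integral_prod_mul, ha, hb, α.integral_normed, ω.integral_normed,
      one_mul]
  · rw [dX_prod_mul (has.differentiable (by simp)) (hbs.differentiable (by simp)), abs_mul,
      abs_of_nonneg (ω.nonneg_normed p.2)]
    exact mul_le_mul_of_nonneg_right (hA p.1) (ω.nonneg_normed p.2)

theorem dX_add_const (f : ℝ × Euc N → ℝ) (κ : ℝ) (p : ℝ × Euc N) :
    dX (fun p => f p + κ) p = dX f p := by
  simp [dX, fderiv_add_const]

theorem lapY_add_const (f : ℝ × Euc N → ℝ) (κ : ℝ) (p : ℝ × Euc N) :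
    lapY (fun p => f p + κ) p = lapY f p := by
  simp [lapY, fderiv_add_const]

/-- Bounded nonnegative distributional solutions are uniform limits of near solutions. -/
theorem IsDistribSolution.exists_isNearSolution {β β' : Euc N → ℝ} {B L R₁ R₂ : ℝ}
    (hβ' : Continuous β') (hB : ∀ y, |β' y| ≤ B) (hL0 : 0 ≤ L)
    (hL : ∀ y y', |β' y - β' y'| ≤ L * ‖y - y'‖) (hR : R₁ < R₂) (hR₂ : R₂ < 3)
    (hββ' : ∀ y ∈ closedBall (0 : Euc N) R₂, β y = β' y) {γ u : ℝ × Euc N → ℝ}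
    (hγ : Measurable γ) (hγ1 : ∀ᵐ p ∂(volume.restrict (cylD N)), |γ p| ≤ 1)
    (hu : ContinuousOn u (cylD N)) (hu0 : ∀ p ∈ cylD N, 0 ≤ u p) {K : ℝ}
    (huK : ∀ p ∈ cylD N, u p ≤ K) (h : IsDistribSolution (cylD N) β γ u) {η : ℝ} (hη : 0 < η) :
    ∃ U, IsNearSolution β' (Icc (-4 : ℝ) 5 ×ˢ closedBall 0 R₁) U ∧
      ∀ p ∈ Icc (-1 : ℝ) 2 ×ˢ closedBall (0 : Euc N) 1, |U p - u p| ≤ η := by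
  have hSo : IsOpen (cylD N) := isOpen_Ioo.prod isOpen_ball
  have hSm : MeasurableSet (cylD N) := hSo.measurableSet
  have hmem0 : (0 : ℝ × Euc N) ∈ cylD N := ⟨by constructor <;> norm_num, by simp⟩
  have hK0 : 0 ≤ K := (hu0 0 hmem0).trans (huK 0 hmem0)
  have hfin : volume (cylD N) ≠ ⊤ := by
    rw [cylD, Measure.volume_eq_prod, Measure.prod_prod]
    exact ENNReal.mul_ne_top (by simp) measure_ball_lt_top.ne
  have hui : IntegrableOn u (cylD N) := by
    have : IsFiniteMeasure (volume.restrict (cylD N)) := ⟨by simpa using hfin.lt_top⟩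
    refine Integrable.of_bound (hu.aestronglyMeasurable hSm) K ?_
    refine (ae_restrict_iff' hSm).2 (Eventually.of_forall fun p hp => ?_)
    rw [Real.norm_eq_abs, abs_of_nonneg (hu0 p hp)]
    exact huK p hp
  set w : ℝ × Euc N → ℝ := (cylD N).indicator u with hw
  have hwi : Integrable w := (integrable_indicator_iff hSm).2 hui
  have hwl : LocallyIntegrable w := hwi.locallyIntegrable
  have hw0 : ∀ p, 0 ≤ w p := fun p => indicator_nonneg hu0 p
  have hwK : ∀ p, w p ≤ K := fun p => indicator_le' huK (fun _ _ => hK0) p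
  have hwm : ∀ f : ℝ × Euc N → ℝ, (fun q => w q * f q) =
      (cylD N).indicator fun q => u q * f q := fun f => by
    ext q
    by_cases hq : q ∈ cylD N <;> simp [hw, hq]
  have hconv : ∀ f : ℝ × Euc N → ℝ, ∫ q, w q * f q = ∫ q in cylD N, u q * f q := fun f => by
    rw [hwm, integral_indicator hSm]
  have hconvi : ∀ f : ℝ × Euc N → ℝ, Integrable (fun q => w q * f q) →
      IntegrableOn (fun q => u q * f q) (cylD N) := fun f hf => by
    rwa [hwm, integrable_indicator_iff hSm] at hf
  -- uniform continuity near the region of approximation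
  have hTc : IsCompact (Icc (-2 : ℝ) 3 ×ˢ closedBall (0 : Euc N) 2) :=
    isCompact_Icc.prod (isCompact_closedBall _ _)
  have hTS : Icc (-2 : ℝ) 3 ×ˢ closedBall (0 : Euc N) 2 ⊆ cylD N :=
    prod_mono (fun x hx => ⟨by linarith [hx.1], by linarith [hx.2]⟩)
      (closedBall_subset_ball (by norm_num))
  obtain ⟨ε₀, hε₀, hunif⟩ := Metric.uniformContinuousOn_iff.1
    (hTc.uniformContinuousOn_of_continuous (hu.mono hTS)) (η / 2) (by positivity)
  set ε : ℝ := min (1 / 2) (ε₀ / 2) with hε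
  have hε0 : 0 < ε := by positivity
  have hε1 : ε ≤ 1 / 2 := min_le_left _ _
  have hε2 : ε < ε₀ := (min_le_right _ _).trans_lt (by linarith)
  obtain ⟨A, hA0, hker⟩ := exists_anisotropic_kernel N hε0
  set κ : ℝ := η / 2 with hκ
  have hκ0 : 0 < κ := by positivity
  have hRR : 0 < R₂ - R₁ := by linarith
  set δ : ℝ := min ε (min (R₂ - R₁) (κ / (11 * (K * L * A) + 1))) with hδ
  have hδ0 : 0 < δ := by positivity
  have hδε : δ ≤ ε := min_le_left _ _
  have hδR : δ ≤ R₂ - R₁ := (min_le_right _ _).trans (min_le_left _ _)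
  have hδκ : K * L * δ * A * 11 ≤ κ := by
    have : δ ≤ κ / (11 * (K * L * A) + 1) := (min_le_right _ _).trans (min_le_right _ _)
    rw [le_div_iff₀ (by positivity)] at this
    linarith
  obtain ⟨φ, b, hφ, hφc, hφ0, hφt, hφi, hbc, hb0, hbi, hbi1, hdφ, hbz⟩ := hker δ hδ0
  have hφ2 : ContDiff ℝ 2 φ := contDiff_infty.1 hφ 2
  have hφint : Integrable φ := hφ.continuous.integrable_of_hasCompactSupport hφc
  have hφpi : ∀ p, Integrable fun q => φ (p - q) := fun p => hφint.comp_sub_left p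
  have hφp1 : ∀ p, ∫ q, φ (p - q) = 1 := fun p => by
    rw [integral_sub_left_eq_self φ volume p, hφi]
  have hwφ : ∀ p, Integrable fun q => w q * φ (p - q) := fun p =>
    integrable_mul_comp_sub hwl hφ.continuous hφc p
  refine ⟨fun p => (∫ q, w q * φ (p - q)) + κ, ⟨?_, fun p => ?_, ⟨K + κ, fun p => ?_⟩,
    fun p hp => ?_⟩, fun p hp => ?_⟩
  · exact (contDiff_mollify (n := 2) hwl hφ2 hφc).add contDiff_const
  · exact add_nonneg (integral_nonneg fun q => mul_nonneg (hw0 q) (hφ0 _)) hκ0.le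
  · have : ∫ q, w q * φ (p - q) ≤ ∫ q, K * φ (p - q) :=
      integral_mono (hwφ p) ((hφpi p).const_mul K) fun q =>
        mul_le_mul_of_nonneg_right (hwK q) (hφ0 _)
    rw [integral_const_mul, hφp1] at this
    linarith
  · obtain ⟨hp1, hp2⟩ := hp
    rw [mem_closedBall_zero_iff] at hp2
    rw [dX_add_const, lapY_add_const, dX_mollify hwl (hφ2.of_le (by norm_num)) hφc,
      lapY_mollify hwl hφ2 hφc]
    have hclose : ∀ q, p.2 - q ∈ closedBall (0 : Euc N) δ → q ∈ closedBall (0 : Euc N) R₂ := by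
      intro q hq
      rw [mem_closedBall_zero_iff] at hq ⊢
      have : ‖q‖ ≤ ‖p.2‖ + ‖p.2 - q‖ := by
        have := norm_sub_le p.2 (p.2 - q)
        rwa [sub_sub_cancel] at this
      linarith
    have heq := h.integral_kernel_eq_zero hφ hφc (p := p) (fun q hq => by
      have hq' := hφt hq
      refine ⟨?_, ?_⟩
      · have := hq'.1
        rw [mem_closedBall_zero_iff, Real.norm_eq_abs, Prod.fst_sub, abs_le] at this
        constructor <;> linarith [hp1.1, hp1.2, this.1, this.2]
      · have := mem_closedBall_zero_iff.1 (hclose q.2 hq'.2)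
        rw [mem_ball_zero_iff]
        linarith)
    have hdXc : Continuous (dX φ) := continuous_dX hφ2
    have hdXs : HasCompactSupport (dX φ) := hφc.fderiv_apply ℝ _
    have hlc : Continuous (lapY φ) := continuous_lapY hφ2
    have hls : HasCompactSupport (lapY φ) := by
      refine HasCompactSupport.intro hφc fun q hq => ?_
      have hq' : φ =ᶠ[𝓝 q] 0 := notMem_tsupport_iff_eventuallyEq.1 hq
      simp only [lapY]
      refine Finset.sum_eq_zero fun i _ => ?_
      have h1 : (fun q => fderiv ℝ φ q ((0 : ℝ), EuclideanSpace.single i (1 : ℝ))) =ᶠ[𝓝 q] 0 := by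
        filter_upwards [hq'.eventuallyEq_nhds] with q' hq''
        rw [hq''.fderiv_eq]
        simp
      rw [h1.fderiv_eq]
      simp
    have i1 := hconvi _ (integrable_mul_comp_sub hwl hlc hls p)
    have i2 := hconvi _ (integrable_mul_comp_sub hwl hdXc hdXs p)
    have i4 := hconvi _ (hwφ p)
    have i3 : IntegrableOn (fun q => β' q.2 * (u q * dX φ (p - q))) (cylD N) :=
      Integrable.bdd_mul (c := B) i2
        (hβ'.comp continuous_snd).aestronglyMeasurable (Eventually.of_forall fun q => hB q.2)
    have i5 : IntegrableOn (fun q => γ q * (u q * φ (p - q))) (cylD N) :=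
      Integrable.bdd_mul (c := 1) i4 hγ.aestronglyMeasurable hγ1
    have heq' : ∫ q in cylD N, (u q * lapY φ (p - q) + β' q.2 * (u q * dX φ (p - q)) +
        γ q * (u q * φ (p - q))) = 0 := by
      rw [← heq]
      refine integral_congr_ae (Eventually.of_forall fun q => ?_)
      simp only
      by_cases hq : p.2 - q.2 ∈ closedBall (0 : Euc N) δ
      · rw [hββ' _ (hclose _ hq)]
        ring
      · have : dX φ (p - q) = 0 := by
          have h1 := hdφ (p - q)
          rw [Prod.snd_sub, hbz _ hq, mul_zero] at h1
          exact abs_nonpos_iff.1 h1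
        rw [this]
        ring
    have hid : (∫ q, w q * lapY φ (p - q)) + β' p.2 * ∫ q, w q * dX φ (p - q) =
        ∫ q in cylD N, (β' p.2 * (u q * dX φ (p - q)) - β' q.2 * (u q * dX φ (p - q)) -
          γ q * (u q * φ (p - q))) := by
      have i13 : IntegrableOn (fun q => u q * lapY φ (p - q) + β' q.2 * (u q * dX φ (p - q)))
        (cylD N) := i1.add i3
      have i23 : IntegrableOn (fun q => β' p.2 * (u q * dX φ (p - q)) -
        β' q.2 * (u q * dX φ (p - q))) (cylD N) := (i2.const_mul _).sub i3
      rw [hconv, hconv, integral_sub i23 i5, integral_sub (i2.const_mul _) i3,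
        integral_const_mul]
      rw [integral_add i13 i5, integral_add i1 i3] at heq'
      linarith
    have hbp : Integrable fun y => b (p.2 - y) := hbi.comp_sub_left p.2
    have hbS : IntegrableOn (fun q : ℝ × Euc N => b (p.2 - q.2)) (cylD N) := by
      have h1 : IntegrableOn (fun _ : ℝ => (1 : ℝ)) (Ioo (-5 : ℝ) 6) := integrableOn_const (by simp)
      have := Integrable.mul_prod (f := fun _ : ℝ => (1 : ℝ)) (g := fun y => b (p.2 - y))
        h1 (hbp.integrableOn (s := ball (0 : Euc N) 3))
      rw [Measure.prod_restrict] at this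
      simpa [IntegrableOn, cylD, Measure.volume_eq_prod] using this
    have hbS1 : ∫ q in cylD N, b (p.2 - q.2) ≤ 11 := by
      have h1 := setIntegral_prod_mul (μ := volume) (ν := volume) (fun _ : ℝ => (1 : ℝ))
        (fun y => b (p.2 - y)) (Ioo (-5 : ℝ) 6) (ball (0 : Euc N) 3)
      have h2 : ∫ y in ball (0 : Euc N) 3, b (p.2 - y) ≤ 1 := by
        refine (setIntegral_le_integral hbp (Eventually.of_forall fun y => hb0 _)).trans_eq ?_
        rw [integral_sub_left_eq_self b volume p.2, hbi1]
      have h3 : ∫ _ in Ioo (-5 : ℝ) 6, (1 : ℝ) = 11 := by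
        simp
        norm_num
      rw [h3] at h1
      simp only [one_mul] at h1
      rw [cylD, Measure.volume_eq_prod, h1]
      linarith
    rw [hid, hconv]
    have hbound := norm_integral_le_of_norm_le (μ := volume.restrict (cylD N))
      (f := fun q => β' p.2 * (u q * dX φ (p - q)) - β' q.2 * (u q * dX φ (p - q)) -
          γ q * (u q * φ (p - q)))
      (g := fun q => K * L * δ * A * b (p.2 - q.2) + u q * φ (p - q))
      ((hbS.const_mul _).add i4) (by
        filter_upwards [hγ1, ae_restrict_mem hSm] with q hq hqS
        have hu0q := hu0 q hqS
        have huKq := huK q hqS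
        have hφq := hφ0 (p - q)
        rw [Real.norm_eq_abs, ← sub_mul]
        refine (abs_sub _ _).trans (add_le_add ?_ ?_)
        · rw [abs_mul, abs_mul, abs_of_nonneg hu0q]
          by_cases hq2 : p.2 - q.2 ∈ closedBall (0 : Euc N) δ
          · have e1 : |β' p.2 - β' q.2| ≤ L * δ := (hL _ _).trans
              (mul_le_mul_of_nonneg_left (mem_closedBall_zero_iff.1 hq2) hL0)
            have e2 := hdφ (p - q)
            have e3 := hb0 (p.2 - q.2)
            calc _ ≤ L * δ * (K * (A * b (p - q).2)) := by gcongr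
              _ = _ := by
                rw [Prod.snd_sub]
                ring
          · have e1 : |dX φ (p - q)| = 0 := by
              have h1 := hdφ (p - q)
              rw [Prod.snd_sub, hbz _ hq2, mul_zero] at h1
              exact le_antisymm h1 (abs_nonneg _)
            rw [e1, hbz _ hq2]
            simp
        · rw [abs_mul, abs_of_nonneg (mul_nonneg hu0q hφq)]
          exact mul_le_of_le_one_left (mul_nonneg hu0q hφq) hq)
    rw [Real.norm_eq_abs, integral_add (hbS.const_mul _) i4, integral_const_mul] at hbound
    have : K * L * δ * A * ∫ q in cylD N, b (p.2 - q.2) ≤ K * L * δ * A * 11 :=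
      mul_le_mul_of_nonneg_left hbS1 (by positivity)
    linarith
  · obtain ⟨hp1, hp2⟩ := hp
    rw [mem_closedBall_zero_iff] at hp2
    have hpT : p ∈ Icc (-2 : ℝ) 3 ×ˢ closedBall (0 : Euc N) 2 :=
      ⟨⟨by linarith [hp1.1], by linarith [hp1.2]⟩, mem_closedBall_zero_iff.2 (by linarith)⟩
    have hdiff : (∫ q, w q * φ (p - q)) - u p = ∫ q, (w q * φ (p - q) - u p * φ (p - q)) := by
      rw [integral_sub (hwφ p) ((hφpi p).const_mul _), integral_const_mul, hφp1, mul_one]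
    have hbound := norm_integral_le_of_norm_le (μ := volume)
      (f := fun q => w q * φ (p - q) - u p * φ (p - q)) (g := fun q => η / 2 * φ (p - q))
      ((hφpi p).const_mul _) (Eventually.of_forall fun q => by
        have hφq := hφ0 (p - q)
        rw [← sub_mul, Real.norm_eq_abs, abs_mul, abs_of_nonneg hφq]
        by_cases hq : p - q ∈ tsupport φ
        · refine mul_le_mul_of_nonneg_right ?_ hφq
          obtain ⟨h1, h2⟩ := hφt hq
          rw [mem_closedBall_zero_iff] at h1 h2
          rw [Prod.fst_sub] at h1
          rw [Prod.snd_sub] at h2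
          have h1' := abs_le.1 h1
          have hqn : ‖q.2‖ ≤ ‖p.2‖ + ‖p.2 - q.2‖ := by
            have := norm_sub_le p.2 (p.2 - q.2)
            rwa [sub_sub_cancel] at this
          have hqT : q ∈ Icc (-2 : ℝ) 3 ×ˢ closedBall (0 : Euc N) 2 :=
            ⟨⟨by linarith [hp1.2, h1'.2, hp1.1], by linarith [hp1.2, h1'.1]⟩,
              mem_closedBall_zero_iff.2 (by linarith)⟩
          have hwq : w q = u q := indicator_of_mem (hTS hqT) u
          rw [hwq]
          refine (hunif q hqT p hpT ?_).le
          rw [dist_comm, Prod.dist_eq, dist_eq_norm, dist_eq_norm]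
          exact max_lt (by linarith) (by linarith)
        · rw [image_eq_zero_of_notMem_tsupport hq]
          simp)
    rw [Real.norm_eq_abs, ← hdiff, integral_const_mul, hφp1] at hbound
    have h1 := abs_le.1 hbound
    rw [abs_le]
    constructor <;> linarith [h1.1, h1.2]

end Approximation

section Harnack

variable {N : ℕ}

/-- A function smooth on `B_3(0)` agrees on a smaller ball with a bounded Lipschitz function. -/
theorem exists_lipschitz_extension {β : Euc N → ℝ}
    (hβ : ContDiffOn ℝ (⊤ : ℕ∞) β (ball (0 : Euc N) 3)) {R : ℝ} (hR0 : 0 < R) (hR : R < 3) :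
    ∃ (β' : Euc N → ℝ) (B L : ℝ), Continuous β' ∧ (∀ y, |β' y| ≤ B) ∧ 0 ≤ L ∧
      (∀ y y', |β' y - β' y'| ≤ L * ‖y - y'‖) ∧ ∀ y ∈ closedBall (0 : Euc N) R, β y = β' y := by
  let χ : ContDiffBump (0 : Euc N) := ⟨R, (R + 3) / 2, hR0, by linarith⟩
  have hχ : tsupport χ ⊆ ball 0 3 := by
    rw [χ.tsupport_eq]
    exact closedBall_subset_ball (show (R + 3) / 2 < 3 by linarith)
  have hs : ContDiff ℝ 1 fun y => χ y * β y := by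
    rw [contDiff_iff_contDiffAt]
    intro y
    by_cases hy : y ∈ ball (0 : Euc N) 3
    · exact χ.contDiff.contDiffAt.mul
        ((contDiffOn_infty.1 hβ 1).contDiffAt (isOpen_ball.mem_nhds hy))
    · have hz : (fun y => χ y * β y) =ᶠ[𝓝 y] fun _ => 0 := by
        filter_upwards [notMem_tsupport_iff_eventuallyEq.1 fun h => hy (hχ h)] with y' hy'
        rw [hy', Pi.zero_apply, zero_mul]
      exact contDiffAt_const.congr_of_eventuallyEq hz
  have hc : HasCompactSupport fun y => χ y * β y := χ.hasCompactSupport.mul_right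
  obtain ⟨B, hB⟩ := hs.continuous.bounded_above_of_compact_support hc
  obtain ⟨L, hL⟩ := hs.lipschitzWith_of_hasCompactSupport hc (by norm_num)
  refine ⟨_, B, L, hs.continuous, hB, L.2, fun y y' => ?_, fun y hy => ?_⟩
  · have := hL.dist_le_mul y y'
    rwa [Real.dist_eq, dist_eq_norm] at this
  · rw [χ.one_of_mem_closedBall hy, one_mul]

/-- The integral of a solution along a horizontal segment is controlled by its value at any point
of the inner cylinder. -/
theorem exists_integral_le_mul {β : Euc N → ℝ}
    (hβsmooth : ContDiffOn ℝ (⊤ : ℕ∞) β (ball (0 : Euc N) 3))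
    (hβneg : ∃ y ∈ ball (0 : Euc N) 1, β y < 0) (hβpos : ∃ y ∈ ball (0 : Euc N) 1, 0 < β y) :
    ∃ C > (0 : ℝ), ∀ γ : ℝ × Euc N → ℝ, Measurable γ →
      (∀ᵐ p ∂(volume.restrict (cylD N)), |γ p| ≤ 1) →
      ∀ u : ℝ × Euc N → ℝ, ContinuousOn u (cylD N) → (∀ p ∈ cylD N, 0 ≤ u p) →
      (∃ K : ℝ, ∀ p ∈ cylD N, u p ≤ K) → IsDistribSolution (cylD N) β γ u →
      ∀ y₀ ∈ ball (0 : Euc N) 1, ∀ p ∈ Icc (0 : ℝ) 1 ×ˢ ball (0 : Euc N) 1,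
        ∫ x in Icc (-1 / 3 : ℝ) (4 / 3), u (x, y₀) ≤ C * u p := by
  obtain ⟨ym, hym, hm⟩ := hβneg
  obtain ⟨yp, hyp, hp⟩ := hβpos
  rw [mem_ball_zero_iff] at hym hyp
  set R : ℝ := max ‖yp‖ ‖ym‖ with hRdef
  have hR : R < 1 := max_lt hyp hym
  have hypR : ‖yp‖ ≤ R := le_max_left _ _
  have hymR : ‖ym‖ ≤ R := le_max_right _ _
  have hR0 : 0 ≤ R := (norm_nonneg _).trans hypR
  obtain ⟨β', B, L, hβ', hB, hL0, hL, hββ'⟩ :=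
    exists_lipschitz_extension hβsmooth (R := (5 + R) / 2) (by linarith) (by linarith)
  rw [hββ' ym (mem_closedBall_zero_iff.2 (by linarith))] at hm
  rw [hββ' yp (mem_closedBall_zero_iff.2 (by linarith))] at hp
  obtain ⟨C, hC, hmain⟩ :=
    IsNearSolution.exists_average_le hβ' hB hL0 hL hR hypR hymR hp hm
  refine ⟨C, hC, fun γ hγ hγ1 u hu hu0 ⟨K, huK⟩ h y₀ hy₀ p hpm => ?_⟩
  have hIvol : volume.real (Icc (-1 / 3 : ℝ) (4 / 3)) = 5 / 3 := by
    rw [Real.volume_real_Icc]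
    norm_num
  refine le_of_forall_pos_le_add fun ε hε => ?_
  have hC2 : 0 < C + 2 := by linarith
  obtain ⟨U, hU, hUu⟩ := h.exists_isNearSolution hβ' hB hL0 hL (R₁ := 2 + R)
    (by linarith) (by linarith) hββ' hγ hγ1 hu hu0 huK (η := ε / (C + 2)) (by positivity)
  have hη : (C + 2) * (ε / (C + 2)) = ε := by field_simp
  have hη0 : 0 < ε / (C + 2) := by positivity
  have hUc : Continuous fun x => U (x, y₀) :=
    hU.contDiff.continuous.comp (Continuous.prodMk_left y₀)
  have huI : IntegrableOn (fun x => u (x, y₀)) (Icc (-1 / 3 : ℝ) (4 / 3)) := by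
    refine (hu.comp (Continuous.prodMk_left y₀).continuousOn fun x hx => ?_).integrableOn_Icc
    exact ⟨⟨by linarith [hx.1], by linarith [hx.2]⟩, ball_subset_ball (by norm_num) hy₀⟩
  have hUI : IntegrableOn (fun x => U (x, y₀)) (Icc (-1 / 3 : ℝ) (4 / 3)) :=
    hUc.continuousOn.integrableOn_Icc
  have hcI : IntegrableOn (fun _ => ε / (C + 2)) (Icc (-1 / 3 : ℝ) (4 / 3)) :=
    continuousOn_const.integrableOn_Icc
  have hle : ∫ x in Icc (-1 / 3 : ℝ) (4 / 3), u (x, y₀) ≤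
      (∫ x in Icc (-1 / 3 : ℝ) (4 / 3), U (x, y₀)) + 5 / 3 * (ε / (C + 2)) := by
    have h1 : ∫ x in Icc (-1 / 3 : ℝ) (4 / 3), u (x, y₀) ≤
        ∫ x in Icc (-1 / 3 : ℝ) (4 / 3), (U (x, y₀) + ε / (C + 2)) := by
      refine setIntegral_mono_on huI (hUI.add hcI) measurableSet_Icc fun x hx => ?_
      have := (abs_le.1 (hUu (x, y₀) ⟨⟨by linarith [hx.1], by linarith [hx.2]⟩,
        ball_subset_closedBall hy₀⟩)).1
      linarith
    rwa [integral_add hUI hcI, setIntegral_const, hIvol, smul_eq_mul] at h1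
  have hUp := (abs_le.1 (hUu p ⟨⟨by linarith [hpm.1.1], by linarith [hpm.1.2]⟩,
    ball_subset_closedBall hpm.2⟩)).2
  have hUp' : C * U p ≤ C * (u p + ε / (C + 2)) := mul_le_mul_of_nonneg_left (by linarith) hC.le
  have := hmain U hU y₀ hy₀ p hpm
  nlinarith

end Harnack

/-- In the normalized setting, fix `z ∈ (0, 1/3]` and let `v(x,y) := ∫_{−z}^{z} u(x+s,y) ds`.
Then there is `C̃ ≥ 1`, depending only on `N`, `z` and `β` (not on `γ` or `u`), with
`sup_{[0,1]×B_1(0)} v ≤ C̃ · inf_{[0,1]×B_1(0)} u`. -/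
theorem sup_average_le_inf
    (N : ℕ) (hN : 2 ≤ N)
    (β : Euc N → ℝ) (hβsmooth : ContDiffOn ℝ (⊤ : ℕ∞) β (ball (0 : Euc N) 3))
    (hβbdd : ∀ k : ℕ, ∃ M : ℝ, ∀ y ∈ ball (0 : Euc N) 3,
      ‖iteratedFDerivWithin ℝ k β (ball (0 : Euc N) 3) y‖ ≤ M)
    (hβneg : ∃ y ∈ ball (0 : Euc N) 1, β y < 0)
    (hβpos : ∃ y ∈ ball (0 : Euc N) 1, 0 < β y)
    (z : ℝ) (hz : z ∈ Ioc (0 : ℝ) (1 / 3)) :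
    ∃ C ≥ (1 : ℝ),
      ∀ γ : ℝ × Euc N → ℝ, Measurable γ →
        (∀ᵐ p ∂(volume.restrict (cylD N)), |γ p| ≤ 1) →
      ∀ u : ℝ × Euc N → ℝ, ContinuousOn u (cylD N) →
        (∀ p ∈ cylD N, 0 ≤ u p) →
        (∃ K : ℝ, ∀ p ∈ cylD N, u p ≤ K) →
        IsDistribSolution (cylD N) β γ u →
        sSup ((fun p : ℝ × Euc N => ∫ s in (-z)..z, u (p.1 + s, p.2)) ''
            (Icc (0 : ℝ) 1 ×ˢ ball (0 : Euc N) 1))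
          ≤ C * sInf (u '' (Icc (0 : ℝ) 1 ×ˢ ball (0 : Euc N) 1)) := by
  obtain ⟨C, hC, hmain⟩ := exists_integral_le_mul hβsmooth hβneg hβpos
  refine ⟨max C 1, le_max_right _ _, fun γ hγ hγ1 u hu hu0 huK h => ?_⟩
  have hne : (Icc (0 : ℝ) 1 ×ˢ ball (0 : Euc N) 1).Nonempty := ⟨(0, 0), by simp⟩
  have hC1 : 0 < max C 1 := lt_max_of_lt_left hC
  refine csSup_le (hne.image _) ?_
  rintro _ ⟨⟨x₀, y₀⟩, ⟨hx₀, hy₀⟩, rfl⟩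
  rw [← div_le_iff₀' hC1]
  refine le_csInf (hne.image _) ?_
  rintro _ ⟨p, hp, rfl⟩
  have hp' : p ∈ cylD N :=
    ⟨⟨by linarith [hp.1.1], by linarith [hp.1.2]⟩, ball_subset_ball (by norm_num) hp.2⟩
  rw [div_le_iff₀' hC1]
  refine le_trans ?_ (mul_le_mul_of_nonneg_right (le_max_left C 1) (hu0 p hp'))
  refine le_trans ?_ (hmain γ hγ hγ1 u hu hu0 huK h y₀ hy₀ p hp)
  have hcyl : ∀ x ∈ Icc (-1 / 3 : ℝ) (4 / 3), (x, y₀) ∈ cylD N := fun x hx =>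
    ⟨⟨by linarith [hx.1], by linarith [hx.2]⟩, ball_subset_ball (by norm_num) hy₀⟩
  change ∫ s in (-z)..z, u (x₀ + s, y₀) ≤ _
  rw [intervalIntegral.integral_comp_add_left (fun x => u (x, y₀)) x₀,
    intervalIntegral.integral_of_le (by linarith [hz.1])]
  refine setIntegral_mono_set
    (hu.comp (Continuous.prodMk_left y₀).continuousOn hcyl).integrableOn_Icc ?_ ?_
  · filter_upwards [ae_restrict_mem measurableSet_Icc] with x hx using hu0 _ (hcyl x hx)
  · refine Eventually.of_forall fun x hx => ?_
    exact ⟨by linarith [hx.1, hx₀.1, hz.2], by linarith [hx.2, hx₀.2, hz.2]⟩
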